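/- arXiv:1611.02878 — 6 statements merged into one kernel-verified Lean document; each statement's English description precedes it below -/
import Mathlib

section
/- Let g = Σ_α c_α x^α ∈ K[x_1,…,x_m] be a nonzero polynomial and let w ∈ ℝ^m with w_j ∈ ν(Kˣ) for every j. If the minimum defining trop(g)(w) = min{w·α + ν(c_α) : c_α ≠ 0} is attained at at least two distinct exponents α (i.e. the initial form of g at w is not a monomial), then there exists z ∈ (Kˣ)^m with ν(z_j) = w_j for all j and ν(g(z)) > trop(g)(w). -/
open scoped Pointwise

namespace TropPaper

variable {K : Type*} [Field K]

/-- The weighted valued degree `w·α + ν(c_α)` of the term of `g` with exponent `α`. -/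
noncomputable def tropTerm {m : ℕ} (ν : K → WithTop ℝ) (g : MvPolynomial (Fin m) K)
    (w : Fin m → ℝ) (α : Fin m →₀ ℕ) : WithTop ℝ :=
  ((∑ j, w j * (α j : ℝ) : ℝ) : WithTop ℝ) + ν (MvPolynomial.coeff α g)

/-- `trop(g)(w) = min { w·α + ν(c_α) : c_α ≠ 0 }`. -/
noncomputable def tropMin {m : ℕ} (ν : K → WithTop ℝ) (g : MvPolynomial (Fin m) K)
    (w : Fin m → ℝ) : WithTop ℝ :=
  g.support.inf (tropTerm ν g w)

end TropPaper

open TropPaper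

/-- The residue field of an integrally closed local domain whose fraction field is algebraically
closed is algebraically closed. -/
theorem IsLocalRing.isAlgClosed_residueField (R K : Type*) [CommRing R] [IsDomain R]
    [IsLocalRing R] [IsIntegrallyClosed R] [Field K] [Algebra R K] [IsFractionRing R K]
    [IsAlgClosed K] : IsAlgClosed (IsLocalRing.ResidueField R) := by
  refine IsAlgClosed.of_exists_root _ fun p hp hirr => ?_
  obtain ⟨q, hqp, hdeg, hq⟩ := Polynomial.lifts_and_natDegree_eq_and_monic
    (Polynomial.map_surjective _ IsLocalRing.residue_surjective p :
      p ∈ Polynomial.lifts (IsLocalRing.residue R)) hp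
  obtain ⟨x, hx⟩ := IsAlgClosed.exists_root (q.map (algebraMap R K)) (by
    rw [hq.degree_map, Polynomial.degree_eq_natDegree hq.ne_zero, hdeg]
    exact_mod_cast hirr.natDegree_pos.ne')
  have hx' : Polynomial.eval₂ (algebraMap R K) x q = 0 := by
    rw [← Polynomial.eval_map]; exact hx
  obtain ⟨y, rfl⟩ := IsIntegrallyClosed.isIntegral_iff.mp (⟨q, hq, hx'⟩ : IsIntegral R x)
  rw [Polynomial.eval₂_at_apply] at hx'
  have hy : q.eval y = 0 := IsFractionRing.injective R K (by rw [hx', map_zero])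
  exact ⟨IsLocalRing.residue R y, by rw [← hqp, Polynomial.eval_map_apply, hy, map_zero]⟩

/-- Over an algebraically closed field a univariate polynomial with at least two terms has a
nonzero root. -/
theorem Polynomial.exists_ne_zero_isRoot {k : Type*} [Field k] [IsAlgClosed k]
    (p : Polynomial k) {a b : ℕ} (hab : a ≠ b) (ha : p.coeff a ≠ 0) (hb : p.coeff b ≠ 0) :
    ∃ x, x ≠ 0 ∧ p.IsRoot x := by
  have hp : p ≠ 0 := by rintro rfl; simp at ha
  obtain ⟨q, hq, hdvd⟩ := p.exists_eq_pow_rootMultiplicity_mul_and_not_dvd hp 0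
  set n := p.rootMultiplicity 0
  rw [map_zero, sub_zero] at hq hdvd
  have hdeg : q.degree ≠ 0 := by
    intro h
    rw [Polynomial.eq_C_of_degree_eq_zero h, mul_comm] at hq
    rw [hq, Polynomial.coeff_C_mul_X_pow] at ha hb
    simp only [ne_eq, ite_eq_right_iff, Classical.not_imp] at ha hb
    exact hab (ha.1.trans hb.1.symm)
  obtain ⟨x, hx⟩ := IsAlgClosed.exists_root q hdeg
  refine ⟨x, ?_, ?_⟩
  · rintro rfl
    exact hdvd (Polynomial.X_dvd_iff.mpr (by rw [Polynomial.coeff_zero_eq_eval_zero]; exact hx))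
  · rw [hq, Polynomial.IsRoot.def, Polynomial.eval_mul, hx.eq_zero, mul_zero]

/-- Over an algebraically closed field a multivariate polynomial with at least two terms has a
root with all coordinates nonzero. -/
theorem MvPolynomial.exists_forall_ne_zero_eval_eq_zero {k σ : Type*} [Field k] [IsAlgClosed k]
    [Fintype σ] (p : MvPolynomial σ k) {α β : σ →₀ ℕ} (hαβ : α ≠ β)
    (hα : α ∈ p.support) (hβ : β ∈ p.support) :
    ∃ z : σ → k, (∀ j, z j ≠ 0) ∧ MvPolynomial.eval z p = 0 := by
  classical
  obtain ⟨j, hj⟩ := DFunLike.ne_iff.mp hαβ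
  -- the part of `p` of degree `i` in the variable `j`
  let A : ℕ → MvPolynomial σ k := fun i =>
    ∑ γ ∈ p.support with γ j = i, monomial γ (p.coeff γ)
  have hA : ∀ γ ∈ p.support, A (γ j) ≠ 0 := by
    intro γ hγ h
    have h' := congrArg (MvPolynomial.coeff γ) h
    simp only [A, coeff_sum, coeff_monomial, coeff_zero] at h'
    rw [Finset.sum_ite_eq', if_pos (by simpa using hγ)] at h'
    exact MvPolynomial.mem_support_iff.mp hγ h'
  have hinf : ({0}ᶜ : Set k).Infinite := (Set.finite_singleton 0).infinite_compl
  obtain ⟨y, hy0, hy⟩ : ∃ y : σ → k, (∀ i, y i ≠ 0) ∧ eval y (A (α j) * A (β j)) ≠ 0 := by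
    by_contra! h
    refine mul_ne_zero (hA α hα) (hA β hβ)
      (MvPolynomial.funext_set (fun _ => ({0}ᶜ : Set k)) (fun _ => hinf) fun x hx => ?_)
    rw [map_zero]
    exact h x fun i => hx i trivial
  rw [map_mul] at hy
  let q : Polynomial k :=
    ∑ γ ∈ p.support, Polynomial.monomial (γ j) (p.coeff γ * ∏ i, y i ^ γ i)
  have hq : ∀ i, q.coeff i = eval y (A i) := by
    intro i
    simp only [q, A, Polynomial.finsetSum_coeff, Polynomial.coeff_monomial, map_sum,
      Finset.sum_filter, apply_ite (eval y), eval_monomial, map_zero, Finsupp.prod_pow]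
  obtain ⟨x, hx0, hx⟩ := q.exists_ne_zero_isRoot hj (by rw [hq]; exact left_ne_zero_of_mul hy)
    (by rw [hq]; exact right_ne_zero_of_mul hy)
  refine ⟨fun i => y i * if i = j then x else 1, fun i => ?_, ?_⟩
  · refine mul_ne_zero (hy0 i) ?_
    split_ifs
    exacts [hx0, one_ne_zero]
  · rw [← hx.eq_zero, eval_eq', Polynomial.eval_finsetSum]
    refine Finset.sum_congr rfl fun γ _ => ?_
    simp only [mul_pow, Finset.prod_mul_distrib, ite_pow, one_pow, Finset.prod_ite_eq',
      Finset.mem_univ, if_true, Polynomial.eval_monomial, mul_assoc]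

namespace AddValuation

variable {K : Type*} [Field K] (v : AddValuation K (WithTop ℝ))

/-- The valuation ring `{x | 0 ≤ v x}` of a real-valued additive valuation. -/
def integerSubring : ValuationSubring K where
  carrier := {x | 0 ≤ v x}
  mul_mem' {a b} ha hb := by
    rw [Set.mem_ofPred_eq, v.map_mul]; exact add_nonneg ha hb
  one_mem' := by rw [Set.mem_ofPred_eq, v.map_one]
  add_mem' ha hb := v.map_le_add ha hb
  zero_mem' := by rw [Set.mem_ofPred_eq, v.map_zero]; exact le_top
  neg_mem' {a} ha := by rw [Set.mem_ofPred_eq, v.map_neg]; exact ha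
  mem_or_inv_mem' x := by
    by_cases hx : x = 0
    · left; rw [Set.mem_ofPred_eq, hx, v.map_zero]; exact le_top
    · have h : v x + v x⁻¹ = 0 := by rw [← v.map_mul, mul_inv_cancel₀ hx, v.map_one]
      by_contra! hlt
      simp only [Set.mem_ofPred_eq, not_le] at hlt
      have hlt' : v x + v x⁻¹ ≤ v x + 0 := by gcongr; exact hlt.2.le
      rw [h, add_zero] at hlt'
      exact hlt'.not_gt hlt.1

theorem mem_integerSubring {x : K} : x ∈ v.integerSubring ↔ 0 ≤ v x := Iff.rfl

theorem residue_eq_zero_iff (x : v.integerSubring) :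
    IsLocalRing.residue v.integerSubring x = 0 ↔ 0 < v (x : K) := by
  rw [IsLocalRing.residue_eq_zero_iff, IsLocalRing.mem_maximalIdeal, mem_nonunits_iff,
    not_iff_comm]
  constructor
  · intro h
    have hx : v (x : K) = 0 := le_antisymm (not_lt.mp h) x.2
    have hx0 : (x : K) ≠ 0 := by
      intro h0
      rw [h0, v.map_zero] at hx
      exact WithTop.top_ne_zero hx
    have hinv : v (x : K)⁻¹ = 0 := by
      have := v.map_mul x (x : K)⁻¹
      rwa [mul_inv_cancel₀ hx0, v.map_one, hx, zero_add, eq_comm] at this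
    exact IsUnit.of_mul_eq_one ⟨(x : K)⁻¹, hinv.ge⟩ (Subtype.ext (mul_inv_cancel₀ hx0))
  · intro h hpos
    obtain ⟨y, hy⟩ := h.exists_right_inv
    have h1 : v (x : K) + v (y : K) = 0 := by
      rw [← v.map_mul, ← v.map_one]
      exact congrArg (fun z : v.integerSubring => v (z : K)) hy
    exact (add_pos_of_pos_of_nonneg hpos y.2).ne' h1

theorem residue_ne_zero_iff (x : v.integerSubring) :
    IsLocalRing.residue v.integerSubring x ≠ 0 ↔ v (x : K) = 0 := by
  rw [ne_eq, residue_eq_zero_iff, not_lt]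
  exact ⟨fun h => le_antisymm h x.2, fun h => h.le⟩

/-- The value of the monomial `x^α` at a point `t` with valuations `w`. -/
theorem map_prod_pow {m : ℕ} {t : Fin m → K} {w : Fin m → ℝ} (ht : ∀ j, v (t j) = (w j : WithTop ℝ))
    (α : Fin m →₀ ℕ) : v (∏ j, t j ^ α j) = ((∑ j, w j * (α j : ℝ) : ℝ) : WithTop ℝ) := by
  have key : ∀ s : Finset (Fin m),
      v (∏ j ∈ s, t j ^ α j) = ((∑ j ∈ s, w j * (α j : ℝ) : ℝ) : WithTop ℝ) := by
    intro s
    classical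
    induction s using Finset.induction_on with
    | empty => simp
    | insert j s hj ih =>
      rw [Finset.prod_insert hj, Finset.sum_insert hj, v.map_mul, ih, v.map_pow, ht,
        WithTop.coe_add, ← WithTop.coe_nsmul, nsmul_eq_mul, mul_comm]
  exact key Finset.univ

end AddValuation

theorem stmt2 {K : Type*} [Field K] [IsAlgClosed K] (ν : K → WithTop ℝ)
    (hν0 : ∀ a : K, ν a = ⊤ ↔ a = 0)
    (hνM : ∀ a b : K, ν (a * b) = ν a + ν b)
    (hνA : ∀ a b : K, min (ν a) (ν b) ≤ ν (a + b))
    (hνNT : ∃ a : K, a ≠ 0 ∧ ν a ≠ 0)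
    {m : ℕ} (g : MvPolynomial (Fin m) K) (hg : g ≠ 0)
    (w : Fin m → ℝ) (hw : ∀ j, ∃ a : K, a ≠ 0 ∧ ν a = (w j : WithTop ℝ))
    (h2 : ∃ α ∈ g.support, ∃ β ∈ g.support, α ≠ β ∧
      tropTerm ν g w α = tropMin ν g w ∧ tropTerm ν g w β = tropMin ν g w) :
    ∃ z : Fin m → K, (∀ j, z j ≠ 0) ∧ (∀ j, ν (z j) = (w j : WithTop ℝ)) ∧
      tropMin ν g w < ν (MvPolynomial.eval z g) := by
  classical
  have h1 : ν 1 = 0 := by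
    have h := hνM 1 1
    rw [mul_one] at h
    have hne : ν 1 ≠ ⊤ := fun h' => one_ne_zero ((hν0 1).mp h')
    lift ν 1 to ℝ using hne with r
    norm_cast at h ⊢
    linarith
  let v : AddValuation K (WithTop ℝ) := AddValuation.of ν ((hν0 0).mpr rfl) h1 hνA hνM
  choose t ht0 htw using hw
  obtain ⟨α, hα, β, hβ, hαβ, hαmin, hβmin⟩ := h2
  let e : (Fin m →₀ ℕ) → K := fun γ => MvPolynomial.coeff γ g * ∏ j, t j ^ γ j
  have he : ∀ γ, v (e γ) = tropTerm ν g w γ := by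
    intro γ
    rw [v.map_mul, v.map_prod_pow htw, add_comm]
    rfl
  have he0 : e α ≠ 0 := mul_ne_zero (MvPolynomial.mem_support_iff.mp hα)
    (Finset.prod_ne_zero_iff.mpr fun j _ => pow_ne_zero _ (ht0 j))
  have hmin : v (e α) = tropMin ν g w := (he α).trans hαmin
  have htop : v (e α) ≠ ⊤ := fun h => he0 ((hν0 _).mp h)
  have hdiv : ∀ x : K, v x = v (x / e α) + v (e α) := fun x => by
    rw [← v.map_mul, div_mul_cancel₀ x he0]
  have hmem : ∀ γ, e γ / e α ∈ v.integerSubring := by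
    intro γ
    rw [AddValuation.mem_integerSubring, ← WithTop.add_le_add_iff_right htop, ← hdiv, zero_add]
    by_cases hγ : γ ∈ g.support
    · rw [hmin, he]
      exact Finset.inf_le hγ
    · have : e γ = 0 := by
        simp only [e, MvPolynomial.notMem_support_iff.mp hγ, zero_mul]
      rw [this, v.map_zero]
      exact le_top
  let O := v.integerSubring
  let H : MvPolynomial (Fin m) O := ∑ γ ∈ g.support, MvPolynomial.monomial γ ⟨_, hmem γ⟩
  have hH : ∀ γ ∈ g.support, H.coeff γ = ⟨_, hmem γ⟩ := by
    intro γ hγ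
    simp only [H, MvPolynomial.coeff_sum, MvPolynomial.coeff_monomial]
    rw [Finset.sum_ite_eq', if_pos hγ]
  have hsupp : ∀ γ ∈ g.support, tropTerm ν g w γ = tropMin ν g w →
      γ ∈ (H.map (IsLocalRing.residue O)).support := by
    intro γ hγ hγmin
    rw [MvPolynomial.mem_support_iff, MvPolynomial.coeff_map, hH γ hγ,
      AddValuation.residue_ne_zero_iff]
    refine (WithTop.add_right_inj htop).mp ?_
    rw [← hdiv, zero_add, he, hγmin, hmin]
  have : IsAlgClosed (IsLocalRing.ResidueField O) := IsLocalRing.isAlgClosed_residueField O K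
  obtain ⟨z, hz0, hz⟩ := MvPolynomial.exists_forall_ne_zero_eval_eq_zero
    (H.map (IsLocalRing.residue O)) hαβ (hsupp α hα hαmin) (hsupp β hβ hβmin)
  choose y hy using fun j => IsLocalRing.residue_surjective (z j)
  obtain rfl : (fun j => IsLocalRing.residue O (y j)) = z := funext hy
  have hy0 : ∀ j, v (y j : K) = 0 := fun j => (v.residue_ne_zero_iff _).mp (hz0 j)
  have hν : ∀ j, ν (t j * y j) = (w j : WithTop ℝ) := fun j => by
    rw [hνM, htw]
    exact (congrArg _ (hy0 j)).trans (add_zero _)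
  refine ⟨fun j => t j * y j, fun j h => ?_, hν, ?_⟩
  · have := hν j
    rw [show t j * (y j : K) = 0 from h, (hν0 0).mpr rfl] at this
    exact WithTop.top_ne_coe this
  · have hres : IsLocalRing.residue O (MvPolynomial.eval y H) = 0 := by
      rw [← hz, MvPolynomial.eval_map]
      exact MvPolynomial.eval₂_comp (IsLocalRing.residue O) y H
    have hpos := (v.residue_eq_zero_iff _).mp hres
    have heval : ((MvPolynomial.eval y H : O) : K) =
        MvPolynomial.eval (fun j => t j * (y j : K)) g / e α := by
      rw [MvPolynomial.eval_eq' _ g, Finset.sum_div]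
      simp only [H, map_sum, MvPolynomial.eval_monomial, Finsupp.prod_pow]
      push_cast
      refine Finset.sum_congr rfl fun γ _ => ?_
      simp only [e, mul_pow, Finset.prod_mul_distrib]
      ring
    rw [heval] at hpos
    change _ < v _
    rw [hdiv (MvPolynomial.eval _ g), ← hmin]
    calc v (e α) = 0 + v (e α) := (zero_add _).symm
      _ < _ := WithTop.add_lt_add_right htop hpos
end

section
/- Let F = {f_1,…,f_n} ⊆ K[x_1,…,x_n] be a triangular set whose set of common zeros V(F) ⊆ K^n is finite, nonempty, and contained in (Kˣ)^n. Then the following are equivalent: (1) for every k = 1,…,n, the set Trop(f_1) ∩ ⋯ ∩ Trop(f_k) ⊆ ℝ^n (each f_i regarded as a polynomial in x_1,…,x_n) is nonempty of Hausdorff dimension n−k; (2) F is a tropical basis, i.e. Trop(f_1) ∩ ⋯ ∩ Trop(f_n) = closure{(ν(z_1),…,ν(z_n)) : z ∈ (Kˣ)^n, f_1(z)=⋯=f_n(z)=0}. -/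
open scoped Pointwise

namespace TropPaper

variable {K : Type*} [Field K]

/-- The tropical hypersurface of `g`: the minimum is attained at two distinct exponents. -/
def tropHyp {m : ℕ} (ν : K → WithTop ℝ) (g : MvPolynomial (Fin m) K) :
    Set (Fin m → ℝ) :=
  {w | ∃ α ∈ g.support, ∃ β ∈ g.support, α ≠ β ∧
    tropTerm ν g w α = tropMin ν g w ∧ tropTerm ν g w β = tropMin ν g w}

/-- `f = Σ f_i x_k^i ∈ K[x_1,…,x_{m}][x_{m+1}]` regarded as a polynomial in `m+1` variables,
the polynomial variable becoming the last variable `x_{m+1}`. -/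
noncomputable def toMv {m : ℕ} (f : Polynomial (MvPolynomial (Fin m) K)) :
    MvPolynomial (Fin (m + 1)) K :=
  Polynomial.eval₂ (MvPolynomial.rename (Fin.castSucc : Fin m → Fin (m + 1))).toRingHom
    (MvPolynomial.X (Fin.last m)) f

/-- A polynomial in the variables `x_1,…,x_{i+1}` regarded as a polynomial in `n` variables. -/
noncomputable def emb {n : ℕ} (i : Fin n) (f : Polynomial (MvPolynomial (Fin (i : ℕ)) K)) :
    MvPolynomial (Fin n) K :=
  MvPolynomial.rename (Fin.castLE i.isLt) (toMv f)

end TropPaper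

open TropPaper

section Valuation

open Polynomial

variable {K : Type*} [Field K] (v : AddValuation K (WithTop ℝ))

theorem exists_dominant_mul_X_sub_C {p : K[X]} {r : K} {u : ℝ} (hr : v r ≠ u)
    (hp : ∃ d : ℕ, ∀ j ≠ d, v (p.coeff d) + ((d * u : ℝ) : WithTop ℝ) <
      v (p.coeff j) + ((j * u : ℝ) : WithTop ℝ)) :
    ∃ d : ℕ, ∀ j ≠ d, v ((p * (X - C r)).coeff d) + ((d * u : ℝ) : WithTop ℝ) <
      v ((p * (X - C r)).coeff j) + ((j * u : ℝ) : WithTop ℝ) := by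
  obtain ⟨d, hd⟩ := hp
  have hle : ∀ j : ℕ, v (p.coeff d) + ((d * u : ℝ) : WithTop ℝ) ≤
      v (p.coeff j) + ((j * u : ℝ) : WithTop ℝ) := fun j ↦ by
    rcases eq_or_ne j d with rfl | h
    exacts [le_rfl, (hd j h).le]
  have hfin : v (p.coeff d) ≠ ⊤ := fun h ↦ by simpa [h] using hd (d + 1) (by simp)
  obtain ⟨a, ha⟩ := WithTop.ne_top_iff_exists.1 hfin
  rw [← ha] at hd hle
  rcases lt_or_gt_of_ne hr with hlt | hgt
  · obtain ⟨s, hs⟩ := WithTop.ne_top_iff_exists.1 hlt.ne_top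
    rw [← hs] at hlt
    have hmain : v ((p * (X - C r)).coeff d) = ((a + s : ℝ) : WithTop ℝ) := by
      cases d with
      | zero => simp [← ha, ← hs]
      | succ d =>
        have hlt' : v (p.coeff (d + 1) * r) < v (p.coeff d) := by
          have h1 := hd d (by simp)
          rw [AddValuation.map_mul, ← ha, ← hs]
          generalize v (p.coeff d) = b at h1
          cases b
          · exact WithTop.coe_lt_top _
          · norm_cast at *
            push_cast at h1
            linarith
        rw [coeff_mul_X_sub_C, v.map_sub_eq_of_lt_right hlt', AddValuation.map_mul, ← ha, ← hs]
        rfl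
    refine ⟨d, fun j hj ↦ ?_⟩
    rw [hmain]
    cases j with
    | zero =>
      have h1 := hd 0 hj
      simp only [mul_coeff_zero, coeff_sub, coeff_X_zero, coeff_C_zero, zero_sub, mul_neg,
        AddValuation.map_neg, AddValuation.map_mul, ← hs]
      generalize v (p.coeff 0) = b at *
      cases b
      · exact WithTop.coe_lt_top _
      · norm_cast at *
        push_cast at *
        linarith
    | succ j =>
      have h1 := hd (j + 1) hj
      have h2 := hle j
      rw [coeff_mul_X_sub_C]
      have h3 : ((a + s + d * u - (j + 1) * u : ℝ) : WithTop ℝ) <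
          v (p.coeff j - p.coeff (j + 1) * r) := by
        refine lt_of_lt_of_le ?_ (v.map_sub _ _)
        rw [AddValuation.map_mul, ← hs]
        generalize v (p.coeff j) = b at *
        generalize v (p.coeff (j + 1)) = c at *
        refine lt_min ?_ ?_
        · cases b
          · exact WithTop.coe_lt_top _
          · norm_cast at *
            push_cast at *
            linarith
        · cases c
          · exact WithTop.coe_lt_top _
          · norm_cast at *
            push_cast at *
            linarith
      generalize v (p.coeff j - p.coeff (j + 1) * r) = b at *
      cases b
      · exact WithTop.coe_lt_top _
      · norm_cast at *
        push_cast at *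
        linarith
  · have hmain : v ((p * (X - C r)).coeff (d + 1)) = (a : WithTop ℝ) := by
      have hlt' : v (p.coeff d) < v (p.coeff (d + 1) * r) := by
        have h1 := hd (d + 1) (by simp)
        rw [AddValuation.map_mul, ← ha]
        generalize v (p.coeff (d + 1)) = b at *
        generalize v r = s at *
        cases b
        · exact WithTop.coe_lt_top _
        cases s
        · exact WithTop.coe_lt_top _
        norm_cast at *
        push_cast at h1
        linarith
      rw [coeff_mul_X_sub_C, v.map_sub_eq_of_lt_left hlt', ← ha]
    refine ⟨d + 1, fun j hj ↦ ?_⟩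
    rw [hmain]
    cases j with
    | zero =>
      have h1 := hle 0
      simp only [mul_coeff_zero, coeff_sub, coeff_X_zero, coeff_C_zero, zero_sub, mul_neg,
        AddValuation.map_neg, AddValuation.map_mul]
      generalize v (p.coeff 0) = b at *
      generalize v r = s at *
      cases b
      · exact WithTop.coe_lt_top _
      cases s
      · exact WithTop.coe_lt_top _
      norm_cast at *
      push_cast at *
      linarith
    | succ j =>
      have h1 := hle (j + 1)
      have h2 := hd j (by simpa using hj)
      rw [coeff_mul_X_sub_C]
      have h3 : ((a + (d + 1) * u - (j + 1) * u : ℝ) : WithTop ℝ) <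
          v (p.coeff j - p.coeff (j + 1) * r) := by
        refine lt_of_lt_of_le ?_ (v.map_sub _ _)
        rw [AddValuation.map_mul]
        generalize v (p.coeff j) = b at *
        generalize v (p.coeff (j + 1)) = c at *
        generalize v r = s at *
        refine lt_min ?_ ?_
        · cases b
          · exact WithTop.coe_lt_top _
          · norm_cast at *
            push_cast at *
            linarith
        · cases c
          · exact WithTop.coe_lt_top _
          cases s
          · exact WithTop.coe_lt_top _
          norm_cast at *
          push_cast at *
          linarith
      generalize v (p.coeff j - p.coeff (j + 1) * r) = b at *
      cases b
      · exact WithTop.coe_lt_top _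
      · norm_cast at *
        push_cast at *
        linarith

theorem coeff_zero_le_mul_X_sub_C {p : K[X]} {r : K} {M : ℝ} (hr : v r ≤ M)
    (hp : ∀ j : ℕ, v (p.coeff 0) ≤ v (p.coeff j) + ((j * M : ℝ) : WithTop ℝ)) (j : ℕ) :
    v ((p * (X - C r)).coeff 0) ≤ v ((p * (X - C r)).coeff j) + ((j * M : ℝ) : WithTop ℝ) := by
  cases j with
  | zero => simp
  | succ j =>
    have h1 := hp j
    have h2 := hp (j + 1)
    have h3 := v.map_sub (p.coeff j) (p.coeff (j + 1) * r)
    rw [coeff_mul_X_sub_C]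
    simp only [mul_coeff_zero, coeff_sub, coeff_X_zero, coeff_C_zero, zero_sub, mul_neg,
        AddValuation.map_neg, AddValuation.map_mul] at h3 ⊢
    refine le_trans ?_ (add_le_add_left h3 _)
    rw [min_add]
    generalize v (p.coeff j) = b at *
    generalize v (p.coeff (j + 1)) = c at *
    generalize v (p.coeff 0) = a at *
    generalize v r = s at *
    refine le_min ?_ ?_
    · cases b
      · exact le_top
      cases s
      · simp at hr
      cases a
      · simp only [top_le_iff, ← WithTop.coe_add, WithTop.coe_ne_top] at h1
      norm_cast at *
      push_cast at *
      linarith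
    · cases c
      · exact le_top
      cases s
      · simp at hr
      cases a
      · simp only [top_le_iff, ← WithTop.coe_add, WithTop.coe_ne_top] at h2
      norm_cast at *
      push_cast at *
      linarith

variable [IsAlgClosed K]

theorem exists_root_of_min_attained_twice {p : K[X]} {u : ℝ} {j₁ j₂ : ℕ} (hne : j₁ ≠ j₂)
    (hfin : v (p.coeff j₁) ≠ ⊤)
    (heq : v (p.coeff j₁) + ((j₁ * u : ℝ) : WithTop ℝ) =
      v (p.coeff j₂) + ((j₂ * u : ℝ) : WithTop ℝ))
    (hmin : ∀ j : ℕ, v (p.coeff j₁) + ((j₁ * u : ℝ) : WithTop ℝ) ≤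
      v (p.coeff j) + ((j * u : ℝ) : WithTop ℝ)) :
    ∃ y, v y = u ∧ p.eval y = 0 := by
  by_contra! H
  have hp0 : p ≠ 0 := by rintro rfl; simp at hfin
  have hroots : ∀ r ∈ p.roots, v r ≠ u := fun r hr h ↦ H r h (isRoot_of_mem_roots hr)
  have key : ∃ d : ℕ, ∀ j ≠ d, v (p.coeff d) + ((d * u : ℝ) : WithTop ℝ) <
      v (p.coeff j) + ((j * u : ℝ) : WithTop ℝ) := by
    rw [(IsAlgClosed.splits p).eq_prod_roots]
    generalize p.roots = s at hroots
    induction s using Multiset.induction with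
    | empty =>
      refine ⟨0, fun j hj ↦ ?_⟩
      obtain ⟨a, ha⟩ := WithTop.ne_top_iff_exists.1
        (v.ne_top_iff.2 (leadingCoeff_ne_zero.2 hp0))
      simp [coeff_C, hj, ← ha]
    | cons r s ih =>
      rw [Multiset.map_cons, Multiset.prod_cons, mul_comm (X - C r), ← mul_assoc]
      exact exists_dominant_mul_X_sub_C v (hroots r (by simp))
        (ih fun t ht ↦ hroots t (by simp [ht]))
  obtain ⟨d, hd⟩ := key
  rcases eq_or_ne j₁ d with rfl | h
  · exact (hd j₂ hne.symm).ne heq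
  · exact (hd j₁ h).not_ge (hmin d)

theorem exists_root_of_coeff_zero_gt {p : K[X]} {M : ℝ} {j : ℕ}
    (hj : v (p.coeff j) + ((j * M : ℝ) : WithTop ℝ) < v (p.coeff 0)) :
    ∃ s, (M : WithTop ℝ) < v s ∧ p.eval s = 0 := by
  by_contra! H
  have hroots : ∀ r ∈ p.roots, v r ≤ M := fun r hr ↦
    le_of_not_gt fun h ↦ H r h (isRoot_of_mem_roots hr)
  refine hj.not_ge ?_
  rw [(IsAlgClosed.splits p).eq_prod_roots]
  generalize p.roots = s at hroots
  clear hj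
  induction s using Multiset.induction generalizing j with
  | empty =>
    rcases eq_or_ne j 0 with rfl | h
    · simp
    · simp [coeff_C, h]
  | cons r s ih =>
    rw [Multiset.map_cons, Multiset.prod_cons, mul_comm (X - C r), ← mul_assoc]
    exact coeff_zero_le_mul_X_sub_C v (hroots r (by simp))
      (fun j ↦ ih fun t ht ↦ hroots t (by simp [ht])) j

end Valuation

section Hypersurface

open MvPolynomial

variable {K : Type*} [Field K] (v : AddValuation K (WithTop ℝ)) {m : ℕ}

theorem tropTerm_ne_top_iff {g : MvPolynomial (Fin m) K} {w : Fin m → ℝ} {α : Fin m →₀ ℕ} :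
    tropTerm v g w α ≠ ⊤ ↔ coeff α g ≠ 0 := by
  rw [tropTerm, WithTop.add_ne_top, v.ne_top_iff, and_iff_right WithTop.coe_ne_top]

theorem tropMin_le (g : MvPolynomial (Fin m) K) (w : Fin m → ℝ) (α : Fin m →₀ ℕ) :
    tropMin v g w ≤ tropTerm v g w α := by
  by_cases h : coeff α g = 0
  · rw [not_not.1 ((tropTerm_ne_top_iff v (w := w)).not.2 (not_not.2 h))]
    exact le_top
  · exact Finset.inf_le (mem_support_iff.2 h)

theorem exists_tropTerm_eq_tropMin {g : MvPolynomial (Fin m) K} (hg : g ≠ 0) (w : Fin m → ℝ) :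
    ∃ α ∈ g.support, tropTerm v g w α = tropMin v g w := by
  obtain ⟨α, hα, h⟩ := Finset.exists_mem_eq_inf g.support (support_nonempty.2 hg) (tropTerm v g w)
  exact ⟨α, hα, h.symm⟩

theorem tropMin_ne_top_iff {g : MvPolynomial (Fin m) K} {w : Fin m → ℝ} :
    tropMin v g w ≠ ⊤ ↔ g ≠ 0 := by
  constructor
  · rintro h rfl
    simp [tropMin] at h
  · intro hg
    obtain ⟨α, hα, h⟩ := exists_tropTerm_eq_tropMin v hg w
    rw [← h, tropTerm_ne_top_iff]
    exact mem_support_iff.1 hα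

theorem mem_tropHyp_iff {g : MvPolynomial (Fin m) K} {w : Fin m → ℝ} :
    w ∈ tropHyp v g ↔ ∃ α β, α ≠ β ∧ tropTerm v g w α ≠ ⊤ ∧
      tropTerm v g w α = tropTerm v g w β ∧ ∀ γ, tropTerm v g w α ≤ tropTerm v g w γ := by
  constructor
  · rintro ⟨α, hα, β, -, hne, h1, h2⟩
    refine ⟨α, β, hne, (tropTerm_ne_top_iff v).2 (mem_support_iff.1 hα), h1.trans h2.symm, ?_⟩
    rw [h1]
    exact tropMin_le v g w
  · rintro ⟨α, β, hne, hfin, heq, hmin⟩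
    have hα : α ∈ g.support := mem_support_iff.2 ((tropTerm_ne_top_iff v).1 hfin)
    have hβ : β ∈ g.support := mem_support_iff.2 ((tropTerm_ne_top_iff v).1 (heq ▸ hfin))
    have h : tropTerm v g w α = tropMin v g w :=
      le_antisymm (Finset.le_inf fun γ _ ↦ hmin γ) (tropMin_le v g w α)
    exact ⟨α, hα, β, hβ, hne, h, heq ▸ h⟩

theorem map_coeff_mul_prod (g : MvPolynomial (Fin m) K) {z : Fin m → K} {w : Fin m → ℝ}
    (hz : ∀ j, v (z j) = w j) (α : Fin m →₀ ℕ) :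
    v (coeff α g * ∏ j, z j ^ α j) = tropTerm v g w α := by
  have h : ∀ s : Finset (Fin m), v (∏ j ∈ s, z j ^ α j) = ((∑ j ∈ s, w j * α j : ℝ)) := by
    intro s
    induction s using Finset.induction with
    | empty => simp
    | insert a s ha ih =>
      rw [Finset.prod_insert ha, Finset.sum_insert ha, AddValuation.map_mul, ih,
        AddValuation.map_pow, hz, WithTop.coe_add, ← WithTop.coe_nsmul, nsmul_eq_mul, mul_comm]
  rw [AddValuation.map_mul, h, add_comm, tropTerm]

theorem tropMin_le_map_eval (g : MvPolynomial (Fin m) K) {z : Fin m → K} {w : Fin m → ℝ}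
    (hz : ∀ j, v (z j) = w j) : tropMin v g w ≤ v (eval z g) := by
  rw [eval_eq']
  refine v.map_le_sum fun α _ ↦ ?_
  rw [map_coeff_mul_prod v g hz]
  exact tropMin_le v g w α

theorem map_eval_eq_tropMin {g : MvPolynomial (Fin m) K} {z : Fin m → K} {w : Fin m → ℝ}
    (hz : ∀ j, v (z j) = w j) (hw : w ∉ tropHyp v g) : v (eval z g) = tropMin v g w := by
  rcases eq_or_ne g 0 with rfl | hg
  · simp [tropMin]
  obtain ⟨α, hα, h⟩ := exists_tropTerm_eq_tropMin v hg w
  rw [eval_eq', ← Finset.add_sum_erase _ _ hα]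
  have hlt : v (coeff α g * ∏ j, z j ^ α j) <
      v (∑ β ∈ g.support.erase α, coeff β g * ∏ j, z j ^ β j) := by
    rw [map_coeff_mul_prod v g hz, h]
    refine v.map_lt_sum ((tropMin_ne_top_iff v).2 hg) fun β hβ ↦ ?_
    rw [map_coeff_mul_prod v g hz]
    refine lt_of_le_of_ne (tropMin_le v g w β) fun h' ↦ hw ?_
    exact ⟨α, hα, β, Finset.mem_of_mem_erase hβ, (Finset.ne_of_mem_erase hβ).symm, h, h'.symm⟩
  rw [v.map_add_eq_of_lt_left hlt, map_coeff_mul_prod v g hz, h]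

theorem mem_tropHyp_of_eval_eq_zero {g : MvPolynomial (Fin m) K} (hg : g ≠ 0) {z : Fin m → K}
    {w : Fin m → ℝ} (hz : ∀ j, v (z j) = w j) (h0 : eval z g = 0) : w ∈ tropHyp v g := by
  by_contra hw
  have := map_eval_eq_tropMin v hz hw
  rw [h0, v.map_zero] at this
  exact (tropMin_ne_top_iff v).2 hg this.symm

end Hypersurface

section Embedding

open MvPolynomial

variable {K : Type*} [Field K] {n : ℕ}

/-- The first `i` coordinates of a vector. -/
def initCoords {A : Type*} (i : Fin n) (w : Fin n → A) : Fin i → A :=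
  fun l ↦ w (Fin.castLE i.isLt (Fin.castSucc l))

theorem initCoords_congr {A : Type*} {i : Fin n} {w w' : Fin n → A} (h : ∀ l < i, w l = w' l) :
    initCoords i w = initCoords i w' :=
  funext fun l ↦ h _ (Fin.lt_def.2 (by simp))

theorem initCoords_update {A : Type*} (i : Fin n) (w : Fin n → A) (a : A) :
    initCoords i (Function.update w i a) = initCoords i w :=
  initCoords_congr fun _ hl ↦ Function.update_of_ne hl.ne _ _

/-- The exponent in `n` variables of the monomial `x^β x_i^j`, for `β` an exponent in the
variables before `x_i`. -/
noncomputable def embExp (i : Fin n) (p : (Fin i →₀ ℕ) × ℕ) : Fin n →₀ ℕ :=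
  (p.1.mapDomain Fin.castSucc + Finsupp.single (Fin.last i) p.2).mapDomain (Fin.castLE i.isLt)

theorem embExp_apply_castSucc (i : Fin n) (p : (Fin i →₀ ℕ) × ℕ) (l : Fin i) :
    embExp i p (Fin.castLE i.isLt (Fin.castSucc l)) = p.1 l := by
  rw [embExp, Finsupp.mapDomain_apply (Fin.castLE_injective _), Finsupp.add_apply,
    Finsupp.mapDomain_apply (Fin.castSucc_injective _),
    Finsupp.single_eq_of_ne (Fin.castSucc_lt_last l).ne, add_zero]

theorem castLE_last (i : Fin n) : Fin.castLE i.isLt (Fin.last i) = i := rfl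

theorem embExp_apply_self (i : Fin n) (p : (Fin i →₀ ℕ) × ℕ) : embExp i p i = p.2 := by
  change embExp i p (Fin.castLE i.isLt (Fin.last i)) = p.2
  rw [embExp, Finsupp.mapDomain_apply (Fin.castLE_injective _), Finsupp.add_apply,
    Finsupp.mapDomain_of_notMem_range _ _ (by simp)]
  simp

theorem embExp_injective (i : Fin n) : Function.Injective (embExp i) := by
  intro p q h
  refine Prod.ext (Finsupp.ext fun l ↦ ?_) ?_
  · rw [← embExp_apply_castSucc, h, embExp_apply_castSucc]
  · rw [← embExp_apply_self, h, embExp_apply_self]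

theorem sum_mul_embExp (i : Fin n) (w : Fin n → ℝ) (p : (Fin i →₀ ℕ) × ℕ) :
    ∑ j, w j * (embExp i p j : ℝ) = ∑ l, initCoords i w l * (p.1 l : ℝ) + p.2 * w i := by
  have h : ∑ j, w j * (embExp i p j : ℝ) =
      ∑ j : Fin (i + 1), w (Fin.castLE i.isLt j) * (embExp i p (Fin.castLE i.isLt j) : ℝ) := by
    refine (Fintype.sum_of_injective _ (Fin.castLE_injective i.isLt) _ _ (fun j hj ↦ ?_)
      fun _ ↦ rfl).symm
    rw [embExp, Finsupp.mapDomain_of_notMem_range _ _ hj]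
    simp
  rw [h, Fin.sum_univ_castSucc]
  simp only [embExp_apply_castSucc, castLE_last, embExp_apply_self, initCoords]
  ring

theorem emb_add (i : Fin n) (f g : Polynomial (MvPolynomial (Fin i) K)) :
    emb i (f + g) = emb i f + emb i g := by
  simp [emb, toMv, Polynomial.eval₂_add]

theorem emb_monomial (i : Fin n) (j : ℕ) (β : Fin i →₀ ℕ) (a : K) :
    emb i (Polynomial.monomial j (monomial β a)) = monomial (embExp i (β, j)) a := by
  simp only [emb, toMv, Polynomial.eval₂_monomial, map_mul, map_pow, rename_X]
  simp only [embExp, Finsupp.mapDomain_add, Finsupp.mapDomain_single]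
  rw [AlgHom.toRingHom_eq_coe, RingHom.coe_coe, rename_monomial, rename_monomial, X_pow_eq_monomial,
    monomial_mul, mul_one]

theorem coeff_embExp_emb (i : Fin n) (f : Polynomial (MvPolynomial (Fin i) K))
    (p : (Fin i →₀ ℕ) × ℕ) : coeff (embExp i p) (emb i f) = coeff p.1 (f.coeff p.2) := by
  classical
  induction f using Polynomial.induction_on' with
  | add f g hf hg => simp [emb_add, hf, hg]
  | monomial j c =>
    induction c using MvPolynomial.induction_on' with
    | monomial β a =>
      rw [emb_monomial, coeff_monomial, Polynomial.coeff_monomial]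
      simp only [(embExp_injective i).eq_iff]
      by_cases h1 : j = p.2 <;> by_cases h2 : β = p.1 <;> simp [h1, h2, Prod.ext_iff]
    | add f g hf hg => rw [map_add, emb_add, coeff_add, hf, hg, Polynomial.coeff_add, coeff_add]

theorem coeff_emb_of_notMem_range (i : Fin n) (f : Polynomial (MvPolynomial (Fin i) K))
    {α : Fin n →₀ ℕ} (hα : α ∉ Set.range (embExp i)) : coeff α (emb i f) = 0 := by
  classical
  induction f using Polynomial.induction_on' with
  | add f g hf hg => simp [emb_add, hf, hg]
  | monomial j c =>
    induction c using MvPolynomial.induction_on' with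
    | monomial β a => rw [emb_monomial, coeff_monomial, if_neg fun h ↦ hα ⟨_, h⟩]
    | add f g hf hg => rw [map_add, emb_add, coeff_add, hf, hg, add_zero]

theorem emb_ne_zero (i : Fin n) {f : Polynomial (MvPolynomial (Fin i) K)} (hf : f ≠ 0) :
    emb i f ≠ 0 := by
  intro h
  refine hf (Polynomial.ext fun j ↦ MvPolynomial.ext _ _ fun β ↦ ?_)
  rw [← coeff_embExp_emb i f (β, j), h]
  simp

theorem eval_emb (i : Fin n) (f : Polynomial (MvPolynomial (Fin i) K)) (z : Fin n → K) :
    eval z (emb i f) = (f.map (eval (initCoords i z))).eval (z i) := by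
  rw [emb, eval_rename, toMv, Polynomial.hom_eval₂, Polynomial.eval_map]
  congr 1
  · ext <;> simp [initCoords]
  · simp [castLE_last]

variable (v : AddValuation K (WithTop ℝ))

theorem tropTerm_embExp (i : Fin n) (f : Polynomial (MvPolynomial (Fin i) K)) (w : Fin n → ℝ)
    (p : (Fin i →₀ ℕ) × ℕ) :
    tropTerm v (emb i f) w (embExp i p) =
      tropTerm v (f.coeff p.2) (initCoords i w) p.1 + ((p.2 * w i : ℝ) : WithTop ℝ) := by
  rw [tropTerm, tropTerm, coeff_embExp_emb, sum_mul_embExp, WithTop.coe_add, add_right_comm]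

theorem mem_tropHyp_emb_iff {i : Fin n} {f : Polynomial (MvPolynomial (Fin i) K)}
    {w : Fin n → ℝ} :
    w ∈ tropHyp v (emb i f) ↔ ∃ p q : (Fin i →₀ ℕ) × ℕ, p ≠ q ∧
      tropTerm v (f.coeff p.2) (initCoords i w) p.1 ≠ ⊤ ∧
      tropTerm v (f.coeff p.2) (initCoords i w) p.1 + ((p.2 * w i : ℝ) : WithTop ℝ) =
        tropTerm v (f.coeff q.2) (initCoords i w) q.1 + ((q.2 * w i : ℝ) : WithTop ℝ) ∧
      ∀ j, tropTerm v (f.coeff p.2) (initCoords i w) p.1 + ((p.2 * w i : ℝ) : WithTop ℝ) ≤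
        tropMin v (f.coeff j) (initCoords i w) + ((j * w i : ℝ) : WithTop ℝ) := by
  rw [mem_tropHyp_iff]
  constructor
  · rintro ⟨α, β, hne, hfin, heq, hmin⟩
    have hα : α ∈ Set.range (embExp i) := by
      by_contra h
      exact (tropTerm_ne_top_iff v).1 hfin (coeff_emb_of_notMem_range i f h)
    have hβ : β ∈ Set.range (embExp i) := by
      by_contra h
      exact (tropTerm_ne_top_iff v).1 (heq ▸ hfin) (coeff_emb_of_notMem_range i f h)
    obtain ⟨p, rfl⟩ := hα
    obtain ⟨q, rfl⟩ := hβ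
    simp only [tropTerm_embExp] at heq hfin hmin
    refine ⟨p, q, fun h ↦ hne (h ▸ rfl), fun h ↦ hfin (by simp [h]), heq, fun j ↦ ?_⟩
    rcases eq_or_ne (f.coeff j) 0 with h0 | h0
    · simp [h0, tropMin]
    · obtain ⟨γ, -, hγ⟩ := exists_tropTerm_eq_tropMin v h0 (initCoords i w)
      rw [← hγ]
      simpa only [tropTerm_embExp] using hmin (embExp i (γ, j))
  · rintro ⟨p, q, hne, hfin, heq, hmin⟩
    refine ⟨embExp i p, embExp i q, (embExp_injective i).ne hne, ?_, ?_, fun γ ↦ ?_⟩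
    · rw [tropTerm_embExp]
      exact WithTop.add_ne_top.2 ⟨hfin, WithTop.coe_ne_top⟩
    · rw [tropTerm_embExp, tropTerm_embExp, heq]
    · by_cases hγ : γ ∈ Set.range (embExp i)
      · obtain ⟨r, rfl⟩ := hγ
        rw [tropTerm_embExp, tropTerm_embExp]
        exact (hmin r.2).trans (add_le_add_left (tropMin_le v _ _ _) _)
      · rw [not_not.1 ((tropTerm_ne_top_iff v (w := w)).not.2
          (not_not.2 (coeff_emb_of_notMem_range i f hγ)))]
        exact le_top

theorem mem_tropHyp_emb_congr {i : Fin n} {f : Polynomial (MvPolynomial (Fin i) K)}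
    {w w' : Fin n → ℝ} (h : ∀ l ≤ i, w l = w' l) :
    w ∈ tropHyp v (emb i f) ↔ w' ∈ tropHyp v (emb i f) := by
  rw [mem_tropHyp_emb_iff, mem_tropHyp_emb_iff, initCoords_congr fun l hl ↦ h l hl.le, h i le_rfl]

end Embedding

section Fiber

open MvPolynomial Topology

theorem exists_extreme_minimizers {a : ℕ → WithTop ℝ} {D : ℕ} (hD : ∀ j > D, a j = ⊤) {u : ℝ}
    {j₀ : ℕ} (hj₀ : a j₀ ≠ ⊤)
    (hmin : ∀ k : ℕ, a j₀ + ((j₀ * u : ℝ) : WithTop ℝ) ≤ a k + ((k * u : ℝ) : WithTop ℝ)) :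
    ∃ j₁ j₂ : ℕ, j₁ ≤ j₀ ∧ j₀ ≤ j₂ ∧ a j₁ ≠ ⊤ ∧ a j₂ ≠ ⊤ ∧
      a j₁ + ((j₁ * u : ℝ) : WithTop ℝ) = a j₀ + ((j₀ * u : ℝ) : WithTop ℝ) ∧
      a j₂ + ((j₂ * u : ℝ) : WithTop ℝ) = a j₀ + ((j₀ * u : ℝ) : WithTop ℝ) ∧
      (∀ k : ℕ, a k + ((k * u : ℝ) : WithTop ℝ) = a j₀ + ((j₀ * u : ℝ) : WithTop ℝ) →
        j₁ ≤ k ∧ k ≤ j₂) ∧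
      ∃ ε > 0, (∀ u' ∈ Set.Ioo u (u + ε), ∀ k : ℕ,
          a j₁ + ((j₁ * u' : ℝ) : WithTop ℝ) ≤ a k + ((k * u' : ℝ) : WithTop ℝ)) ∧
        ∀ u' ∈ Set.Ioo (u - ε) u, ∀ k : ℕ,
          a j₂ + ((j₂ * u' : ℝ) : WithTop ℝ) ≤ a k + ((k * u' : ℝ) : WithTop ℝ) := by
  classical
  obtain ⟨x, hx⟩ := WithTop.ne_top_iff_exists.1 hj₀
  set V : ℝ := x + j₀ * u with hV
  have hVa : a j₀ + ((j₀ * u : ℝ) : WithTop ℝ) = (V : WithTop ℝ) := by rw [← hx]; rfl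
  rw [hVa] at hmin ⊢
  have hval : ∀ {k : ℕ}, a k + ((k * u : ℝ) : WithTop ℝ) = (V : WithTop ℝ) →
      a k = ((V - k * u : ℝ) : WithTop ℝ) := by
    intro k hk
    generalize a k = b at hk
    cases b
    · simp at hk
    · norm_cast at *
      linarith
  set J := (Finset.range (D + 1)).filter
    fun k : ℕ ↦ a k + ((k * u : ℝ) : WithTop ℝ) = (V : WithTop ℝ) with hJ
  have hmemJ : ∀ k, k ∈ J ↔ a k + ((k * u : ℝ) : WithTop ℝ) = (V : WithTop ℝ) := by
    intro k
    rw [hJ, Finset.mem_filter, and_iff_right_iff_imp, Finset.mem_range, Nat.lt_succ_iff]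
    intro hk
    by_contra hkD
    rw [hD k (not_le.1 hkD)] at hk
    simp at hk
  have hJ₀ : j₀ ∈ J := (hmemJ _).2 hVa
  have hJne : J.Nonempty := ⟨j₀, hJ₀⟩
  have h₁ := (hmemJ _).1 (J.min'_mem hJne)
  have h₂ := (hmemJ _).1 (J.max'_mem hJne)
  have hle : ∀ k ∈ J, J.min' hJne ≤ k ∧ k ≤ J.max' hJne :=
    fun k hk ↦ ⟨J.min'_le k hk, J.le_max' k hk⟩
  generalize J.min' hJne = j₁ at *
  generalize J.max' hJne = j₂ at *
  have hev : ∀ᶠ u' in 𝓝 u, ∀ k ∈ Finset.range (D + 1), k ∉ J →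
      ((V + j₁ * (u' - u) : ℝ) : WithTop ℝ) ≤ a k + ((k * u' : ℝ) : WithTop ℝ) ∧
      ((V + j₂ * (u' - u) : ℝ) : WithTop ℝ) ≤ a k + ((k * u' : ℝ) : WithTop ℝ) := by
    rw [Filter.eventually_all_finset]
    intro k _
    by_cases hk : k ∈ J
    · simp [hk]
    have hlt := lt_of_le_of_ne (hmin k) fun h ↦ hk ((hmemJ k).2 h.symm)
    generalize a k = b at hlt
    cases b with
    | top => simp
    | coe b =>
      norm_cast at *
      have key : ∀ j : ℕ, ∀ᶠ u' in 𝓝 u, V + j * (u' - u) < b + k * u' := fun j ↦ by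
        refine ContinuousAt.eventually_lt (by fun_prop) (by fun_prop) ?_
        simpa using hlt
      filter_upwards [key j₁, key j₂] with u' h h' _ using ⟨h.le, h'.le⟩
  obtain ⟨ε, hε, hball⟩ := Metric.eventually_nhds_iff.1 hev
  refine ⟨j₁, j₂, (hle _ hJ₀).1, (hle _ hJ₀).2, ?_, ?_, h₁, h₂,
    fun k hk ↦ hle k ((hmemJ k).2 hk), ε, hε, fun u' hu' k ↦ ?_, fun u' hu' k ↦ ?_⟩
  · rw [hval h₁]; exact WithTop.coe_ne_top
  · rw [hval h₂]; exact WithTop.coe_ne_top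
  · have hd : dist u' u < ε := by
      rw [Real.dist_eq, abs_lt]
      constructor <;> linarith [hu'.1, hu'.2]
    rcases lt_or_ge D k with hk | hk
    · simp [hD k hk]
    by_cases hkJ : k ∈ J
    · rw [hval h₁, hval ((hmemJ k).1 hkJ)]
      have h : (j₁ : ℝ) ≤ k := by exact_mod_cast (hle k hkJ).1
      norm_cast
      nlinarith [hu'.1]
    · refine le_trans (le_of_eq ?_) (hball hd k (by simpa [Nat.lt_succ_iff] using hk) hkJ).1
      rw [hval h₁, ← WithTop.coe_add]
      congr 1
      ring
  · have hd : dist u' u < ε := by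
      rw [Real.dist_eq, abs_lt]
      constructor <;> linarith [hu'.1, hu'.2]
    rcases lt_or_ge D k with hk | hk
    · simp [hD k hk]
    by_cases hkJ : k ∈ J
    · rw [hval h₂, hval ((hmemJ k).1 hkJ)]
      have h : (k : ℝ) ≤ j₂ := by exact_mod_cast (hle k hkJ).2
      norm_cast
      nlinarith [hu'.2]
    · refine le_trans (le_of_eq ?_) (hball hd k (by simpa [Nat.lt_succ_iff] using hk) hkJ).2
      rw [hval h₂, ← WithTop.coe_add]
      congr 1
      ring

variable {K : Type*} [Field K] (v : AddValuation K (WithTop ℝ)) {n : ℕ}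

theorem update_mem_tropHyp_emb {i : Fin n} {f : Polynomial (MvPolynomial (Fin i) K)}
    {w : Fin n → ℝ} {u : ℝ} {j : ℕ} (hw : initCoords i w ∈ tropHyp v (f.coeff j))
    (hmin : ∀ k : ℕ, tropMin v (f.coeff j) (initCoords i w) + ((j * u : ℝ) : WithTop ℝ) ≤
      tropMin v (f.coeff k) (initCoords i w) + ((k * u : ℝ) : WithTop ℝ)) :
    Function.update w i u ∈ tropHyp v (emb i f) := by
  obtain ⟨α, hα, β, -, hne, h₁, h₂⟩ := hw
  rw [mem_tropHyp_emb_iff, initCoords_update]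
  refine ⟨(α, j), (β, j), fun h ↦ hne (congrArg Prod.fst h),
    (tropTerm_ne_top_iff v).2 (mem_support_iff.1 hα), ?_, ?_⟩
  · simp only [h₁, h₂]
  · simpa only [Function.update_self, h₁] using hmin

theorem exists_Ioo_or_exists_root [IsAlgClosed K] {i : Fin n}
    {f : Polynomial (MvPolynomial (Fin i) K)} {w : Fin n → ℝ} (hw : w ∈ tropHyp v (emb i f))
    {z : Fin i → K} (hz : ∀ l, v (z l) = initCoords i w l) :
    (∃ a b, a < b ∧ ∀ u ∈ Set.Ioo a b, Function.update w i u ∈ tropHyp v (emb i f)) ∨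
      ∃ y, v y = w i ∧ (f.map (eval z)).eval y = 0 := by
  obtain ⟨p, q, hne, hfin, heq, hmin⟩ := (mem_tropHyp_emb_iff v).1 hw
  have hcancel : ∀ {a b : WithTop ℝ} {c : ℝ}, a + (c : WithTop ℝ) ≤ b + (c : WithTop ℝ) → a ≤ b :=
    fun h ↦ WithTop.le_of_add_le_add_right WithTop.coe_ne_top h
  have hp : tropTerm v (f.coeff p.2) (initCoords i w) p.1 =
      tropMin v (f.coeff p.2) (initCoords i w) :=
    le_antisymm (hcancel (hmin p.2)) (tropMin_le v _ _ _)
  have hq : tropTerm v (f.coeff q.2) (initCoords i w) q.1 =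
      tropMin v (f.coeff q.2) (initCoords i w) :=
    le_antisymm (hcancel (heq ▸ hmin q.2)) (tropMin_le v _ _ _)
  rw [hp] at hfin heq hmin
  rw [hq] at heq
  obtain ⟨j₁, j₂, -, -, hf₁, hf₂, he₁, he₂, hle, ε, hε, hI₁, hI₂⟩ :=
    exists_extreme_minimizers (a := fun j ↦ tropMin v (f.coeff j) (initCoords i w))
      (D := f.natDegree) (fun j hj ↦ by simp [f.coeff_eq_zero_of_natDegree_lt hj, tropMin])
      hfin hmin
  by_cases h₁ : initCoords i w ∈ tropHyp v (f.coeff j₁)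
  · exact .inl ⟨_, _, lt_add_of_pos_right _ hε, fun u hu ↦
      update_mem_tropHyp_emb v h₁ (hI₁ u hu)⟩
  by_cases h₂ : initCoords i w ∈ tropHyp v (f.coeff j₂)
  · exact .inl ⟨_, _, sub_lt_self _ hε, fun u hu ↦
      update_mem_tropHyp_emb v h₂ (hI₂ u hu)⟩
  have hj : j₁ ≠ j₂ := by
    rintro rfl
    have hp' := hle p.2 rfl
    have hq' := hle q.2 heq.symm
    have hp₂ : p.2 = j₁ := le_antisymm hp'.2 hp'.1
    have hq₂ : q.2 = j₁ := le_antisymm hq'.2 hq'.1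
    rw [hp₂] at hp hfin
    rw [hq₂] at hq
    refine h₁ ⟨p.1, ?_, q.1, ?_, fun h ↦ hne (Prod.ext h (hp₂.trans hq₂.symm)), hp, hq⟩
    · rw [mem_support_iff, ← tropTerm_ne_top_iff v (w := initCoords i w), hp]
      exact hfin
    · rw [mem_support_iff, ← tropTerm_ne_top_iff v (w := initCoords i w), hq]
      exact hfin
  have hv₁ := map_eval_eq_tropMin v hz h₁
  have hv₂ := map_eval_eq_tropMin v hz h₂
  refine .inr (exists_root_of_min_attained_twice v hj ?_ ?_ fun k ↦ ?_)
  · rw [Polynomial.coeff_map, hv₁]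
    exact hf₁
  · rw [Polynomial.coeff_map, Polynomial.coeff_map, hv₁, hv₂]
    exact he₁.trans he₂.symm
  · rw [Polynomial.coeff_map, Polynomial.coeff_map, hv₁]
    exact (he₁.le.trans (hmin k)).trans (add_le_add_left (tropMin_le_map_eval v _ hz) _)

theorem exists_update_mem_tropHyp_emb {i : Fin n} {f : Polynomial (MvPolynomial (Fin i) K)}
    {j : ℕ} (hj : j < f.natDegree) (hfj : f.coeff j ≠ 0) (w : Fin n → ℝ) :
    ∃ u, Function.update w i u ∈ tropHyp v (emb i f) := by
  set D := f.natDegree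
  have hfD : f.coeff D ≠ 0 := Polynomial.leadingCoeff_ne_zero.2 fun h ↦ hfj (by simp [h])
  have hfin : ∀ k, f.coeff k ≠ 0 → ∃ x : ℝ, tropMin v (f.coeff k) (initCoords i w) = x := by
    intro k hk
    obtain ⟨x, hx⟩ := WithTop.ne_top_iff_exists.1
      ((tropMin_ne_top_iff v (w := initCoords i w)).2 hk)
    exact ⟨x, hx.symm⟩
  choose! x hx using hfin
  have hjS : j ∈ f.support.erase D := by simp [hj.ne, hfj]
  obtain ⟨k, hk, hkmin⟩ := Finset.exists_min_image (f.support.erase D)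
    (fun k ↦ (x k - x D) / (D - k)) ⟨j, hjS⟩
  obtain ⟨hkD, hk⟩ := Finset.mem_erase.1 hk
  have hk0 := Polynomial.mem_support_iff.1 hk
  have hltD : ∀ l, l ≠ D → f.coeff l ≠ 0 → (0 : ℝ) < D - l := fun l hl hl0 ↦ by
    rw [sub_pos, Nat.cast_lt]
    exact lt_of_le_of_ne (Polynomial.le_natDegree_of_ne_zero hl0) hl
  set u := (x k - x D) / (D - k) with hu
  have hDk : x D + D * u = x k + k * u := by
    have := div_mul_cancel₀ (x k - x D) (hltD k hkD hk0).ne'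
    rw [← hu] at this
    linarith
  obtain ⟨α, -, hα⟩ := exists_tropTerm_eq_tropMin v hfD (initCoords i w)
  obtain ⟨β, -, hβ⟩ := exists_tropTerm_eq_tropMin v hk0 (initCoords i w)
  refine ⟨u, ?_⟩
  rw [mem_tropHyp_emb_iff, initCoords_update]
  refine ⟨(α, D), (β, k), fun h ↦ hkD (congrArg Prod.snd h).symm, ?_, ?_, fun l ↦ ?_⟩
  · simp only [hα, hx D hfD]
    exact WithTop.coe_ne_top
  · simp only [hα, hβ, hx D hfD, hx k hk0, Function.update_self]
    exact_mod_cast hDk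
  · simp only [hα, hx D hfD, Function.update_self]
    by_cases hl0 : f.coeff l = 0
    · simp [hl0, tropMin]
    rw [hx l hl0]
    rcases eq_or_ne l D with rfl | hlD
    · exact le_rfl
    have h := hkmin l (by simp [hlD, hl0])
    rw [le_div_iff₀ (hltD l hlD hl0)] at h
    norm_cast
    linarith

end Fiber

section Continuity

open MvPolynomial

variable {K : Type*} [Field K] (v : AddValuation K (WithTop ℝ))

theorem exists_lt_map_of_nontrivial (hv : ∃ a : K, a ≠ 0 ∧ v a ≠ 0) (N : ℝ) :
    ∃ t : K, t ≠ 0 ∧ (N : WithTop ℝ) < v t := by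
  have hpos : ∃ a : K, ∃ x : ℝ, 0 < x ∧ v a = x := by
    obtain ⟨a, ha, hva⟩ := hv
    obtain ⟨x, hx⟩ := WithTop.ne_top_iff_exists.1 (v.ne_top_iff.2 ha)
    obtain ⟨y, hy⟩ := WithTop.ne_top_iff_exists.1 (v.ne_top_iff.2 (inv_ne_zero ha))
    have hxy : v a + v a⁻¹ = 0 := by rw [← AddValuation.map_mul, mul_inv_cancel₀ ha, v.map_one]
    rw [← hx, ← hy] at hxy
    rw [← hx] at hva
    norm_cast at hxy hva
    rcases lt_or_gt_of_ne hva with h | h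
    · exact ⟨a⁻¹, y, by linarith, hy.symm⟩
    · exact ⟨a, x, h, hx.symm⟩
  obtain ⟨a, x, hx, hax⟩ := hpos
  obtain ⟨k, hk⟩ := exists_lt_nsmul hx N
  have hak : v (a ^ k) = ((k • x : ℝ) : WithTop ℝ) := by
    rw [AddValuation.map_pow, hax, WithTop.coe_nsmul]
  refine ⟨a ^ k, v.ne_top_iff.1 (by rw [hak]; exact WithTop.coe_ne_top), ?_⟩
  rw [hak]
  exact_mod_cast hk

theorem exists_forall_lt_map_mul (a : K) (M : ℝ) :
    ∃ N : ℝ, ∀ b, (N : WithTop ℝ) < v b → (M : WithTop ℝ) < v (a * b) := by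
  rcases eq_or_ne a 0 with rfl | ha
  · exact ⟨0, fun b _ ↦ by simp⟩
  obtain ⟨x, hx⟩ := WithTop.ne_top_iff_exists.1 (v.ne_top_iff.2 ha)
  refine ⟨M - x, fun b hb ↦ ?_⟩
  rw [AddValuation.map_mul, ← hx]
  generalize v b = y at hb
  cases y
  · exact WithTop.coe_lt_top _
  · norm_cast at *
    linarith

theorem exists_forall_lt_map_eval_sub {m : ℕ} (g : MvPolynomial (Fin m) K) (z : Fin m → K)
    (M : ℝ) : ∃ N : ℝ, ∀ z' : Fin m → K, (∀ j, (N : WithTop ℝ) < v (z' j - z j)) →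
      (M : WithTop ℝ) < v (eval z' g - eval z g) := by
  induction g using MvPolynomial.induction_on generalizing M with
  | C a => exact ⟨0, fun z' _ ↦ by simp⟩
  | add p q hp hq =>
    obtain ⟨N₁, h₁⟩ := hp M
    obtain ⟨N₂, h₂⟩ := hq M
    refine ⟨max N₁ N₂, fun z' hz' ↦ ?_⟩
    rw [map_add, map_add, add_sub_add_comm]
    refine lt_of_lt_of_le (lt_min (h₁ z' fun j ↦ ?_) (h₂ z' fun j ↦ ?_)) (v.map_add _ _)
    · exact lt_of_le_of_lt (WithTop.coe_le_coe.2 (le_max_left _ _)) (hz' j)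
    · exact lt_of_le_of_lt (WithTop.coe_le_coe.2 (le_max_right _ _)) (hz' j)
  | mul_X p i hp =>
    obtain ⟨N₁, h₁⟩ := exists_forall_lt_map_mul v (z i) M
    obtain ⟨N₂, h₂⟩ := hp (max N₁ (max M 0))
    obtain ⟨N₃, h₃⟩ := exists_forall_lt_map_mul v (eval z p) M
    refine ⟨max N₂ (max N₃ 0), fun z' hz' ↦ ?_⟩
    have hp' := h₂ z' fun j ↦ lt_of_le_of_lt (WithTop.coe_le_coe.2 (le_max_left _ _)) (hz' j)
    have hN₃ : ((max N₃ 0 : ℝ) : WithTop ℝ) < v (z' i - z i) :=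
      lt_of_le_of_lt (WithTop.coe_le_coe.2 (le_max_right _ _)) (hz' i)
    have e : eval z' (p * X i) - eval z (p * X i) =
        (eval z' p - eval z p) * (z' i - z i) + (eval z p * (z' i - z i) +
          z i * (eval z' p - eval z p)) := by
      simp only [map_mul, eval_X]
      ring
    rw [e]
    refine lt_of_lt_of_le (lt_min ?_ (lt_of_lt_of_le (lt_min (h₃ _ ?_) (h₁ _ ?_))
      (v.map_add _ _))) (v.map_add _ _)
    · rw [AddValuation.map_mul]
      have h0 : ((0 : ℝ) : WithTop ℝ) < v (z' i - z i) :=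
        lt_of_le_of_lt (WithTop.coe_le_coe.2 (le_max_right _ _)) hN₃
      have hM : ((M : ℝ) : WithTop ℝ) < v (eval z' p - eval z p) :=
        lt_of_le_of_lt (WithTop.coe_le_coe.2 ((le_max_left _ _).trans (le_max_right _ _))) hp'
      generalize v (z' i - z i) = a at h0
      generalize v (eval z' p - eval z p) = b at hM
      cases a
      · simp
      cases b
      · simp
      norm_cast at *
      linarith
    · exact lt_of_le_of_lt (WithTop.coe_le_coe.2 (le_max_left _ _)) hN₃
    · exact lt_of_le_of_lt (WithTop.coe_le_coe.2 (le_max_left _ _)) hp'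

theorem exists_forall_exists_root_near [IsAlgClosed K] {m : ℕ}
    (f : Polynomial (MvPolynomial (Fin m) K)) {z : Fin m → K} (hf : f.map (eval z) ≠ 0) {y₀ : K}
    (hy₀ : (f.map (eval z)).eval y₀ = 0) (M : ℝ) :
    ∃ N : ℝ, ∀ z' : Fin m → K, (∀ j, (N : WithTop ℝ) < v (z' j - z j)) →
      ∃ y, (M : WithTop ℝ) < v (y - y₀) ∧ (f.map (eval z')).eval y = 0 := by
  set h := f.comp (Polynomial.X + Polynomial.C (C y₀)) with hh
  have hmap : ∀ z' : Fin m → K, h.map (eval z') =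
      (f.map (eval z')).comp (Polynomial.X + Polynomial.C y₀) := fun z' ↦ by
    simp [hh, Polynomial.map_comp]
  have hne : h.map (eval z) ≠ 0 := by
    rw [hmap]
    exact Polynomial.comp_X_add_C_ne_zero_iff.2 hf
  obtain ⟨j, hj⟩ : ∃ j, eval z (h.coeff j) ≠ 0 := by
    by_contra! H
    exact hne (Polynomial.ext fun j ↦ by simp [Polynomial.coeff_map, H])
  have h0 : eval z (h.coeff 0) = 0 := by
    rw [← Polynomial.coeff_map, hmap, Polynomial.coeff_zero_eq_eval_zero]
    simpa using hy₀
  obtain ⟨x, hx⟩ := WithTop.ne_top_iff_exists.1 (v.ne_top_iff.2 hj)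
  obtain ⟨N₁, h₁⟩ := exists_forall_lt_map_eval_sub v (h.coeff j) z x
  obtain ⟨N₂, h₂⟩ := exists_forall_lt_map_eval_sub v (h.coeff 0) z (x + j * M)
  refine ⟨max N₁ N₂, fun z' hz' ↦ ?_⟩
  have hz₁ := h₁ z' fun j ↦ lt_of_le_of_lt (WithTop.coe_le_coe.2 (le_max_left _ _)) (hz' j)
  have hz₂ := h₂ z' fun j ↦ lt_of_le_of_lt (WithTop.coe_le_coe.2 (le_max_right _ _)) (hz' j)
  rw [hx] at hz₁
  have hvj := v.map_eq_of_lt_sub hz₁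
  rw [h0, sub_zero] at hz₂
  obtain ⟨s, hs, hs0⟩ := exists_root_of_coeff_zero_gt v (p := h.map (eval z')) (M := M) (j := j) <| by
    rw [Polynomial.coeff_map, Polynomial.coeff_map, hvj, ← hx]
    exact hz₂
  refine ⟨s + y₀, by simpa using hs, ?_⟩
  rw [hmap] at hs0
  simpa using hs0

theorem map_eval_initCoords_ne_zero [IsAlgClosed K] (hv : ∃ a : K, a ≠ 0 ∧ v a ≠ 0) {n : ℕ}
    (f : (i : Fin n) → Polynomial (MvPolynomial (Fin (i : ℕ)) K))
    (hVfin : {z : Fin n → K | ∀ i, eval z (emb i (f i)) = 0}.Finite)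
    {z : Fin n → K} (hz : ∀ i, eval z (emb i (f i)) = 0) (i : Fin n) :
    (f i).map (eval (initCoords i z)) ≠ 0 := by
  classical
  intro hi
  obtain ⟨k, hk, hkmax⟩ := Finset.exists_max_image
    (Finset.univ.filter fun i ↦ (f i).map (eval (initCoords i z)) = 0) id ⟨i, by simp [hi]⟩
  simp only [Finset.mem_filter, Finset.mem_univ, true_and, id] at hk hkmax
  have key : ∀ m : ℕ, (k : ℕ) + 1 ≤ m → ∀ N : ℝ, ∃ z' : Fin n → K, z' k ≠ z k ∧
      (∀ j, (N : WithTop ℝ) < v (z' j - z j)) ∧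
      ∀ i : Fin n, (i : ℕ) < m → eval z' (emb i (f i)) = 0 := by
    intro m hm
    induction m, hm using Nat.le_induction with
    | base =>
      intro N
      obtain ⟨t, ht, htN⟩ := exists_lt_map_of_nontrivial v hv N
      refine ⟨Function.update z k (z k + t), by simpa using ht, fun j ↦ ?_, fun i hi ↦ ?_⟩
      · rcases eq_or_ne j k with rfl | hj
        · simpa using htN
        · simp [hj]
      · have hik : i ≤ k := Fin.le_def.2 (Nat.lt_succ_iff.1 hi)
        rw [eval_emb, initCoords_congr (w' := z) fun l hl ↦
          Function.update_of_ne (hl.trans_le hik).ne _ _]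
        rcases hik.eq_or_lt with rfl | hlt
        · rw [hk, Polynomial.eval_zero]
        · rw [Function.update_of_ne hlt.ne, ← eval_emb, hz]
    | succ m hm ih =>
      intro N
      by_cases hmn : m < n
      swap
      · obtain ⟨z', h₁, h₂, h₃⟩ := ih N
        exact ⟨z', h₁, h₂, fun i _ ↦ h₃ i (by omega)⟩
      have hki : k < ⟨m, hmn⟩ := Fin.lt_def.2 hm
      obtain ⟨N', hN'⟩ := exists_forall_exists_root_near v (f ⟨m, hmn⟩)
        (fun h ↦ (hkmax _ h).not_gt hki) ((eval_emb _ _ _).symm.trans (hz ⟨m, hmn⟩)) N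
      obtain ⟨z', h₁, h₂, h₃⟩ := ih (max N N')
      obtain ⟨y, hy, hy0⟩ := hN' (initCoords ⟨m, hmn⟩ z') fun j ↦
        lt_of_le_of_lt (WithTop.coe_le_coe.2 (le_max_right _ _)) (h₂ _)
      refine ⟨Function.update z' ⟨m, hmn⟩ y, ?_, fun j ↦ ?_, fun i hi ↦ ?_⟩
      · rwa [Function.update_of_ne hki.ne]
      · rcases eq_or_ne j ⟨m, hmn⟩ with rfl | hj
        · rwa [Function.update_self]
        · rw [Function.update_of_ne hj]
          exact lt_of_le_of_lt (WithTop.coe_le_coe.2 (le_max_left _ _)) (h₂ j)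
      · rcases Nat.lt_succ_iff_lt_or_eq.1 hi with hlt | heq
        · have hlt' : i < ⟨m, hmn⟩ := Fin.lt_def.2 hlt
          rw [eval_emb, initCoords_congr (w' := z') fun l hl ↦
            Function.update_of_ne (hl.trans hlt').ne _ _, Function.update_of_ne hlt'.ne,
            ← eval_emb, h₃ i hlt]
        · obtain rfl : i = ⟨m, hmn⟩ := Fin.ext heq
          rw [eval_emb, initCoords_update, Function.update_self, hy0]
  obtain ⟨N, hN⟩ := (hVfin.image fun z' : Fin n → K ↦ (v (z' k - z k)).untopD 0).bddAbove
  obtain ⟨z', h₁, h₂, h₃⟩ := key n k.isLt N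
  have hle := hN ⟨z', fun i ↦ h₃ i i.isLt, rfl⟩
  obtain ⟨x, hx⟩ := WithTop.ne_top_iff_exists.1 (v.ne_top_iff.2 (sub_ne_zero.2 h₁))
  have hlt := h₂ k
  simp only [← hx, WithTop.untopD_coe] at hle hlt
  exact hle.not_gt (WithTop.coe_lt_coe.1 hlt)

end Continuity

section Dimension

open MvPolynomial Set

theorem card_le_dimH_of_forall_exists {n : ℕ} {p : Fin n → Prop} [DecidablePred p]
    {S : Set (Fin n → ℝ)} {U : Set ({j // p j} → ℝ)} (hU : IsOpen U) (hne : U.Nonempty)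
    (h : ∀ y ∈ U, ∃ x ∈ S, ∀ j : {j // p j}, x j = y j) :
    (Fintype.card {j // p j} : ENNReal) ≤ dimH S := by
  have hlip : LipschitzWith 1 fun (x : Fin n → ℝ) (j : {j // p j}) ↦ x j :=
    LipschitzWith.of_dist_le_mul fun x y ↦ by
      rw [NNReal.coe_one, one_mul]
      exact (dist_pi_le_iff dist_nonneg).2 fun j ↦ dist_le_pi_dist x y j
  calc (Fintype.card {j // p j} : ENNReal) = dimH U := by
        rw [Real.dimH_of_nonempty_interior (by rwa [hU.interior_eq]), Module.finrank_pi]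
    _ ≤ dimH ((fun (x : Fin n → ℝ) (j : {j // p j}) ↦ x j) '' S) := dimH_mono fun y hy ↦ by
        obtain ⟨x, hx, hxy⟩ := h y hy
        exact ⟨x, hx, funext hxy⟩
    _ ≤ dimH S := hlip.dimH_image_le S

theorem dimH_le_card_of_forall_exists {n : ℕ} {p : Fin n → Prop} [DecidablePred p]
    {S T : Set (Fin n → ℝ)} (hT : T.Finite) (h : ∀ x ∈ S, ∃ w ∈ T, ∀ j, ¬ p j → x j = w j) :
    dimH S ≤ Fintype.card {j // p j} := by
  let φ : (Fin n → ℝ) → ({j // p j} → ℝ) → Fin n → ℝ :=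
    fun w y j ↦ if hj : p j then y ⟨j, hj⟩ else w j
  have hlip : ∀ w, LipschitzWith 1 (φ w) := fun w ↦ LipschitzWith.of_dist_le_mul fun x y ↦ by
    rw [NNReal.coe_one, one_mul]
    refine (dist_pi_le_iff dist_nonneg).2 fun j ↦ ?_
    by_cases hj : p j
    · simpa [φ, hj] using dist_le_pi_dist x y ⟨j, hj⟩
    · simp [φ, hj]
  calc dimH S ≤ dimH (⋃ w ∈ T, range (φ w)) := dimH_mono fun x hx ↦ by
        obtain ⟨w, hw, hxw⟩ := h x hx
        refine mem_iUnion₂.2 ⟨w, hw, fun j ↦ x j, funext fun j ↦ ?_⟩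
        by_cases hj : p j
        · simp [φ, hj]
        · simp [φ, hj, hxw j hj]
    _ = ⨆ w ∈ T, dimH (range (φ w)) := dimH_bUnion hT.countable _
    _ ≤ Fintype.card {j // p j} := iSup₂_le fun w _ ↦ by
        rw [← Real.dimH_univ_pi]
        exact (hlip w).dimH_range_le

variable {K : Type*} [Field K] (v : AddValuation K (WithTop ℝ)) {n : ℕ}
  {f : (i : Fin n) → Polynomial (MvPolynomial (Fin (i : ℕ)) K)}

theorem not_forall_Ioo_mem_tropHyp {k : Fin n}
    (hdim : dimH (⋂ i : Fin n, ⋂ _ : i ≤ k, tropHyp v (emb i (f i))) = (n - ((k : ℕ) + 1) : ℕ))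
    {w : Fin n → ℝ} (hw : ∀ i, w ∈ tropHyp v (emb i (f i))) :
    ¬ ∃ a b, a < b ∧ ∀ u ∈ Ioo a b, Function.update w k u ∈ tropHyp v (emb k (f k)) := by
  rintro ⟨a, b, hab, h⟩
  have hcard := card_le_dimH_of_forall_exists (p := fun j ↦ k ≤ j)
    (S := ⋂ i : Fin n, ⋂ _ : i ≤ k, tropHyp v (emb i (f i)))
    (U := (fun y ↦ y ⟨k, le_rfl⟩) ⁻¹' Ioo a b) (isOpen_Ioo.preimage (continuous_apply _))
    ⟨fun _ ↦ (a + b) / 2, by simp only [mem_preimage, mem_Ioo]; constructor <;> linarith⟩ ?_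
  · rw [hdim, Nat.cast_le, Fintype.card_subtype, Finset.filter_le_eq_Ici, Fin.card_Ici] at hcard
    have := k.isLt
    omega
  · intro y hy
    refine ⟨fun j ↦ if hj : k ≤ j then y ⟨j, hj⟩ else w j, ?_, fun j ↦ by simp [j.2]⟩
    refine mem_iInter₂.2 fun i hi ↦ ?_
    rcases hi.eq_or_lt with rfl | hlt
    · refine (mem_tropHyp_emb_congr v fun l hl ↦ ?_).1 (h _ hy)
      rcases hl.eq_or_lt with rfl | hl
      · simp
      · simp [hl.ne, hl]
    · refine (mem_tropHyp_emb_congr v fun l hl ↦ ?_).1 (hw i)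
      simp [hl.trans_lt hlt]

theorem exists_lift_of_mem_tropHyp [IsAlgClosed K]
    (hdim : ∀ k, dimH (⋂ i : Fin n, ⋂ _ : i ≤ k, tropHyp v (emb i (f i))) =
      (n - ((k : ℕ) + 1) : ℕ))
    {w : Fin n → ℝ} (hw : ∀ i, w ∈ tropHyp v (emb i (f i))) :
    ∃ z : Fin n → K, (∀ i, eval z (emb i (f i)) = 0) ∧ ∀ i, v (z i) = w i := by
  suffices key : ∀ m : ℕ, ∃ z : Fin n → K, ∀ i : Fin n, (i : ℕ) < m →
      eval z (emb i (f i)) = 0 ∧ v (z i) = w i by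
    obtain ⟨z, hz⟩ := key n
    exact ⟨z, fun i ↦ (hz i i.isLt).1, fun i ↦ (hz i i.isLt).2⟩
  intro m
  induction m with
  | zero => exact ⟨0, fun i hi ↦ absurd hi (Nat.not_lt_zero _)⟩
  | succ m ih =>
    obtain ⟨z, hz⟩ := ih
    by_cases hmn : m < n
    swap
    · exact ⟨z, fun i _ ↦ hz i (by omega)⟩
    obtain ⟨y, hy, hy0⟩ := (exists_Ioo_or_exists_root v (hw ⟨m, hmn⟩)
      (z := initCoords ⟨m, hmn⟩ z) fun l ↦ (hz _ l.isLt).2).resolve_left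
        (not_forall_Ioo_mem_tropHyp v (hdim _) hw)
    refine ⟨Function.update z ⟨m, hmn⟩ y, fun i hi ↦ ?_⟩
    rcases Nat.lt_succ_iff_lt_or_eq.1 hi with hlt | heq
    · have hlt' : i < ⟨m, hmn⟩ := Fin.lt_def.2 hlt
      rw [eval_emb, initCoords_congr (w' := z) fun l hl ↦
        Function.update_of_ne (hl.trans hlt').ne _ _, Function.update_of_ne hlt'.ne, ← eval_emb]
      exact hz i hlt
    · obtain rfl : i = ⟨m, hmn⟩ := Fin.ext heq
      rw [eval_emb, initCoords_update, Function.update_self]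
      exact ⟨hy0, hy⟩

theorem exists_extension_mem_tropHyp (hf : ∀ i, ∃ j < (f i).natDegree, (f i).coeff j ≠ 0)
    (k : Fin n) {x : Fin n → ℝ} (hx : ∀ i ≤ k, x ∈ tropHyp v (emb i (f i))) :
    ∃ w, (∀ i, w ∈ tropHyp v (emb i (f i))) ∧ ∀ j, ¬ k < j → x j = w j := by
  suffices key : ∀ m : ℕ, (k : ℕ) + 1 ≤ m → ∃ w, (∀ i : Fin n, (i : ℕ) < m →
      w ∈ tropHyp v (emb i (f i))) ∧ ∀ j, ¬ k < j → x j = w j by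
    obtain ⟨w, h₁, h₂⟩ := key n k.isLt
    exact ⟨w, fun i ↦ h₁ i i.isLt, h₂⟩
  intro m hm
  induction m, hm using Nat.le_induction with
  | base => exact ⟨x, fun i hi ↦ hx i (Fin.le_def.2 (Nat.lt_succ_iff.1 hi)), fun _ _ ↦ rfl⟩
  | succ m hm ih =>
    obtain ⟨w, h₁, h₂⟩ := ih
    by_cases hmn : m < n
    swap
    · exact ⟨w, fun i _ ↦ h₁ i (by omega), h₂⟩
    have hkm : k < ⟨m, hmn⟩ := Fin.lt_def.2 hm
    obtain ⟨j, hj, hj0⟩ := hf ⟨m, hmn⟩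
    obtain ⟨u, hu⟩ := exists_update_mem_tropHyp_emb v hj hj0 w
    refine ⟨Function.update w ⟨m, hmn⟩ u, fun i hi ↦ ?_, fun j hj ↦ ?_⟩
    · rcases Nat.lt_succ_iff_lt_or_eq.1 hi with hlt | heq
      · refine (mem_tropHyp_emb_congr v fun l hl ↦ ?_).1 (h₁ i hlt)
        rw [Function.update_of_ne (hl.trans_lt (Fin.lt_def.2 hlt)).ne]
      · obtain rfl : i = ⟨m, hmn⟩ := Fin.ext heq
        exact hu
    · rw [Function.update_of_ne (by rintro rfl; exact hj hkm), h₂ j hj]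

theorem dimH_iInter_tropHyp_eq (hf : ∀ i, ∃ j < (f i).natDegree, (f i).coeff j ≠ 0)
    (hfin : (⋂ i, tropHyp v (emb i (f i))).Finite)
    (hne : (⋂ i, tropHyp v (emb i (f i))).Nonempty) (k : Fin n) :
    dimH (⋂ i : Fin n, ⋂ _ : i ≤ k, tropHyp v (emb i (f i))) = (n - ((k : ℕ) + 1) : ℕ) := by
  have hcard : Fintype.card {j // k < j} = n - ((k : ℕ) + 1) := by
    rw [Fintype.card_subtype, Finset.filter_lt_eq_Ioi, Fin.card_Ioi]
    omega
  rw [← hcard]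
  refine le_antisymm (dimH_le_card_of_forall_exists hfin fun x hx ↦ ?_) ?_
  · obtain ⟨w, hw, hxw⟩ := exists_extension_mem_tropHyp v hf k (mem_iInter₂.1 hx)
    exact ⟨w, mem_iInter.2 hw, hxw⟩
  · obtain ⟨w, hw⟩ := hne
    refine card_le_dimH_of_forall_exists isOpen_univ univ_nonempty fun y _ ↦
      ⟨fun j ↦ if hj : k < j then y ⟨j, hj⟩ else w j, mem_iInter₂.2 fun i hi ↦ ?_,
        fun j ↦ by simp [j.2]⟩
    refine (mem_tropHyp_emb_congr v fun l hl ↦ ?_).1 (mem_iInter.1 hw i)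
    simp [(hl.trans hi).not_gt]

theorem exists_coeff_ne_zero_of_eval_eq_zero [IsAlgClosed K] (hv : ∃ a : K, a ≠ 0 ∧ v a ≠ 0)
    (hVfin : {z : Fin n → K | ∀ i, eval z (emb i (f i)) = 0}.Finite)
    {z : Fin n → K} (hz : ∀ i, eval z (emb i (f i)) = 0) (hz0 : ∀ i, z i ≠ 0) (i : Fin n) :
    ∃ j < (f i).natDegree, (f i).coeff j ≠ 0 := by
  by_contra! H
  have hmono : f i = Polynomial.C (f i).leadingCoeff * Polynomial.X ^ (f i).natDegree := by
    ext1 j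
    rw [Polynomial.coeff_C_mul_X_pow]
    split_ifs with h
    · rw [h, Polynomial.leadingCoeff]
    · rcases lt_or_gt_of_ne h with h | h
      · exact H j h
      · exact Polynomial.coeff_eq_zero_of_natDegree_lt h
  have hP := map_eval_initCoords_ne_zero v hv f hVfin hz i
  have h0 := hz i
  rw [eval_emb] at h0
  rw [hmono] at h0 hP
  simp only [Polynomial.map_mul, Polynomial.map_C, Polynomial.map_pow, Polynomial.map_X,
    Polynomial.eval_mul, Polynomial.eval_C, Polynomial.eval_pow, Polynomial.eval_X] at h0 hP
  rcases mul_eq_zero.1 h0 with h | h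
  · exact hP (by rw [h, Polynomial.C_0, zero_mul])
  · exact pow_ne_zero _ (hz0 i) h

end Dimension

theorem stmt4 {K : Type*} [Field K] [IsAlgClosed K] (ν : K → WithTop ℝ)
    (hν0 : ∀ a : K, ν a = ⊤ ↔ a = 0)
    (hνM : ∀ a b : K, ν (a * b) = ν a + ν b)
    (hνA : ∀ a b : K, min (ν a) (ν b) ≤ ν (a + b))
    (hνNT : ∃ a : K, a ≠ 0 ∧ ν a ≠ 0)
    {n : ℕ} (f : (i : Fin n) → Polynomial (MvPolynomial (Fin (i : ℕ)) K))
    (htri : ∀ i, 1 ≤ (f i).natDegree)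
    (hVfin : {z : Fin n → K | ∀ i, MvPolynomial.eval z (emb i (f i)) = 0}.Finite)
    (hVne : {z : Fin n → K | ∀ i, MvPolynomial.eval z (emb i (f i)) = 0}.Nonempty)
    (hVtor : ∀ z : Fin n → K, (∀ i, MvPolynomial.eval z (emb i (f i)) = 0) → ∀ j, z j ≠ 0) :
    (∀ k : Fin n,
        (⋂ i : Fin n, ⋂ _ : i ≤ k, tropHyp ν (emb i (f i))).Nonempty ∧
        dimH (⋂ i : Fin n, ⋂ _ : i ≤ k, tropHyp ν (emb i (f i))) = (n - ((k : ℕ) + 1) : ℕ)) ↔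
      (⋂ i : Fin n, tropHyp ν (emb i (f i))) =
        closure {v : Fin n → ℝ | ∃ z : Fin n → K, (∀ j, z j ≠ 0) ∧
          (∀ i, MvPolynomial.eval z (emb i (f i)) = 0) ∧
          ∀ j, ν (z j) = (v j : WithTop ℝ)} := by
  obtain ⟨v, rfl⟩ : ∃ v : AddValuation K (WithTop ℝ), ⇑v = ν := by
    have h1 : ν 1 = 0 := by
      have h := hνM 1 1
      obtain ⟨x, hx⟩ := WithTop.ne_top_iff_exists.1 ((hν0 1).not.2 one_ne_zero)
      rw [mul_one, ← hx] at h
      rw [← hx]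
      norm_cast at *
      linarith
    exact ⟨AddValuation.of ν ((hν0 0).2 rfl) h1 hνA hνM, rfl⟩
  set V : Set (Fin n → ℝ) := {x | ∃ z : Fin n → K, (∀ j, z j ≠ 0) ∧
    (∀ i, MvPolynomial.eval z (emb i (f i)) = 0) ∧ ∀ j, v (z j) = (x j : WithTop ℝ)} with hV
  have hVtrop : V.Finite := by
    refine (hVfin.image fun z j ↦ (v (z j)).untopD 0).subset ?_
    rintro x ⟨z, -, hz, hzx⟩
    exact ⟨z, hz, funext fun j ↦ by simp [hzx]⟩
  have hVsub : V ⊆ ⋂ i : Fin n, tropHyp v (emb i (f i)) := by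
    rintro x ⟨z, -, hz, hzx⟩
    refine Set.mem_iInter.2 fun i ↦ mem_tropHyp_of_eval_eq_zero v (emb_ne_zero i ?_) hzx (hz i)
    rintro h
    simpa [h] using htri i
  rw [hVtrop.isClosed.closure_eq]
  constructor
  · intro h
    refine Set.Subset.antisymm (fun w hw ↦ ?_) hVsub
    obtain ⟨z, hz, hzw⟩ := exists_lift_of_mem_tropHyp v (fun k ↦ (h k).2) (Set.mem_iInter.1 hw)
    exact ⟨z, hVtor z hz, hz, hzw⟩
  · intro h k
    obtain ⟨z, hz⟩ := hVne
    have hz0 := hVtor z hz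
    choose x hx using fun j ↦ WithTop.ne_top_iff_exists.1 (v.ne_top_iff.2 (hz0 j))
    have hxT : x ∈ ⋂ i : Fin n, tropHyp v (emb i (f i)) :=
      hVsub ⟨z, hz0, hz, fun j ↦ (hx j).symm⟩
    exact ⟨⟨x, Set.mem_iInter₂.2 fun i _ ↦ Set.mem_iInter.1 hxT i⟩,
      dimH_iInter_tropHyp_eq v (exists_coeff_ne_zero_of_eval_eq_zero v hνNT hVfin hz hz0)
        (h ▸ hVtrop) ⟨x, hxT⟩ k⟩
end

section
/- Let K be an algebraically closed field, let I ⊴ K[x_1,…,x_n] be a prime ideal such that the Krull dimension of K[x_1,…,x_n]/I equals d, such that {x_1,…,x_d} is algebraically independent modulo I (i.e. I ∩ K[x_1,…,x_d] = {0}), and such that the affine variety X = V(I) satisfies X ∩ (Kˣ)^n ≠ ∅. Then there exists a nonzero polynomial g ∈ K[y_1,…,y_d] such that for every λ ∈ (Kˣ)^d with g(λ) ≠ 0, the set X ∩ V(x_1 − λ_1, …, x_d − λ_d) is nonempty, finite (i.e. zero-dimensional), and contained in (Kˣ)^n. -/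
open scoped Pointwise

open MvPolynomial

theorem ringKrullDim_le_of_isIntegral {R S : Type*} [CommRing R] [CommRing S] [Algebra R S]
    [FaithfulSMul R S] [Algebra.IsIntegral R S] : ringKrullDim R ≤ ringKrullDim S := by
  refine iSup_le fun l => ?_
  obtain ⟨P, -, hP, hPl⟩ := Ideal.exists_ideal_over_prime_of_isIntegral l.head.asIdeal (⊥ : Ideal S)
    (by simp [← RingHom.ker_eq_comap_bot,
      (RingHom.injective_iff_ker_eq_bot _).mp (FaithfulSMul.algebraMap_injective R S)])
  have : P.LiesOver l.head.asIdeal := ⟨hPl.symm⟩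
  obtain ⟨L, hL, -⟩ := Ideal.exists_ltSeries_of_hasGoingUp l P
  exact hL ▸ Order.LTSeries.length_le_krullDim L

theorem trdeg_le_of_ringKrullDim_le {K S : Type*} [Field K] [CommRing S] [IsDomain S]
    [Algebra K S] [Algebra.FiniteType K S] {d : ℕ} (hdim : ringKrullDim S ≤ d) :
    Algebra.trdeg K S ≤ d := by
  obtain ⟨s, f, hinj, hint⟩ := exists_integral_inj_algHom_of_fg K S
  algebraize [f.toRingHom]
  have : FaithfulSMul (MvPolynomial (Fin s) K) S :=
    (faithfulSMul_iff_algebraMap_injective _ _).mpr hinj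
  have : IsScalarTower K (MvPolynomial (Fin s) K) S :=
    .of_algebraMap_eq fun x => (f.commutes x).symm
  have hsd : (s : WithBot ℕ∞) ≤ d := by
    refine le_trans ?_ (ringKrullDim_le_of_isIntegral (R := MvPolynomial (Fin s) K)
      |>.trans hdim)
    simp [MvPolynomial.ringKrullDim_of_isNoetherianRing]
  have hadd := lift_trdeg_add_eq K (MvPolynomial (Fin s) K) S
  have h0 : Algebra.trdeg (MvPolynomial (Fin s) K) S = 0 := trdeg_eq_zero
  have h2 : Algebra.trdeg K S = s := by
    rw [h0, MvPolynomial.trdeg_of_isDomain] at hadd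
    apply Cardinal.lift_injective
    rw [← hadd]
    simp
  rw [h2]
  exact_mod_cast hsd

/-- A prime of `A` avoiding the leading coefficients of algebraic equations satisfied by a set of
generators of `S` is the contraction of a prime of `S`. -/
theorem exists_isPrime_comap_eq_of_leadingCoeff_notMem {A S : Type*} [CommRing A] [CommRing S]
    [IsDomain S] [Algebra A S] [FaithfulSMul A S] {s : Set S} (hs : Algebra.adjoin A s = ⊤)
    (P : Ideal A) [P.IsPrime]
    (h : ∀ x ∈ s, ∃ p : Polynomial A, Polynomial.aeval x p = 0 ∧ p.leadingCoeff ∉ P) :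
    ∃ Q : Ideal S, Q.IsPrime ∧ Q.comap (algebraMap A S) = P := by
  have : IsDomain A := (FaithfulSMul.algebraMap_injective A S).isDomain (algebraMap A S)
  let M := P.primeCompl
  let Sₘ := Localization (Algebra.algebraMapSubmonoid S M)
  let Aₘ := Localization.AtPrime P
  let _ : Algebra Aₘ Sₘ := localizationAlgebra M S
  have : IsLocalization (Submonoid.map (algebraMap A S) M) Sₘ :=
    inferInstanceAs (IsLocalization (Algebra.algebraMapSubmonoid S M) Sₘ)
  have htower : IsScalarTower A Aₘ Sₘ := by
    refine .of_algebraMap_eq fun x => ?_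
    rw [localizationAlgebraMap_def, IsLocalization.map_eq]
    exact IsScalarTower.algebraMap_apply A S Sₘ x
  have hM : Algebra.algebraMapSubmonoid S M ≤ nonZeroDivisors S := by
    rintro _ ⟨a, ha, rfl⟩
    refine mem_nonZeroDivisors_of_ne_zero ?_
    rw [Ne, FaithfulSMul.algebraMap_eq_zero_iff]
    rintro rfl
    exact ha P.zero_mem
  have hinj : Function.Injective (algebraMap Aₘ Sₘ) :=
    IsLocalization.map_injective_of_injective M Aₘ Sₘ (FaithfulSMul.algebraMap_injective A S)
  have hSm : ∀ x : S, IsIntegral Aₘ (algebraMap S Sₘ x) := by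
    intro x
    have hx : x ∈ Algebra.adjoin A s := hs ▸ Algebra.mem_top
    induction hx using Algebra.adjoin_induction with
    | mem x hx =>
      obtain ⟨p, hp, hpP⟩ := h x hx
      exact (algebraMap A S).isIntegralElem_localization_at_leadingCoeff x p hp M hpP
    | algebraMap r =>
      rw [← IsScalarTower.algebraMap_apply A S Sₘ, IsScalarTower.algebraMap_apply A Aₘ Sₘ]
      exact isIntegral_algebraMap
    | add x y _ _ hx hy => rw [map_add]; exact hx.add hy
    | mul x y _ _ hx hy => rw [map_mul]; exact hx.mul hy
  have : Algebra.IsIntegral Aₘ Sₘ := by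
    refine ⟨fun y => ?_⟩
    obtain ⟨⟨x, ⟨_, a, ha, rfl⟩⟩, hx⟩ :=
      IsLocalization.surj (Algebra.algebraMapSubmonoid S M) y
    obtain ⟨v, hv⟩ := isUnit_iff_exists_inv'.1 (IsLocalization.map_units Aₘ (⟨a, ha⟩ : M))
    refine IsIntegral.of_mul_unit (x := y) (y := algebraMap A Sₘ a) (r := v) ?_ ?_
    · rw [IsScalarTower.algebraMap_apply A Aₘ Sₘ, ← map_mul, hv, map_one]
    · rw [IsScalarTower.algebraMap_apply A S Sₘ]
      exact hx.symm ▸ hSm x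
  obtain ⟨Q, hQ, hQP⟩ := Ideal.exists_ideal_over_maximal_of_isIntegral (S := Sₘ)
    (IsLocalRing.maximalIdeal Aₘ) (by simp [(RingHom.injective_iff_ker_eq_bot _).mp hinj])
  refine ⟨Q.comap (algebraMap S Sₘ), inferInstance, ?_⟩
  rw [Ideal.comap_comap, ← IsScalarTower.algebraMap_eq A S Sₘ,
    IsScalarTower.algebraMap_eq A Aₘ Sₘ, ← Ideal.comap_comap, hQP]
  exact Localization.AtPrime.under_maximalIdeal

theorem stmt6 {K : Type*} [Field K] [IsAlgClosed K] {n d : ℕ} (hdn : d ≤ n)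
    (I : Ideal (MvPolynomial (Fin n) K)) (hprime : I.IsPrime)
    (hdim : ringKrullDim (MvPolynomial (Fin n) K ⧸ I) = d)
    (hind : ∀ g : MvPolynomial (Fin d) K, MvPolynomial.rename (Fin.castLE hdn) g ∈ I → g = 0)
    (hX : ∃ z : Fin n → K, (∀ j, z j ≠ 0) ∧ ∀ p ∈ I, MvPolynomial.eval z p = 0) :
    ∃ g : MvPolynomial (Fin d) K, g ≠ 0 ∧
      ∀ lam : Fin d → K, (∀ i, lam i ≠ 0) → MvPolynomial.eval lam g ≠ 0 →
        {z : Fin n → K | (∀ p ∈ I, MvPolynomial.eval z p = 0) ∧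
            ∀ i : Fin d, z (Fin.castLE hdn i) = lam i}.Nonempty ∧
        {z : Fin n → K | (∀ p ∈ I, MvPolynomial.eval z p = 0) ∧
            ∀ i : Fin d, z (Fin.castLE hdn i) = lam i}.Finite ∧
        ∀ z : Fin n → K, ((∀ p ∈ I, MvPolynomial.eval z p = 0) ∧
            ∀ i : Fin d, z (Fin.castLE hdn i) = lam i) → ∀ j, z j ≠ 0 := by
  let S := MvPolynomial (Fin n) K ⧸ I
  let f : MvPolynomial (Fin d) K →ₐ[K] S :=
    (Ideal.Quotient.mkₐ K I).comp (rename (Fin.castLE hdn))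
  let x : Fin n → S := fun j => Ideal.Quotient.mk I (X j)
  have hf : Function.Injective f := (injective_iff_map_eq_zero f).mpr fun p hp =>
    hind p (Ideal.Quotient.eq_zero_iff_mem.mp hp)
  have hfX : ∀ i, f (X i) = x (Fin.castLE hdn i) := fun i => by simp [f, x]
  algebraize [f.toRingHom]
  have htower : IsScalarTower K (MvPolynomial (Fin d) K) S :=
    .of_algebraMap_eq fun a => (f.commutes a).symm
  have hfaithful : FaithfulSMul (MvPolynomial (Fin d) K) S :=
    (faithfulSMul_iff_algebraMap_injective _ _).mpr hf
  have halg : Algebra.IsAlgebraic (MvPolynomial (Fin d) K) S := by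
    have hfx : f = aeval (fun i => x (Fin.castLE hdn i)) := by
      ext i; simp [hfX]
    have hind' : AlgebraicIndependent K (fun i => x (Fin.castLE hdn i)) := by
      rw [AlgebraicIndependent, ← hfx]; exact hf
    have hbasis : IsTranscendenceBasis K (fun i => x (Fin.castLE hdn i)) :=
      AlgebraicIndependent.isTranscendenceBasis_of_lift_trdeg_le_of_finite
        hind' (by
          rw [Cardinal.mk_fin, Cardinal.lift_natCast, Cardinal.lift_uzero]
          exact trdeg_le_of_ringKrullDim_le (K := K) hdim.le)
    have := hbasis.isAlgebraic
    refine .of_ringHom_of_comp_eq hind'.aevalEquiv (RingHom.id S)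
      hind'.aevalEquiv.surjective Function.injective_id ?_
    refine RingHom.ext fun a => ?_
    exact congr($hfx a).symm
  have hx0 : ∏ j, x j ≠ 0 := by
    obtain ⟨z, hz, hzI⟩ := hX
    intro h
    have : (∏ j, X j : MvPolynomial (Fin n) K) ∈ I := by
      rw [← Ideal.Quotient.eq_zero_iff_mem, map_prod]; exact h
    have := hzI _ this
    rw [map_prod, Finset.prod_eq_zero_iff] at this
    obtain ⟨j, -, hj⟩ := this
    exact hz j (by simpa using hj)
  obtain ⟨h, hh0, c, hc⟩ := (halg.isAlgebraic (∏ j, x j)).exists_nonzero_dvd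
    (mem_nonZeroDivisors_of_ne_zero hx0)
  choose p hp0 hp using fun j => halg.isAlgebraic (x j)
  have hpoint : ∀ (lam : Fin d → K) (z : Fin n → K), (∀ q ∈ I, eval z q = 0) →
      (∀ i, z (Fin.castLE hdn i) = lam i) → ∃ φ : S →ₐ[K] K, (∀ j, φ (x j) = z j) ∧
        ∀ a, φ (algebraMap (MvPolynomial (Fin d) K) S a) = eval lam a := by
    intro lam z hz hlam
    let φ : S →ₐ[K] K := Ideal.Quotient.liftₐ I (aeval z) hz
    have hφ : ∀ j, φ (x j) = z j := fun j => by
      change aeval z (X j) = z j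
      simp
    refine ⟨φ, hφ, fun a => ?_⟩
    have : φ.comp f = aeval lam := by
      ext i
      simp [hfX, hφ, hlam]
    exact congr($this a)
  refine ⟨h * ∏ j, (p j).leadingCoeff, mul_ne_zero hh0 <| Finset.prod_ne_zero_iff.mpr fun j _ =>
    Polynomial.leadingCoeff_ne_zero.mpr (hp0 j), fun lam _ hg => ?_⟩
  rw [map_mul, map_prod, mul_ne_zero_iff, Finset.prod_ne_zero_iff] at hg
  obtain ⟨hgh, hgp⟩ := hg
  refine ⟨?_, ?_, ?_⟩
  · have hmax : (vanishingIdeal K {lam} : Ideal (MvPolynomial (Fin d) K)).IsMaximal :=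
      isMaximal_iff_eq_vanishingIdeal_singleton.mpr ⟨lam, rfl⟩
    have hadj : Algebra.adjoin (MvPolynomial (Fin d) K) (Set.range x) = ⊤ := by
      refine eq_top_iff.mpr fun y _ => ?_
      obtain ⟨q, rfl⟩ := Ideal.Quotient.mk_surjective y
      induction q using MvPolynomial.induction_on with
      | C a =>
        have : Ideal.Quotient.mk I (C a) = algebraMap (MvPolynomial (Fin d) K) S (C a) :=
          (f.commutes a).symm
        rw [this]
        exact Subalgebra.algebraMap_mem _ _
      | add p q hp hq => rw [map_add]; exact add_mem (hp trivial) (hq trivial)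
      | mul_X p j hp =>
        rw [map_mul]
        exact mul_mem (hp trivial) (Algebra.subset_adjoin ⟨j, rfl⟩)
    obtain ⟨Q, hQ, hQlam⟩ := exists_isPrime_comap_eq_of_leadingCoeff_notMem hadj
      (vanishingIdeal K {lam}) (by
        rintro _ ⟨j, rfl⟩
        exact ⟨p j, hp j, by simpa [mem_vanishingIdeal_singleton_iff] using hgp j⟩)
    obtain ⟨N, hN, hQN⟩ := Ideal.exists_le_maximal Q hQ.ne_top
    have hNmax : (N.comap (Ideal.Quotient.mk I)).IsMaximal :=
      Ideal.comap_isMaximal_of_surjective _ Ideal.Quotient.mk_surjective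
    obtain ⟨z, hz⟩ := isMaximal_iff_eq_vanishingIdeal_singleton.mp hNmax
    have hzmem : ∀ q, Ideal.Quotient.mk I q ∈ N → eval z q = 0 := fun q hq => by
      have : q ∈ N.comap (Ideal.Quotient.mk I) := hq
      rw [hz, mem_vanishingIdeal_singleton_iff] at this
      simpa using this
    refine ⟨z, fun q hq => hzmem q ?_, fun i => ?_⟩
    · rw [Ideal.Quotient.eq_zero_iff_mem.mpr hq]; exact N.zero_mem
    · have hmem : (X i - C (lam i) : MvPolynomial (Fin d) K) ∈
          Q.comap (algebraMap (MvPolynomial (Fin d) K) S) := by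
        rw [hQlam, mem_vanishingIdeal_singleton_iff]; simp
      have := hzmem (rename (Fin.castLE hdn) (X i - C (lam i))) (hQN hmem)
      simpa [sub_eq_zero] using this
  · refine (Set.Finite.pi' fun j => ((p j).map (eval lam)).rootSet_finite K).subset ?_
    rintro z ⟨hz, hlam⟩ j
    obtain ⟨φ, hφx, hφa⟩ := hpoint lam z hz hlam
    have hne : (p j).map (eval lam) ≠ 0 := by
      intro h0
      have := congr(Polynomial.coeff $h0 (p j).natDegree)
      rw [Polynomial.coeff_map, Polynomial.coeff_zero] at this
      exact hgp j (Finset.mem_univ j) this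
    rw [Polynomial.mem_rootSet]
    refine ⟨hne, ?_⟩
    have := congr(φ $(hp j))
    rw [Polynomial.aeval_def, map_zero, ← AlgHom.coe_toRingHom, Polynomial.hom_eval₂] at this
    have hcomp : (φ : S →+* K).comp (algebraMap (MvPolynomial (Fin d) K) S) = eval lam :=
      RingHom.ext hφa
    rw [hcomp] at this
    rw [Polynomial.coe_aeval_eq_eval, Polynomial.eval_map, ← hφx]
    exact this
  · rintro z ⟨hz, hlam⟩ j hj
    obtain ⟨φ, hφx, hφa⟩ := hpoint lam z hz hlam
    apply hgh
    rw [← hφa, hc, map_mul, map_prod, Finset.prod_eq_zero (Finset.mem_univ j) (by rw [hφx, hj]),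
      zero_mul]
end

section
/- Let I ⊴ K[x_1,…,x_n] be an ideal such that Trop(I) is a one-dimensional polyhedral fan, i.e. there exists a finite set W ⊆ ℝ^n with Trop(I) = ⋃_{w∈W} ℝ_{≥0}·w. Then for every c ∈ Kˣ with ν(c) ≠ 0 one has Trop(I) ∩ ({ν(c)} × ℝ^{n-1}) = Trop(I + ⟨x_1 − c⟩), and this set is finite (zero-dimensional). -/
open scoped Pointwise

namespace TropPaper

variable {K : Type*} [Field K]

/-- The tropical variety of an ideal `I`: the euclidean closure of the set of coordinatewise
valuations of points of `V(I) ∩ (K*)ⁿ`. -/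
noncomputable def tropIdeal {n : ℕ} (ν : K → WithTop ℝ) (I : Ideal (MvPolynomial (Fin n) K)) :
    Set (Fin n → ℝ) :=
  closure {v : Fin n → ℝ | ∃ z : Fin n → K, (∀ j, z j ≠ 0) ∧
    (∀ p ∈ I, MvPolynomial.eval z p = 0) ∧ ∀ j, ν (z j) = (v j : WithTop ℝ)}

end TropPaper

open TropPaper

/-- A constructible set in a prime spectrum containing the point `p` contains a nonempty open
subset of the closure of `p`. -/
theorem PrimeSpectrum.exists_basicOpen_of_isConstructible {R : Type*} [CommRing R]
    {s : Set (PrimeSpectrum R)} (hs : Topology.IsConstructible s) {p : PrimeSpectrum R}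
    (hp : p ∈ s) :
    ∃ a ∉ p.asIdeal, ∀ q : PrimeSpectrum R, p.asIdeal ≤ q.asIdeal → a ∉ q.asIdeal → q ∈ s := by
  have key : (p ∈ s → ∃ a ∉ p.asIdeal, ∀ q : PrimeSpectrum R,
        p.asIdeal ≤ q.asIdeal → a ∉ q.asIdeal → q ∈ s) ∧
      (p ∉ s → ∃ a ∉ p.asIdeal, ∀ q : PrimeSpectrum R,
        p.asIdeal ≤ q.asIdeal → a ∉ q.asIdeal → q ∉ s) := by
    clear hp
    induction hs using Topology.IsConstructible.empty_union_induction with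
    | open_retrocompact U hU _ =>
      refine ⟨fun hpU ↦ ?_, fun hpU ↦ ?_⟩
      · obtain ⟨_, ⟨a, rfl⟩, hpa, haU⟩ :=
          PrimeSpectrum.isTopologicalBasis_basic_opens.exists_subset_of_mem_open hpU hU
        exact ⟨a, hpa, fun q _ hq ↦ haU hq⟩
      · refine ⟨1, (Ideal.ne_top_iff_one _).1 p.2.ne_top, fun q hpq _ hqU ↦ hpU ?_⟩
        exact ((PrimeSpectrum.le_iff_specializes p q).1 hpq).mem_open hU hqU
    | union s _ t _ hs ht =>
      refine ⟨?_, fun hp ↦ ?_⟩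
      · rintro (hp | hp)
        · obtain ⟨a, ha, h⟩ := hs.1 hp
          exact ⟨a, ha, fun q h₁ h₂ ↦ Or.inl (h q h₁ h₂)⟩
        · obtain ⟨a, ha, h⟩ := ht.1 hp
          exact ⟨a, ha, fun q h₁ h₂ ↦ Or.inr (h q h₁ h₂)⟩
      · obtain ⟨a, ha, h⟩ := hs.2 fun h ↦ hp (Or.inl h)
        obtain ⟨b, hb, h'⟩ := ht.2 fun h ↦ hp (Or.inr h)
        refine ⟨a * b, fun hab ↦ (p.2.mem_or_mem hab).elim ha hb, fun q h₁ h₂ ↦ ?_⟩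
        rintro (hq | hq)
        · exact h q h₁ (fun h ↦ h₂ (Ideal.mul_mem_right _ _ h)) hq
        · exact h' q h₁ (fun h ↦ h₂ (Ideal.mul_mem_left _ _ h)) hq
    | compl s _ hs =>
      exact ⟨hs.2, fun h ↦ by simpa using hs.1 (not_not.1 h)⟩
  exact key.1 hp

open Polynomial in
/-- Pseudo-division by an element of minimal degree of an ideal. -/
theorem Polynomial.exists_C_pow_mul_eq_of_minimal_natDegree {R : Type*} [CommRing R] [IsDomain R]
    {J : Ideal R[X]} {g : R[X]} (hg : g ∈ J) (hg0 : g ≠ 0)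
    (hmin : ∀ p ∈ J, p ≠ 0 → g.natDegree ≤ p.natDegree) (p : R[X]) (hp : p ∈ J) :
    ∃ (k : ℕ) (q : R[X]), C (g.leadingCoeff ^ k) * p = q * g := by
  induction hd : p.natDegree using Nat.strong_induction_on generalizing p with
  | _ d ih =>
    by_cases hp0 : p = 0
    · exact ⟨0, 0, by simp [hp0]⟩
    have hle := hmin p hp hp0
    set m : R[X] := C p.leadingCoeff * X ^ (p.natDegree - g.natDegree) with hm
    have hlg : g.leadingCoeff ≠ 0 := by simpa using hg0
    have hlp : p.leadingCoeff ≠ 0 := by simpa using hp0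
    set r : R[X] := C g.leadingCoeff * p - m * g with hr
    have hrJ : r ∈ J := J.sub_mem (J.mul_mem_left _ hp) (J.mul_mem_left _ hg)
    have finish : (∃ (k : ℕ) (q : R[X]), C (g.leadingCoeff ^ k) * r = q * g) →
        ∃ (k : ℕ) (q : R[X]), C (g.leadingCoeff ^ k) * p = q * g := by
      rintro ⟨k, q, h⟩
      refine ⟨k + 1, q + C (g.leadingCoeff ^ k) * m, ?_⟩
      rw [add_mul, ← h, hr, pow_succ, C_mul]
      ring
    apply finish
    by_cases hr0 : r = 0
    · exact ⟨0, 0, by simp [hr0]⟩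
    have hdeg : r.degree < (C g.leadingCoeff * p).degree := by
      apply degree_sub_lt_left
      · rw [degree_C_mul hlg, hm, degree_mul, degree_C_mul_X_pow _ hlp,
          degree_eq_natDegree hp0, degree_eq_natDegree hg0]
        norm_cast
        omega
      · exact mul_ne_zero (by simpa using hlg) hp0
      · rw [hm, leadingCoeff_mul, leadingCoeff_mul, leadingCoeff_C, leadingCoeff_mul,
          leadingCoeff_C,
          leadingCoeff_X_pow, mul_one, mul_comm]
    rw [degree_C_mul hlg] at hdeg
    exact ih _ (hd ▸ natDegree_lt_natDegree hr0 hdeg) r hrJ rfl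

section Plane

open Polynomial

variable {K : Type*} [Field K] {n : ℕ}

/-- The ring homomorphism `K[X][Y] → K[x₀, …, xₙ]` sending `X` to `x₀` and `Y` to `y`. -/
noncomputable def planeHom (y : MvPolynomial (Fin (n + 1)) K) :
    K[X][X] →+* MvPolynomial (Fin (n + 1)) K :=
  eval₂RingHom (aeval (MvPolynomial.X 0 : MvPolynomial (Fin (n + 1)) K)).toRingHom y

theorem eval_planeHom (y : MvPolynomial (Fin (n + 1)) K) (z : Fin (n + 1) → K) (p : K[X][X]) :
    MvPolynomial.eval z (planeHom y p) =
      (p.map (evalRingHom (z 0))).eval (MvPolynomial.eval z y) := by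
  have h : (MvPolynomial.eval z).comp (planeHom y) =
      (evalRingHom (MvPolynomial.eval z y)).comp (mapRingHom (evalRingHom (z 0))) := by
    refine Polynomial.ringHom_ext' (Polynomial.ringHom_ext' ?_ ?_) ?_
    · ext a; simp [planeHom, MvPolynomial.algebraMap_eq]
    · simp [planeHom]
    · simp [planeHom]
  exact RingHom.congr_fun h p

/-- A relation between `x₀` and `y` modulo `P` can be chosen not to vanish identically at
`x₀ = c`. -/
theorem exists_planeHom_mem_map_ne_zero {P : Ideal (MvPolynomial (Fin (n + 1)) K)}
    [hP : P.IsPrime] {y : MvPolynomial (Fin (n + 1)) K} {g : K[X][X]} (hg0 : g ≠ 0)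
    (hg : planeHom y g ∈ P) {c : K} (hc : MvPolynomial.X 0 - MvPolynomial.C c ∉ P) :
    ∃ f, planeHom y f ∈ P ∧ f.map (evalRingHom c) ≠ 0 := by
  have hprime : Prime (X - C c : K[X]) := prime_X_sub_C c
  have hu : ¬ IsUnit (C (X - C c) : K[X][X]) := by
    rw [isUnit_C]; exact hprime.not_isUnit
  obtain ⟨f, hf, hdvd⟩ :=
    (FiniteMultiplicity.of_not_isUnit hu hg0).exists_eq_pow_mul_and_not_dvd
  refine ⟨f, ?_, fun h0 ↦ hdvd ?_⟩
  · rw [hf, map_mul, map_pow] at hg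
    refine (hP.mem_or_mem hg).resolve_left fun h ↦ hc ?_
    simpa [planeHom] using hP.mem_of_pow_mem _ h
  · rw [C_dvd_iff_dvd_coeff]
    intro i
    rw [dvd_iff_isRoot]
    simpa using congrArg (fun p ↦ p.coeff i) h0

variable [IsAlgClosed K]

/-- A generic point of the closure of the image of `V(P)` under `(x₀, y)` lifts to a point of
`V(P)` where `b` does not vanish. -/
theorem exists_generic_lift {P : Ideal (MvPolynomial (Fin (n + 1)) K)} [hP : P.IsPrime]
    {b : MvPolynomial (Fin (n + 1)) K} (hb : b ∉ P) (y : MvPolynomial (Fin (n + 1)) K) :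
    ∃ a : K[X][X], planeHom y a ∉ P ∧ ∀ t η : K,
      (∀ p, planeHom y p ∈ P → (p.map (evalRingHom t)).eval η = 0) →
      (a.map (evalRingHom t)).eval η ≠ 0 →
      ∃ z : Fin (n + 1) → K, (∀ p ∈ P, MvPolynomial.eval z p = 0) ∧ MvPolynomial.eval z b ≠ 0 ∧
        z 0 = t ∧ MvPolynomial.eval z y = η := by
  have hfp : (planeHom y).FinitePresentation := by
    refine RingHom.FinitePresentation.of_finiteType.1 ?_
    refine RingHom.FiniteType.of_comp_finiteType (f := (C : K[X] →+* K[X][X]).comp C) ?_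
    have : (planeHom y).comp ((C : K[X] →+* K[X][X]).comp C) =
        algebraMap K (MvPolynomial (Fin (n + 1)) K) := by
      ext a; simp [planeHom]
    rw [this, RingHom.finiteType_algebraMap]
    infer_instance
  have hcon : Topology.IsConstructible
      (PrimeSpectrum.zeroLocus (P : Set (MvPolynomial (Fin (n + 1)) K)) ∩
        (PrimeSpectrum.basicOpen b : Set (PrimeSpectrum _))) := by
    refine Topology.IsConstructible.inter ?_ ?_
    · rw [← Topology.isConstructible_compl]
      exact (TopologicalSpace.NoetherianSpace.isCompact _).isConstructible
        (PrimeSpectrum.isClosed_zeroLocus _).isOpen_compl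
    · exact (TopologicalSpace.NoetherianSpace.isCompact _).isConstructible
        (PrimeSpectrum.basicOpen b).2
  obtain ⟨a, ha, h⟩ := PrimeSpectrum.exists_basicOpen_of_isConstructible
    (PrimeSpectrum.isConstructible_comap_image hfp hcon)
    (p := PrimeSpectrum.comap (planeHom y) ⟨P, hP⟩)
    ⟨⟨P, hP⟩, ⟨by simp [PrimeSpectrum.mem_zeroLocus], hb⟩, rfl⟩
  refine ⟨a, ha, fun t η hker hat ↦ ?_⟩
  let e : K[X][X] →+* K := (evalRingHom η).comp (mapRingHom (evalRingHom t))
  obtain ⟨Q, ⟨hQP, hQb⟩, hQ⟩ := h ⟨RingHom.ker e, RingHom.ker_isPrime e⟩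
    (fun p hp ↦ by simpa [e, RingHom.mem_ker] using hker p hp)
    (by simpa [e, RingHom.mem_ker] using hat)
  have hQmem : ∀ p, planeHom y p ∈ Q.asIdeal ↔ (p.map (evalRingHom t)).eval η = 0 := fun p ↦ by
    have : p ∈ (PrimeSpectrum.comap (planeHom y) Q).asIdeal ↔ p ∈ RingHom.ker e := by rw [hQ]
    simpa [e, RingHom.mem_ker] using this
  obtain ⟨z, hz, hzb⟩ : ∃ z ∈ MvPolynomial.zeroLocus K Q.asIdeal, MvPolynomial.eval z b ≠ 0 := by
    by_contra! hcon
    apply hQb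
    have := Q.2
    change b ∈ Q.asIdeal
    rw [← MvPolynomial.IsPrime.vanishingIdeal_zeroLocus (K := K) Q.asIdeal]
    intro z hz
    simpa [MvPolynomial.aeval_eq_eval] using hcon z hz
  have hz' : ∀ p ∈ Q.asIdeal, MvPolynomial.eval z p = 0 := fun p hp ↦ by
    simpa [MvPolynomial.aeval_eq_eval] using hz p hp
  refine ⟨z, fun p hp ↦ hz' p (hQP hp), hzb, ?_, ?_⟩
  · have := hz' _ ((hQmem (C (X - C t))).2 (by simp))
    rw [eval_planeHom] at this
    simpa [sub_eq_zero] using this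
  · have := hz' _ ((hQmem (X - C (C η))).2 (by simp))
    rw [eval_planeHom] at this
    simpa [sub_eq_zero] using this

/-- If over infinitely many `t` the function `y` omits infinitely many values on
`V(P) ∩ {b ≠ 0} ∩ {x₀ = t}`, then `x₀` and `y` are algebraically dependent modulo `P`. -/
theorem exists_planeHom_mem {P : Ideal (MvPolynomial (Fin (n + 1)) K)} [hP : P.IsPrime]
    {b : MvPolynomial (Fin (n + 1)) K} (hb : b ∉ P) (y : MvPolynomial (Fin (n + 1)) K)
    {T : Set K} (hT : T.Infinite)
    (hy : ∀ t ∈ T, {η : K | ¬ ∃ z : Fin (n + 1) → K, (∀ p ∈ P, MvPolynomial.eval z p = 0) ∧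
      MvPolynomial.eval z b ≠ 0 ∧ z 0 = t ∧ MvPolynomial.eval z y = η}.Infinite) :
    ∃ g ≠ 0, planeHom y g ∈ P := by
  classical
  by_contra! hcon
  obtain ⟨a, ha, h⟩ := exists_generic_lift hb y
  have ha0 : a ≠ 0 := by rintro rfl; exact ha (by simp)
  obtain ⟨t, htT, ht⟩ : ∃ t ∈ T, a.leadingCoeff.eval t ≠ 0 := by
    by_contra! hroot
    refine hT ((a.leadingCoeff.roots.toFinset.finite_toSet).subset fun t ht ↦ ?_)
    simpa [ha0] using hroot t ht
  have hat : a.map (evalRingHom t) ≠ 0 := fun h0 ↦ ht (by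
    simpa using congrArg (fun p ↦ p.coeff a.natDegree) h0)
  refine hy t htT (((a.map (evalRingHom t)).roots.toFinset.finite_toSet).subset fun η hη ↦ ?_)
  by_contra hroot
  refine hη (h t η (fun p hp ↦ ?_) ?_)
  · have : p = 0 := by by_contra hp0; exact hcon p hp0 hp
    simp [this]
  · simpa [hat] using hroot

/-- If `x₀` is transcendental modulo `P` and `y` is algebraic over it, the closure of the image of
`V(P)` under `(x₀, y)` is a plane curve all of whose points over generic `x₀` lift. -/
theorem exists_plane_curve {P : Ideal (MvPolynomial (Fin (n + 1)) K)} [hP : P.IsPrime]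
    {b : MvPolynomial (Fin (n + 1)) K} (hb : b ∉ P) (y : MvPolynomial (Fin (n + 1)) K)
    (hy : ∃ g ≠ 0, planeHom y g ∈ P) :
    ∃ g ≠ 0, planeHom y g ∈ P ∧ ∃ h : K[X], h ≠ 0 ∧ ∀ t, h.eval t ≠ 0 →
      ∀ η, (g.map (evalRingHom t)).eval η = 0 →
      ∃ z : Fin (n + 1) → K, (∀ p ∈ P, MvPolynomial.eval z p = 0) ∧ MvPolynomial.eval z b ≠ 0 ∧
        z 0 = t ∧ MvPolynomial.eval z y = η := by
  obtain ⟨a, haP, ha⟩ := exists_generic_lift hb y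
  obtain ⟨g, ⟨hg0, hg⟩, hmin⟩ : ∃ g : K[X][X], (g ≠ 0 ∧ planeHom y g ∈ P) ∧
      ∀ p ∈ P.comap (planeHom y), p ≠ 0 → g.natDegree ≤ p.natDegree := by
    have hne : {g : K[X][X] | g ≠ 0 ∧ planeHom y g ∈ P}.Nonempty := hy
    refine ⟨Function.argminOn natDegree _ hne, Function.argminOn_mem natDegree _ hne,
      fun p hp hp0 ↦ ?_⟩
    exact Function.argminOn_le natDegree {g : K[X][X] | g ≠ 0 ∧ planeHom y g ∈ P} ⟨hp0, hp⟩
  let : Algebra K[X] (MvPolynomial (Fin (n + 1)) K ⧸ P) :=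
    ((Ideal.Quotient.mk P).comp ((planeHom y).comp C)).toAlgebra
  let θ : K[X][X] →ₐ[K[X]] (MvPolynomial (Fin (n + 1)) K ⧸ P) :=
    { (Ideal.Quotient.mk P).comp (planeHom y) with commutes' := fun _ ↦ rfl }
  have hθ : ∀ p, θ p = 0 ↔ planeHom y p ∈ P := fun p ↦ Ideal.Quotient.eq_zero_iff_mem
  have hθX : ∀ p, θ p = aeval (θ X) p := fun p ↦ by
    rw [aeval_algHom_apply, aeval_X_left_apply]
  have halgX : IsAlgebraic K[X] (θ X) := ⟨g, hg0, by rw [← hθX]; exact (hθ g).2 hg⟩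
  have halg : IsAlgebraic K[X] (θ a) := by
    rw [hθX]
    exact Algebra.adjoin_singleton_le (S := Subalgebra.algebraicClosure K[X] _) halgX
      (aeval_mem_adjoin_singleton _ _)
  obtain ⟨q, hq0, hq⟩ := halg.exists_nonzero_coeff_and_aeval_eq_zero
    (mem_nonZeroDivisors_of_ne_zero (fun h ↦ haP ((hθ a).1 h)))
  refine ⟨g, hg0, hg, g.leadingCoeff * q.coeff 0, mul_ne_zero (by simpa using hg0) hq0,
    fun t ht η hη ↦ ?_⟩
  rw [eval_mul, mul_ne_zero_iff] at ht
  have hker : ∀ p, planeHom y p ∈ P → (p.map (evalRingHom t)).eval η = 0 := fun p hp ↦ by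
    obtain ⟨k, r, hr⟩ := exists_C_pow_mul_eq_of_minimal_natDegree (J := P.comap (planeHom y)) hg
      hg0 hmin p hp
    have := congrArg (fun p ↦ (p.map (evalRingHom t)).eval η) hr
    simp only [Polynomial.map_mul, eval_mul, hη, mul_zero, Polynomial.map_C, eval_C] at this
    refine (mul_eq_zero.1 this).resolve_left ?_
    simpa using fun h : _ = _ ↦ absurd h ht.1
  refine ha t η hker fun h0 ↦ ht.2 ?_
  have h1 := hker (q.eval₂ C a) ((hθ _).1 (by
    rw [← hq, aeval_algHom_apply]; rfl))
  rw [← coe_mapRingHom, ← coe_evalRingHom, ← RingHom.comp_apply, hom_eval₂, RingHom.comp_apply,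
    coe_mapRingHom, coe_evalRingHom, h0, eval₂_at_zero] at h1
  simpa using h1

end Plane

section Ultrametric

open Polynomial

variable {K : Type*} [NormedField K]

/-- The Newton polygon of `p` at radius `ϱ` has `N` as its only vertex, with margin `θ`: the term
of degree `j` is smaller than the one of degree `N` by a factor `θ ^ |j - N|`. -/
def DominantTerm (p : K[X]) (ϱ θ : ℝ) (N : ℕ) : Prop :=
  p.coeff N ≠ 0 ∧ ∀ j, ‖p.coeff j‖ * ϱ ^ j ≤ ‖p.coeff N‖ * ϱ ^ N * θ ^ ((j - N) + (N - j))

theorem DominantTerm.C_mul {p : K[X]} {ϱ θ : ℝ} {N : ℕ} (h : DominantTerm p ϱ θ N) {a : K}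
    (ha : a ≠ 0) : DominantTerm (C a * p) ϱ θ N := by
  refine ⟨by simpa [ha] using h.1, fun j ↦ ?_⟩
  have := mul_le_mul_of_nonneg_left (h.2 j) (norm_nonneg a)
  simp only [coeff_C_mul, norm_mul]
  linarith

/-- The dominant term is stable under small perturbations of the absolute values of the
coefficients and of the radius. -/
theorem DominantTerm.eq_of_close {p p' : K[X]} {ϱ ϱ' θ B : ℝ} {N N' : ℕ}
    (h : DominantTerm p ϱ θ N) (h' : DominantTerm p' ϱ' θ N') (hϱ : 0 < ϱ) (hϱ' : 0 < ϱ')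
    (hθ : 0 < θ) (hB : 1 ≤ B) (hBθ : B ^ 3 * θ ^ 2 < 1)
    (hp : ∀ i, ‖p.coeff i‖ ≤ B * ‖p'.coeff i‖) (hp' : ∀ i, ‖p'.coeff i‖ ≤ B * ‖p.coeff i‖)
    (hϱB : ϱ ≤ B * ϱ') (hϱB' : ϱ' ≤ B * ϱ) : N = N' := by
  by_contra hne
  wlog hlt : N < N' generalizing p p' ϱ ϱ' N N'
  · exact this h' h hϱ' hϱ hp' hp hϱB' hϱB (Ne.symm hne) (by omega)
  obtain ⟨D, rfl⟩ := Nat.exists_eq_add_of_lt hlt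
  have h1 := h.2 (N + D + 1)
  have h2 := h'.2 N
  rw [show (N + D + 1 - N) + (N - (N + D + 1)) = D + 1 by omega] at h1
  rw [show (N - (N + D + 1)) + (N + D + 1 - N) = D + 1 by omega] at h2
  have hN : 0 < ‖p.coeff N‖ := norm_pos_iff.2 h.1
  have hN' : 0 < ‖p'.coeff (N + D + 1)‖ := norm_pos_iff.2 h'.1
  have e1 : ‖p.coeff (N + D + 1)‖ * ϱ ^ (D + 1) ≤ ‖p.coeff N‖ * θ ^ (D + 1) := by
    refine le_of_mul_le_mul_right ?_ (pow_pos hϱ N)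
    rw [add_assoc, pow_add] at h1
    rw [add_assoc]
    linarith
  have e2 : ‖p'.coeff N‖ ≤ ‖p'.coeff (N + D + 1)‖ * ϱ' ^ (D + 1) * θ ^ (D + 1) := by
    refine le_of_mul_le_mul_right ?_ (pow_pos hϱ' N)
    rw [add_assoc, pow_add] at h2
    rw [add_assoc]
    linarith
  have hlt : (B ^ 3 * θ ^ 2) ^ (D + 1) < 1 := pow_lt_one₀ (by positivity) hBθ (by omega)
  have hpos : 0 < ‖p'.coeff (N + D + 1)‖ * ϱ ^ (D + 1) := by positivity
  refine absurd ?_ (lt_irrefl (‖p'.coeff (N + D + 1)‖ * ϱ ^ (D + 1)))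
  calc ‖p'.coeff (N + D + 1)‖ * ϱ ^ (D + 1)
      ≤ B * ‖p.coeff (N + D + 1)‖ * ϱ ^ (D + 1) := by gcongr; exact hp' _
    _ = B * (‖p.coeff (N + D + 1)‖ * ϱ ^ (D + 1)) := by ring
    _ ≤ B * (‖p.coeff N‖ * θ ^ (D + 1)) := by gcongr
    _ ≤ B * (B * ‖p'.coeff N‖ * θ ^ (D + 1)) := by gcongr; exact hp _
    _ ≤ B * (B * (‖p'.coeff (N + D + 1)‖ * ϱ' ^ (D + 1) * θ ^ (D + 1)) * θ ^ (D + 1)) := by gcongr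
    _ ≤ B * (B * (‖p'.coeff (N + D + 1)‖ * (B * ϱ) ^ (D + 1) * θ ^ (D + 1)) * θ ^ (D + 1)) := by
      gcongr
    _ = (‖p'.coeff (N + D + 1)‖ * ϱ ^ (D + 1)) *
        ((B ^ 2) ^ 1 * (B ^ (D + 1) * (θ ^ 2) ^ (D + 1))) := by ring
    _ ≤ (‖p'.coeff (N + D + 1)‖ * ϱ ^ (D + 1)) *
        ((B ^ 2) ^ (D + 1) * (B ^ (D + 1) * (θ ^ 2) ^ (D + 1))) := by
      gcongr
      · exact one_le_pow₀ hB
      · omega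
    _ = (‖p'.coeff (N + D + 1)‖ * ϱ ^ (D + 1)) * (B ^ 3 * θ ^ 2) ^ (D + 1) := by ring
    _ < _ := mul_lt_of_lt_one_right hpos hlt

variable [IsUltrametricDist K]

theorem norm_sub_le_max_of_ultrametric (a b : K) : ‖a - b‖ ≤ max ‖a‖ ‖b‖ := by
  simpa [sub_eq_add_neg] using IsUltrametricDist.norm_add_le_max a (-b)

theorem norm_sub_eq_max_of_ne {a b : K} (h : ‖a‖ ≠ ‖b‖) : ‖a - b‖ = max ‖a‖ ‖b‖ := by
  rw [sub_eq_add_neg, IsUltrametricDist.norm_add_eq_max_of_norm_ne_norm (by rwa [norm_neg]),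
    norm_neg]

theorem DominantTerm.mul_X_sub_C {p : K[X]} {ϱ θ : ℝ} {N : ℕ} (h : DominantTerm p ϱ θ N)
    (hϱ : 0 < ϱ) (hθ : 0 < θ) (hθ1 : θ < 1) {η : K} (hη : ‖η‖ ≤ ϱ * θ) :
    DominantTerm (p * (X - C η)) ϱ θ (N + 1) := by
  have hN : 0 < ‖p.coeff N‖ := norm_pos_iff.2 h.1
  have key : ∀ j, ‖p.coeff j * η‖ * ϱ ^ j ≤
      ‖p.coeff N‖ * ϱ ^ (N + 1) * θ ^ ((j - N) + (N - j) + 1) := fun j ↦ by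
    rw [norm_mul]
    calc ‖p.coeff j‖ * ‖η‖ * ϱ ^ j = (‖p.coeff j‖ * ϱ ^ j) * ‖η‖ := by ring
      _ ≤ (‖p.coeff N‖ * ϱ ^ N * θ ^ ((j - N) + (N - j))) * (ϱ * θ) := by
        exact mul_le_mul (h.2 j) hη (by positivity) (by positivity)
      _ = _ := by ring
  have hlead : ‖(p * (X - C η)).coeff (N + 1)‖ = ‖p.coeff N‖ := by
    rw [coeff_mul_X_sub_C]
    have hlt : ‖p.coeff (N + 1) * η‖ < ‖p.coeff N‖ := by
      have h1 := key (N + 1)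
      have h2 : θ ^ ((N + 1 - N) + (N - (N + 1)) + 1) < 1 := pow_lt_one₀ hθ.le hθ1 (by omega)
      have h3 : 0 < ϱ ^ (N + 1) := by positivity
      refine lt_of_mul_lt_mul_right (h1.trans_lt ?_) h3.le
      exact mul_lt_of_lt_one_right (by positivity) h2
    rw [norm_sub_eq_max_of_ne hlt.ne', max_eq_left hlt.le]
  refine ⟨norm_pos_iff.1 (hlead ▸ hN), fun j ↦ ?_⟩
  rw [hlead]
  rcases j with _ | j
  · rw [mul_coeff_zero]
    simpa [add_comm, norm_mul] using key 0
  · rw [coeff_mul_X_sub_C]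
    refine (mul_le_mul_of_nonneg_right (norm_sub_le_max_of_ultrametric _ _)
      (by positivity)).trans ?_
    rw [max_mul_of_nonneg _ _ (by positivity)]
    refine max_le ?_ ((key (j + 1)).trans ?_)
    · have := mul_le_mul_of_nonneg_right (h.2 j) hϱ.le
      rw [show (j + 1 - (N + 1)) + (N + 1 - (j + 1)) = (j - N) + (N - j) by omega, pow_succ,
        pow_succ]
      linarith
    · gcongr ?_ * ?_
      exact pow_le_pow_of_le_one hθ.le hθ1.le (by omega)

theorem DominantTerm.mul_X_sub_C' {p : K[X]} {ϱ θ : ℝ} {N : ℕ} (h : DominantTerm p ϱ θ N)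
    (hϱ : 0 < ϱ) (hθ : 0 < θ) (hθ1 : θ < 1) {η : K} (hη : ϱ ≤ ‖η‖ * θ) :
    DominantTerm (p * (X - C η)) ϱ θ N := by
  have hN : 0 < ‖p.coeff N‖ := norm_pos_iff.2 h.1
  have key : ∀ j, ‖p.coeff j‖ * ϱ ^ (j + 1) ≤
      ‖p.coeff N‖ * ‖η‖ * ϱ ^ N * θ ^ ((j - N) + (N - j) + 1) := fun j ↦ by
    calc ‖p.coeff j‖ * ϱ ^ (j + 1) = (‖p.coeff j‖ * ϱ ^ j) * ϱ := by ring
      _ ≤ (‖p.coeff N‖ * ϱ ^ N * θ ^ ((j - N) + (N - j))) * (‖η‖ * θ) := by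
        exact mul_le_mul (h.2 j) hη hϱ.le (by positivity)
      _ = _ := by ring
  have hη0 : 0 < ‖η‖ := by
    by_contra hneg
    have : ‖η‖ = 0 := le_antisymm (not_lt.1 hneg) (norm_nonneg _)
    rw [this] at hη; linarith
  have hlead : ‖(p * (X - C η)).coeff N‖ = ‖p.coeff N‖ * ‖η‖ := by
    rcases N with _ | N
    · simp [mul_coeff_zero]
    have hlt : ‖p.coeff N‖ < ‖p.coeff (N + 1) * η‖ := by
      have h1 := key N
      have h2 : θ ^ ((N - (N + 1)) + ((N + 1) - N) + 1) < 1 := pow_lt_one₀ hθ.le hθ1 (by omega)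
      have h3 : 0 < ϱ ^ (N + 1) := by positivity
      refine lt_of_mul_lt_mul_right (h1.trans_lt ?_) h3.le
      rw [norm_mul]
      exact mul_lt_of_lt_one_right (by positivity) h2
    rw [coeff_mul_X_sub_C, norm_sub_eq_max_of_ne hlt.ne, max_eq_right hlt.le, norm_mul]
  refine ⟨norm_pos_iff.1 (hlead ▸ by positivity), fun j ↦ ?_⟩
  rw [hlead]
  have key' : ∀ j, ‖p.coeff j * η‖ * ϱ ^ j ≤
      ‖p.coeff N‖ * ‖η‖ * ϱ ^ N * θ ^ ((j - N) + (N - j)) := fun j ↦ by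
    have := mul_le_mul_of_nonneg_right (h.2 j) hη0.le
    rw [norm_mul]; linarith
  rcases j with _ | j
  · rw [mul_coeff_zero]
    simpa [norm_mul] using key' 0
  · rw [coeff_mul_X_sub_C]
    refine (mul_le_mul_of_nonneg_right (norm_sub_le_max_of_ultrametric _ _)
      (by positivity)).trans ?_
    rw [max_mul_of_nonneg _ _ (by positivity)]
    refine max_le ((key j).trans ?_) (key' (j + 1))
    gcongr ?_ * ?_
    exact pow_le_pow_of_le_one hθ.le hθ1.le (by omega)

theorem dominantTerm_prod_X_sub_C {ϱ θ : ℝ} (hϱ : 0 < ϱ) (hθ : 0 < θ) (hθ1 : θ < 1)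
    (s : Multiset K) (hs : ∀ η ∈ s, ‖η‖ ≤ ϱ * θ ∨ ϱ ≤ ‖η‖ * θ) :
    DominantTerm (s.map fun η ↦ X - C η).prod ϱ θ (s.countP fun η ↦ ‖η‖ < ϱ) := by
  induction s using Multiset.induction_on with
  | empty =>
    refine ⟨by simp, fun j ↦ ?_⟩
    rcases j with _ | j <;> simp [coeff_one]
    positivity
  | cons η s ih =>
    have ih := ih fun η' h' ↦ hs η' (Multiset.mem_cons_of_mem h')
    rw [Multiset.map_cons, Multiset.prod_cons, mul_comm]
    rcases hs η (Multiset.mem_cons_self _ _) with h | h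
    · rw [Multiset.countP_cons_of_pos (p := fun η : K ↦ ‖η‖ < ϱ) _ (h.trans_lt (by nlinarith))]
      exact ih.mul_X_sub_C hϱ hθ hθ1 h
    · rw [Multiset.countP_cons_of_neg (p := fun η : K ↦ ‖η‖ < ϱ)]
      · exact ih.mul_X_sub_C' hϱ hθ hθ1 h
      · exact not_lt.2 (h.trans (mul_le_of_le_one_right (norm_nonneg _) hθ1.le))

theorem dominantTerm_roots [IsAlgClosed K] {p : K[X]} (hp : p ≠ 0) {ϱ θ : ℝ} (hϱ : 0 < ϱ)
    (hθ : 0 < θ) (hθ1 : θ < 1) (hs : ∀ η ∈ p.roots, ‖η‖ ≤ ϱ * θ ∨ ϱ ≤ ‖η‖ * θ) :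
    DominantTerm p ϱ θ (p.roots.countP fun η ↦ ‖η‖ < ϱ) := by
  have := (dominantTerm_prod_X_sub_C hϱ hθ hθ1 p.roots hs).C_mul (leadingCoeff_ne_zero.2 hp)
  rwa [← (IsAlgClosed.splits p).eq_prod_roots] at this

end Ultrametric

section Path

open Polynomial

variable {K : Type*} [NormedField K] [IsAlgClosed K]

theorem exists_norm_mem_Ioo (hK : ∃ x : K, 1 < ‖x‖) {a b : ℝ} (ha : 0 < a) (hab : a < b) :
    ∃ q : K, a < ‖q‖ ∧ ‖q‖ < b := by
  obtain ⟨x, hx⟩ := hK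
  obtain ⟨m, hm⟩ := pow_unbounded_of_one_lt ‖x‖ ((one_lt_div ha).2 hab)
  have hm0 : 0 < m := by
    rcases Nat.eq_zero_or_pos m with rfl | h
    · simp at hm; linarith
    · exact h
  obtain ⟨y, hy⟩ := IsAlgClosed.exists_pow_nat_eq x hm0
  have hyx : ‖y‖ ^ m = ‖x‖ := by rw [← norm_pow, hy]
  have hy1 : 1 < ‖y‖ := by
    by_contra! h
    exact absurd (pow_le_one₀ (n := m) (norm_nonneg y) h) (by rw [hyx]; exact not_le.2 hx)
  have hyb : ‖y‖ < b / a :=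
    lt_of_pow_lt_pow_left₀ m (div_nonneg (by linarith) ha.le) (hyx ▸ hm)
  obtain ⟨k, hk1, hk2⟩ := exists_mem_Ico_zpow ha hy1
  refine ⟨y ^ (k + 1), by rwa [norm_zpow], ?_⟩
  rw [norm_zpow, zpow_add_one₀ (zero_lt_one.trans hy1).ne']
  calc ‖y‖ ^ k * ‖y‖ ≤ a * ‖y‖ := by gcongr
    _ < a * (b / a) := by gcongr
    _ = b := by field_simp

theorem exists_norm_mem_Ioo_notMem (hK : ∃ x : K, 1 < ‖x‖) {E : Set ℝ} (hE : E.Finite) {a b : ℝ}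
    (ha : 0 ≤ a) (hab : a < b) : ∃ q : K, a < ‖q‖ ∧ ‖q‖ < b ∧ ‖q‖ ∉ E := by
  obtain ⟨x, hx⟩ := ((Set.Ioo_infinite hab).sdiff hE).nonempty
  have hopen : IsOpen (Set.Ioo a b \ E) := isOpen_Ioo.sdiff hE.isClosed
  obtain ⟨ε, hε, hball⟩ := Metric.isOpen_iff.1 hopen x hx
  obtain ⟨q, hq1, hq2⟩ := exists_norm_mem_Ioo hK (a := x) (b := x + ε)
    (ha.trans_lt hx.1.1) (by linarith)
  have := hball (show ‖q‖ ∈ Metric.ball x ε by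
    rw [Metric.mem_ball, Real.dist_eq, abs_lt]; constructor <;> linarith)
  exact ⟨q, this.1.1, this.1.2, this.2⟩

/-- A function which does not change under small multiplicative changes of the norm is constant
(away from finitely many exceptional norms). -/
theorem eq_of_locally_eq (hK : ∃ x : K, 1 < ‖x‖) {E : Set ℝ} (hE : E.Finite) {α : Type*}
    (F : K → α) {b : ℝ} (hb : 1 < b) {q₀ : K} (hq₀ : ‖q₀‖ ∉ E)
    (hF : ∀ q q' : K, q ≠ 0 → ‖q‖ ∉ E → ‖q'‖ ∉ E → ‖q‖ ≤ ‖q'‖ → ‖q'‖ ≤ ‖q₀‖ →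
      ‖q'‖ ≤ b ^ 2 * ‖q‖ → F q = F q')
    {q : K} (hq : q ≠ 0) (hqE : ‖q‖ ∉ E) (hqq₀ : ‖q‖ ≤ ‖q₀‖) : F q = F q₀ := by
  obtain ⟨k, hk⟩ : ∃ k : ℕ, ‖q₀‖ ≤ ‖q‖ * b ^ k := by
    obtain ⟨k, hk⟩ := pow_unbounded_of_one_lt (‖q₀‖ / ‖q‖) hb
    refine ⟨k, ?_⟩
    have := norm_pos_iff.2 hq
    rw [div_lt_iff₀ this] at hk
    linarith
  induction k generalizing q with
  | zero =>
    have := norm_pos_iff.2 hq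
    exact hF q q₀ hq hqE hq₀ hqq₀ le_rfl (by nlinarith [one_lt_pow₀ hb two_ne_zero])
  | succ k ih =>
    have hq0 := norm_pos_iff.2 hq
    by_cases hnear : ‖q₀‖ ≤ b ^ 2 * ‖q‖
    · exact hF q q₀ hq hqE hq₀ hqq₀ le_rfl hnear
    obtain ⟨q', h1, h2, h3⟩ := exists_norm_mem_Ioo_notMem hK hE (a := b * ‖q‖)
      (b := b ^ 2 * ‖q‖) (by positivity)
      (mul_lt_mul_of_pos_right (by nlinarith) hq0)
    have hqq' : ‖q‖ ≤ ‖q'‖ := by nlinarith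
    rw [hF q q' hq hqE h3 hqq' (by linarith) h2.le]
    refine ih (norm_pos_iff.1 (hq0.trans_le hqq')) h3 (by linarith) (hk.trans ?_)
    calc ‖q‖ * b ^ (k + 1) = (b * ‖q‖) * b ^ k := by ring
      _ ≤ _ := by gcongr

variable [IsUltrametricDist K]

omit [IsAlgClosed K] in
theorem norm_prod_sub_le {c q q' : K} {b : ℝ} (hb : 1 ≤ b) (hqq' : ‖q'‖ ≤ b * ‖q‖)
    (s : Multiset K) (hs : ∀ ρ ∈ s, ‖q‖ ≠ ‖ρ - c‖ ) :
    ‖(s.map fun ρ ↦ c + q' - ρ).prod‖ ≤ b ^ s.card * ‖(s.map fun ρ ↦ c + q - ρ).prod‖ := by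
  induction s using Multiset.induction_on with
  | empty => simp
  | cons ρ s ih =>
    rw [Multiset.map_cons, Multiset.prod_cons, Multiset.map_cons, Multiset.prod_cons, norm_mul,
      norm_mul, Multiset.card_cons, pow_succ]
    have h1 : ‖c + q' - ρ‖ ≤ b * ‖c + q - ρ‖ := by
      rw [show c + q' - ρ = q' - (ρ - c) by ring, show c + q - ρ = q - (ρ - c) by ring,
        norm_sub_eq_max_of_ne (hs ρ (Multiset.mem_cons_self _ _))]
      refine (norm_sub_le_max_of_ultrametric _ _).trans (max_le ?_ ?_)
      · exact hqq'.trans (by gcongr; exact le_max_left _ _)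
      · refine (le_max_right ‖q‖ ‖ρ - c‖).trans (le_mul_of_one_le_left ?_ hb)
        exact (norm_nonneg _).trans (le_max_left _ _)
    calc _ ≤ (b * ‖c + q - ρ‖) * (b ^ s.card * ‖(s.map fun ρ ↦ c + q - ρ).prod‖) := by
          gcongr
          exact ih fun ρ h ↦ hs ρ (Multiset.mem_cons_of_mem h)
      _ = _ := by ring

theorem norm_eval_add_le {a : K[X]} {c q q' : K} {b : ℝ} (hb : 1 ≤ b) (hqq' : ‖q'‖ ≤ b * ‖q‖)
    (hs : ∀ ρ ∈ a.roots, ‖q‖ ≠ ‖ρ - c‖) {M : ℕ} (hM : a.natDegree ≤ M) :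
    ‖a.eval (c + q')‖ ≤ b ^ M * ‖a.eval (c + q)‖ := by
  have hev : ∀ t, a.eval t = a.leadingCoeff * (a.roots.map fun ρ ↦ t - ρ).prod :=
    fun t ↦ (IsAlgClosed.splits a).eval_eq_prod_roots t
  rw [hev, hev, norm_mul, norm_mul]
  calc _ ≤ ‖a.leadingCoeff‖ *
        (b ^ a.roots.card * ‖(a.roots.map fun ρ ↦ c + q - ρ).prod‖) := by
        gcongr; exact norm_prod_sub_le hb hqq' _ hs
    _ ≤ ‖a.leadingCoeff‖ * (b ^ M * ‖(a.roots.map fun ρ ↦ c + q - ρ).prod‖) := by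
        gcongr; exact (card_roots' a).trans hM
    _ = _ := by ring

omit [IsAlgClosed K] [IsUltrametricDist K] in
theorem rpow_le_of_close {x y b : ℝ} (l : ℝ) (hx : 0 < x) (hy : 0 < y) (hb : 1 ≤ b)
    (hxy : x ≤ b * y) (hyx : y ≤ b * x) {M : ℕ} (hM : |l| ≤ M) : x ^ l ≤ b ^ M * y ^ l := by
  have hb0 : 0 < b := by linarith
  have h1 := Real.log_le_log hx hxy
  have h2 := Real.log_le_log hy hyx
  rw [Real.log_mul hb0.ne' hy.ne'] at h1
  rw [Real.log_mul hb0.ne' hx.ne'] at h2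
  rw [← Real.rpow_natCast, Real.rpow_def_of_pos hx, Real.rpow_def_of_pos hy,
    Real.rpow_def_of_pos hb0, ← Real.exp_add]
  refine Real.exp_le_exp.2 ?_
  have h3 : |(Real.log x - Real.log y) * l| ≤ Real.log b * M := by
    rw [abs_mul]
    gcongr
    · exact Real.log_nonneg hb
    · rw [abs_le]; constructor <;> linarith
  linarith [le_abs_self ((Real.log x - Real.log y) * l)]

omit [IsAlgClosed K] [IsUltrametricDist K] in
theorem countP_norm_lt_div {T θ : ℝ} (hT : 0 < T) (hθ : 0 < θ) (hθ1 : θ < 1) (s : Multiset K)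
    (hs : ∀ η ∈ s, ‖η‖ = T ∨ ‖η‖ ≤ T * θ ^ 2 ∨ T ≤ ‖η‖ * θ ^ 2) :
    s.countP (fun η ↦ ‖η‖ < T / θ) =
      s.countP (fun η ↦ ‖η‖ < T * θ) + s.countP (fun η ↦ ‖η‖ = T) := by
  induction s using Multiset.induction_on with
  | empty => simp
  | cons η s ih =>
    rw [Multiset.countP_cons, Multiset.countP_cons, Multiset.countP_cons,
      ih fun η' h' ↦ hs η' (Multiset.mem_cons_of_mem h')]
    have h2 : θ ^ 2 < θ := by nlinarith
    have h3 : T * θ < T := mul_lt_of_lt_one_right hT hθ1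
    have h4 : T < T / θ := by rw [lt_div_iff₀ hθ]; exact h3
    have h5 : T * θ ^ 2 < T * θ := by gcongr
    rcases hs η (Multiset.mem_cons_self _ _) with h | h | h
    · rw [if_pos (by linarith), if_neg (by linarith), if_pos h]; ring
    · rw [if_pos (by linarith), if_pos (by linarith), if_neg (by linarith)]; ring
    · have h6 : T / θ ≤ ‖η‖ := by
        rw [div_le_iff₀ hθ]
        exact h.trans (by gcongr)
      rw [if_neg (by linarith), if_neg (by linarith), if_neg (by linarith)]
      ring

theorem countP_roots_eq_of_close {p p' : K[X]} (hp0 : p ≠ 0) (hp0' : p' ≠ 0) {T T' θ B : ℝ}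
    (hT : 0 < T) (hT' : 0 < T') (hθ : 0 < θ) (hθ1 : θ < 1) (hB : 1 ≤ B)
    (hBθ : B ^ 3 * θ ^ 2 < 1)
    (hs : ∀ η ∈ p.roots, ‖η‖ = T ∨ ‖η‖ ≤ T * θ ^ 2 ∨ T ≤ ‖η‖ * θ ^ 2)
    (hs' : ∀ η ∈ p'.roots, ‖η‖ = T' ∨ ‖η‖ ≤ T' * θ ^ 2 ∨ T' ≤ ‖η‖ * θ ^ 2)
    (hp : ∀ i, ‖p.coeff i‖ ≤ B * ‖p'.coeff i‖) (hp' : ∀ i, ‖p'.coeff i‖ ≤ B * ‖p.coeff i‖)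
    (hTB : T ≤ B * T') (hTB' : T' ≤ B * T) :
    p.roots.countP (fun η ↦ ‖η‖ = T) = p'.roots.countP (fun η ↦ ‖η‖ = T') := by
  have sep : ∀ {q : K[X]} {S : ℝ}, 0 < S →
      (∀ η ∈ q.roots, ‖η‖ = S ∨ ‖η‖ ≤ S * θ ^ 2 ∨ S ≤ ‖η‖ * θ ^ 2) →
      (∀ η ∈ q.roots, ‖η‖ ≤ S / θ * θ ∨ S / θ ≤ ‖η‖ * θ) ∧
      (∀ η ∈ q.roots, ‖η‖ ≤ S * θ * θ ∨ S * θ ≤ ‖η‖ * θ) := by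
    intro q S hS hq
    rw [div_mul_cancel₀ _ hθ.ne']
    have h1 : θ ^ 2 ≤ 1 := by nlinarith
    have h2 : S * θ ^ 2 ≤ S := mul_le_of_le_one_right hS.le h1
    refine ⟨fun η hη ↦ ?_, fun η hη ↦ ?_⟩
    · rcases hq η hη with h | h | h
      · exact Or.inl h.le
      · exact Or.inl (h.trans h2)
      · right
        rw [div_le_iff₀ hθ]
        linarith
    · rcases hq η hη with h | h | h
      · exact Or.inr (by rw [h])
      · exact Or.inl (by linarith)
      · right
        have := mul_le_of_le_one_right (norm_nonneg η) h1
        gcongr; linarith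
  have e1 := (dominantTerm_roots hp0 (div_pos hT hθ) hθ hθ1 (sep hT hs).1).eq_of_close
    (dominantTerm_roots hp0' (div_pos hT' hθ) hθ hθ1 (sep hT' hs').1) (div_pos hT hθ)
    (div_pos hT' hθ) hθ hB hBθ hp hp' (by rw [← mul_div_assoc]; gcongr)
    (by rw [← mul_div_assoc]; gcongr)
  have e2 := (dominantTerm_roots hp0 (mul_pos hT hθ) hθ hθ1 (sep hT hs).2).eq_of_close
    (dominantTerm_roots hp0' (mul_pos hT' hθ) hθ hθ1 (sep hT' hs').2) (mul_pos hT hθ)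
    (mul_pos hT' hθ) hθ hB hBθ hp hp' (by rw [← mul_assoc]; gcongr)
    (by rw [← mul_assoc]; gcongr)
  have e3 := countP_norm_lt_div hT hθ hθ1 _ hs
  have e4 := countP_norm_lt_div hT' hθ hθ1 _ hs'
  omega

/-- **Continuation of roots.** Suppose that, over the annulus `‖c‖ ≤ ‖t‖ ≤ r`, the roots of
`g(t, Y)` have absolute value `‖t‖ ^ l` or are uniformly far from it. If a root with absolute value
`‖t‖ ^ l` exists at some `t = c + q₀` with `‖q₀‖` generic, then there are such roots for `t`
arbitrarily close to `c`. -/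
theorem exists_root_near (hK : ∃ x : K, 1 < ‖x‖) {g : K[X][X]} {h : K[X]} (hg : g ≠ 0)
    (hh : h ≠ 0) {c : K} (hc : c ≠ 0) {r l θ : ℝ} (hr : ‖c‖ ≤ r) (hθ : 0 < θ) (hθ1 : θ < 1)
    (hroots : ∀ t, ‖c‖ ≤ ‖t‖ → ‖t‖ ≤ r → h.eval t ≠ 0 →
      ∀ η, (g.map (evalRingHom t)).eval η = 0 →
      ‖η‖ = ‖t‖ ^ l ∨ ‖η‖ ≤ ‖t‖ ^ l * θ ^ 2 ∨ ‖t‖ ^ l ≤ ‖η‖ * θ ^ 2) :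
    ∃ E : Set ℝ, E.Finite ∧ ∀ q₀ : K, ‖q₀‖ ≤ r → ‖q₀‖ ∉ E → q₀ ≠ 0 →
      (∃ η, (g.map (evalRingHom (c + q₀))).eval η = 0 ∧ ‖η‖ = ‖c + q₀‖ ^ l) →
      ∀ ε > 0, ∃ t, ‖t - c‖ < ε ∧ h.eval t ≠ 0 ∧ ‖t‖ = ‖c‖ ∧
        ∃ η, (g.map (evalRingHom t)).eval η = 0 ∧ ‖η‖ = ‖t‖ ^ l := by
  classical
  set G : K[X] := h * ∏ i ∈ g.support, g.coeff i with hG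
  have hG0 : G ≠ 0 := mul_ne_zero hh (Finset.prod_ne_zero_iff.2 fun i hi ↦ mem_support_iff.1 hi)
  set E : Set ℝ := insert ‖c‖ ((fun ρ ↦ ‖ρ - c‖) '' {ρ | ρ ∈ G.roots}) with hE
  have hEfin : E.Finite := by
    refine Set.Finite.insert _ (Set.Finite.image _ ?_)
    exact (G.roots.toFinset.finite_toSet).subset fun ρ hρ ↦ by simpa using hρ
  obtain ⟨M, hM, hlM⟩ : ∃ M : ℕ, (∀ i, (g.coeff i).natDegree ≤ M) ∧ |l| ≤ M := by
    obtain ⟨k, hk⟩ := exists_nat_ge |l|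
    refine ⟨max k (g.support.sup fun i ↦ (g.coeff i).natDegree), fun i ↦ ?_, hk.trans (by simp)⟩
    by_cases hi : i ∈ g.support
    · exact (Finset.le_sup (f := fun i ↦ (g.coeff i).natDegree) hi).trans (le_max_right _ _)
    · rw [notMem_support_iff.1 hi]; simp
  obtain ⟨b, hbθ, hb⟩ : ∃ b : ℝ, ((b ^ 2) ^ M) ^ 3 * θ ^ 2 < 1 ∧ 1 < b := by
    have hcont : Continuous fun b : ℝ ↦ ((b ^ 2) ^ M) ^ 3 * θ ^ 2 := by fun_prop
    have hev := (hcont.tendsto 1).eventually_lt_const (u := 1)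
      (by simp only [one_pow, one_mul]; nlinarith)
    exact ((hev.filter_mono (nhdsWithin_le_nhds (s := Set.Ioi 1))).and
      self_mem_nhdsWithin).exists
  have hb2 : 1 ≤ b ^ 2 := one_le_pow₀ hb.le
  have hGq : ∀ q : K, ‖q‖ ∉ E → G.eval (c + q) ≠ 0 := fun q hq h0 ↦ hq <| Set.mem_insert_of_mem _
    ⟨c + q, (mem_roots hG0).2 h0, by simp⟩
  have hhq : ∀ q : K, ‖q‖ ∉ E → h.eval (c + q) ≠ 0 := fun q hq h0 ↦ hGq q hq (by simp [hG, h0])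
  have hcq : ∀ q : K, ‖q‖ ∉ E → ∀ i ∈ g.support, (g.coeff i).eval (c + q) ≠ 0 := by
    intro q hq i hi h0
    refine hGq q hq ?_
    rw [hG, eval_mul, eval_prod, Finset.prod_eq_zero hi h0, mul_zero]
  have hne : ∀ q : K, ‖q‖ ∉ E → g.map (evalRingHom (c + q)) ≠ 0 := by
    intro q hq h0
    obtain ⟨i, hi⟩ := nonempty_support_iff.2 hg
    exact hcq q hq i hi (by simpa using congrArg (coeff · i) h0)
  have hnorm : ∀ q : K, ‖q‖ ∉ E → ‖c + q‖ = max ‖c‖ ‖q‖ := fun q hq ↦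
    IsUltrametricDist.norm_add_eq_max_of_norm_ne_norm fun h' ↦ hq (h' ▸ Set.mem_insert _ _)
  have hc0 := norm_pos_iff.2 hc
  have hsep : ∀ q : K, ‖q‖ ∉ E → ‖q‖ ≤ r → ∀ η ∈ (g.map (evalRingHom (c + q))).roots,
      ‖η‖ = ‖c + q‖ ^ l ∨ ‖η‖ ≤ ‖c + q‖ ^ l * θ ^ 2 ∨ ‖c + q‖ ^ l ≤ ‖η‖ * θ ^ 2 := by
    intro q hq hqr η hη
    refine hroots _ ?_ ?_ (hhq q hq) η ((mem_roots (hne q hq)).1 hη)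
    · rw [hnorm q hq]; exact le_max_left _ _
    · rw [hnorm q hq]; exact max_le hr hqr
  have hcoeff : ∀ q q' : K, ‖q‖ ∉ E → ‖q'‖ ≤ b ^ 2 * ‖q‖ → ∀ i,
      ‖(g.map (evalRingHom (c + q'))).coeff i‖ ≤
        (b ^ 2) ^ M * ‖(g.map (evalRingHom (c + q))).coeff i‖ := by
    intro q q' hq hqq' i
    simp only [coeff_map, coe_evalRingHom]
    refine norm_eval_add_le hb2 hqq' (fun ρ hρ heq ↦ hq ?_) (hM i)
    refine Set.mem_insert_of_mem _ ⟨ρ, (mem_roots hG0).2 ?_, heq.symm⟩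
    have hi : i ∈ g.support := by
      rw [mem_support_iff]
      exact fun h0 ↦ by simp [h0] at hρ
    have h0 : (g.coeff i).eval ρ = 0 := isRoot_of_mem_roots hρ
    rw [IsRoot, hG, eval_mul, eval_prod, Finset.prod_eq_zero hi h0, mul_zero]
  have hmax : ∀ q q' : K, ‖q‖ ∉ E → ‖q'‖ ∉ E → ‖q'‖ ≤ b ^ 2 * ‖q‖ →
      ‖c + q'‖ ≤ b ^ 2 * ‖c + q‖ := by
    intro q q' hq hq' hqq'
    rw [hnorm q hq, hnorm q' hq']
    refine max_le ((le_max_left _ _).trans (le_mul_of_one_le_left (by positivity) hb2))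
      (hqq'.trans (by gcongr; exact le_max_right _ _))
  have hpos : ∀ q : K, ‖q‖ ∉ E → 0 < ‖c + q‖ := fun q hq ↦ by
    rw [hnorm q hq]; exact hc0.trans_le (le_max_left _ _)
  refine ⟨E, hEfin, fun q₀ hq₀r hq₀E hq₀ ⟨η₀, hη₀, hη₀'⟩ ε hε ↦ ?_⟩
  obtain ⟨q, hq0, hq1, hqE⟩ := exists_norm_mem_Ioo_notMem hK hEfin (a := 0)
    (b := min ε (min ‖c‖ ‖q₀‖)) le_rfl
    (lt_min hε (lt_min hc0 (norm_pos_iff.2 hq₀)))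
  obtain ⟨hqε, hqc, hqq₀⟩ : ‖q‖ < ε ∧ ‖q‖ < ‖c‖ ∧ ‖q‖ < ‖q₀‖ := by
    simpa only [lt_min_iff] using hq1
  have heq := eq_of_locally_eq hK hEfin
    (fun q ↦ (g.map (evalRingHom (c + q))).roots.countP fun η ↦ ‖η‖ = ‖c + q‖ ^ l) hb hq₀E
    (fun q q' _ hq hq' hqq' hq'q₀ hb' ↦ by
      have hbq' : ‖q‖ ≤ b ^ 2 * ‖q'‖ := hqq'.trans (le_mul_of_one_le_left (norm_nonneg _) hb2)
      have hp := hpos q hq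
      have hp' := hpos q' hq'
      exact countP_roots_eq_of_close (hne q hq) (hne q' hq') (Real.rpow_pos_of_pos hp l)
        (Real.rpow_pos_of_pos hp' l) hθ hθ1 (one_le_pow₀ hb2) hbθ
        (hsep q hq (by linarith)) (hsep q' hq' (by linarith)) (hcoeff q' q hq' hbq')
        (hcoeff q q' hq hb')
        (rpow_le_of_close l hp hp' hb2 (hmax q' q hq' hq hbq') (hmax q q' hq hq' hb') hlM)
        (rpow_le_of_close l hp' hp hb2 (hmax q q' hq hq' hb') (hmax q' q hq' hq hbq') hlM))
    (norm_pos_iff.1 hq0) hqE hqq₀.le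
  have hpos₀ : 0 < (g.map (evalRingHom (c + q₀))).roots.countP fun η ↦ ‖η‖ = ‖c + q₀‖ ^ l :=
    Multiset.countP_pos.2 ⟨η₀, (mem_roots (hne q₀ hq₀E)).2 hη₀, hη₀'⟩
  obtain ⟨η, hη, hη'⟩ := Multiset.countP_pos.1 (heq ▸ hpos₀)
  exact ⟨c + q, by simpa using hqε, hhq q hqE, by rw [hnorm q hqE, max_eq_left hqc.le], η,
    (mem_roots (hne q hqE)).1 hη, hη'⟩

end Path

section Limit

open Polynomial Filter Topology

theorem exists_mem_tendsto_of_tendsto_prod {K ι : Type*} [NormedField K] (U : Ultrafilter ι)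
    (u : ι → K) (s : Multiset K)
    (h : Tendsto (fun k ↦ (s.map fun ρ ↦ u k - ρ).prod) U (𝓝 0)) :
    ∃ ρ ∈ s, Tendsto u U (𝓝 ρ) := by
  induction s using Multiset.induction_on with
  | empty => simp [tendsto_const_nhds_iff] at h
  | cons ρ s ih =>
    by_cases hρ : Tendsto u U (𝓝 ρ)
    · exact ⟨ρ, Multiset.mem_cons_self _ _, hρ⟩
    obtain ⟨ε, hε, hfar⟩ : ∃ ε > 0, ∀ᶠ k in (U : Filter ι), ε ≤ ‖u k - ρ‖ := by
      rw [Metric.tendsto_nhds] at hρ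
      push Not at hρ
      obtain ⟨ε, hε, h'⟩ := hρ
      refine ⟨ε, hε, ?_⟩
      simpa [dist_eq_norm] using h'
    obtain ⟨ρ', hρ', h'⟩ := ih <| by
      have h1 := (h.norm).const_mul ε⁻¹
      rw [norm_zero, mul_zero] at h1
      refine squeeze_zero_norm' ?_ h1
      filter_upwards [hfar] with k hk
      rw [Multiset.map_cons, Multiset.prod_cons, norm_mul, ← mul_assoc]
      refine le_mul_of_one_le_left (norm_nonneg _) ?_
      rwa [← div_eq_inv_mul, one_le_div hε]
    exact ⟨ρ', Multiset.mem_cons_of_mem hρ', h'⟩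

variable {K : Type*} [NormedField K] [IsAlgClosed K] {n : ℕ}

/-- A family of bounded solutions of `f(t, η) = 0` with `t → c` converges along an ultrafilter. -/
theorem exists_tendsto_of_relation {ι : Type*} (U : Ultrafilter ι) {f : K[X][X]} {c : K}
    (hf : f.map (evalRingHom c) ≠ 0) {t u : ι → K} (ht : Tendsto t U (𝓝 c)) {N : ℝ}
    (hN : ∀ k, ‖u k‖ = N) (h : ∀ k, (f.map (evalRingHom (t k))).eval (u k) = 0) :
    ∃ ρ, Tendsto u U (𝓝 ρ) := by
  have hsum : ∀ s v, (f.map (evalRingHom s)).eval v = ∑ i ∈ f.support, (f.coeff i).eval s * v ^ i :=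
    fun s v ↦ by rw [eval_map, eval₂_eq_sum, Polynomial.sum]; rfl
  have h0 : Tendsto (fun k ↦ (f.map (evalRingHom c)).eval (u k)) U (𝓝 0) := by
    have h1 : ∀ k, (f.map (evalRingHom c)).eval (u k) =
        ∑ i ∈ f.support, ((f.coeff i).eval c - (f.coeff i).eval (t k)) * u k ^ i := fun k ↦ by
      rw [← sub_zero ((f.map (evalRingHom c)).eval (u k)), ← h k, hsum, hsum,
        ← Finset.sum_sub_distrib]
      exact Finset.sum_congr rfl fun i _ ↦ by ring
    simp only [h1]
    rw [← Finset.sum_const_zero (s := f.support)]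
    refine tendsto_finsetSum _ fun i _ ↦ ?_
    have h2 : Tendsto (fun k ↦ ‖(f.coeff i).eval c - (f.coeff i).eval (t k)‖ * N ^ i) U (𝓝 0) := by
      have h3 := (((f.coeff i).continuous.tendsto c).comp ht).const_sub ((f.coeff i).eval c)
      simpa using h3.norm.mul_const (N ^ i)
    exact squeeze_zero_norm (fun k ↦ by rw [norm_mul, norm_pow, hN]) h2
  obtain ⟨ρ, -, hρ⟩ := exists_mem_tendsto_of_tendsto_prod U u (f.map (evalRingHom c)).roots <| by
    have h1 := h0.const_mul ((f.map (evalRingHom c)).leadingCoeff)⁻¹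
    rw [mul_zero] at h1
    refine h1.congr fun k ↦ ?_
    rw [(IsAlgClosed.splits _).eval_eq_prod_roots, inv_mul_cancel_left₀ (leadingCoeff_ne_zero.2 hf)]
  exact ⟨ρ, hρ⟩

/-- A sequence of points of `V(P)` with constant absolute values whose first coordinates tend to `c`
accumulates at a point of `V(P)`, if all coordinates are algebraic over `x₀ = c`. -/
theorem exists_limit_point {P : Ideal (MvPolynomial (Fin (n + 1)) K)} {c : K}
    {z : ℕ → Fin (n + 1) → K} (hz : ∀ k, ∀ p ∈ P, MvPolynomial.eval (z k) p = 0)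
    (hzc : Tendsto (fun k ↦ z k 0) atTop (𝓝 c)) {N : Fin (n + 1) → ℝ}
    (hN : ∀ k j, ‖z k j‖ = N j)
    (hrel : ∀ j, ∃ f, planeHom (MvPolynomial.X j) f ∈ P ∧ f.map (evalRingHom c) ≠ 0) :
    ∃ ρ : Fin (n + 1) → K, (∀ p ∈ P, MvPolynomial.eval ρ p = 0) ∧ ρ 0 = c ∧
      ∀ j, ‖ρ j‖ = N j := by
  have hU : ((hyperfilter ℕ : Ultrafilter ℕ) : Filter ℕ) ≤ atTop := by
    rw [← Nat.cofinite_eq_atTop]; exact hyperfilter_le_cofinite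
  have hex : ∀ j, ∃ ρ, Tendsto (fun k ↦ z k j) (hyperfilter ℕ : Ultrafilter ℕ) (𝓝 ρ) := by
    intro j
    obtain ⟨f, hfP, hf⟩ := hrel j
    refine exists_tendsto_of_relation _ hf (hzc.mono_left hU) (fun k ↦ hN k j) fun k ↦ ?_
    have := hz k _ hfP
    rwa [eval_planeHom, MvPolynomial.eval_X] at this
  choose ρ hρ using hex
  refine ⟨ρ, fun p hp ↦ ?_, tendsto_nhds_unique (hρ 0) (hzc.mono_left hU), fun j ↦ ?_⟩
  · have h1 := ((MvPolynomial.continuous_eval p).tendsto ρ).comp (tendsto_pi_nhds.2 hρ)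
    refine tendsto_nhds_unique h1 (tendsto_const_nhds.congr fun k ↦ ?_)
    exact (hz k p hp).symm
  · refine tendsto_nhds_unique (hρ j).norm (tendsto_const_nhds.congr fun k ↦ ?_)
    exact (hN k j).symm

end Limit

section Fibre

open Polynomial Filter Topology

theorem exists_nat_weights_injOn {m : ℕ} {F : Set (Fin m → ℝ)} (hF : F.Finite) :
    ∃ M : Fin m → ℕ, Set.InjOn (fun f ↦ ∑ j, (M j : ℝ) * f j) F := by
  let π : (Fin m → ℝ) → ℝ[X] := fun f ↦ ∑ j, C (f j) * X ^ (j : ℕ)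
  have hcoeff : ∀ f j, (π f).coeff (j : Fin m) = f j := fun f j ↦ by
    simp [π, coeff_X_pow, Fin.val_inj]
  have hfin : (⋃ p ∈ F ×ˢ F, {x | x ∈ (π p.1 - π p.2).roots}).Finite :=
    (hF.prod hF).biUnion fun p _ ↦
      ((π p.1 - π p.2).roots.toFinset.finite_toSet).subset fun x hx ↦ by simpa using hx
  obtain ⟨_, ⟨N, rfl⟩, hN⟩ :=
    ((Set.infinite_range_of_injective (Nat.cast_injective (R := ℝ))).sdiff hfin).nonempty
  refine ⟨fun j ↦ N ^ (j : ℕ), fun f hf f' hf' heq ↦ ?_⟩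
  by_contra hne
  refine hN (Set.mem_biUnion (x := (f, f')) ⟨hf, hf'⟩ ?_)
  have hπ : π f - π f' ≠ 0 := fun h0 ↦ hne <| funext fun j ↦ by
    rw [← hcoeff f, ← hcoeff f', sub_eq_zero.1 h0]
  refine (mem_roots hπ).2 ?_
  have heval : ∀ f : Fin m → ℝ, (π f).eval (N : ℝ) =
      ∑ j : Fin m, ((N ^ j.val : ℕ) : ℝ) * f j := fun f ↦ by
    simp only [π, eval_finsetSum, eval_mul, eval_C, eval_pow, eval_X, Nat.cast_pow, mul_comm]
  rw [IsRoot, eval_sub, heval, heval, sub_eq_zero]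
  exact heq

variable {K : Type*} [NormedField K] [IsAlgClosed K] {n : ℕ}

theorem exists_planeHom_mem_of_norm (hK : ∃ x : K, 1 < ‖x‖)
    {P : Ideal (MvPolynomial (Fin (n + 1)) K)} [P.IsPrime] {b : MvPolynomial (Fin (n + 1)) K}
    (hb : b ∉ P) (y : MvPolynomial (Fin (n + 1)) K) {a r : ℝ} (ha : 0 ≤ a) (har : a < r)
    {Λ : Set ℝ} (hΛ : Λ.Finite)
    (hy : ∀ z : Fin (n + 1) → K, (∀ p ∈ P, MvPolynomial.eval z p = 0) → MvPolynomial.eval z b ≠ 0 →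
      a ≤ ‖z 0‖ → ‖z 0‖ ≤ r → ∃ l ∈ Λ, ‖MvPolynomial.eval z y‖ = ‖z 0‖ ^ l) :
    ∃ g ≠ 0, planeHom y g ∈ P := by
  have hinf : ∀ (s : Set K) (E : Set ℝ) (a r : ℝ), 0 ≤ a → a < r → E.Finite →
      (∀ q, a ≤ ‖q‖ → ‖q‖ ≤ r → ‖q‖ ∉ E → q ∈ s) → s.Infinite := by
    intro s E a r ha har hE hs hfin
    obtain ⟨q, h1, h2, h3⟩ := exists_norm_mem_Ioo_notMem hK (hE.union (hfin.image (‖·‖))) ha har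
    exact h3 (Or.inr ⟨q, hs q h1.le h2.le fun h ↦ h3 (Or.inl h), rfl⟩)
  refine exists_planeHom_mem hb y (T := {t | a ≤ ‖t‖ ∧ ‖t‖ ≤ r})
    (hinf _ ∅ a r ha har Set.finite_empty fun q h1 h2 _ ↦ ⟨h1, h2⟩) fun t ⟨ht1, ht2⟩ ↦ ?_
  refine hinf _ ((‖t‖ ^ ·) '' Λ) 0 1 le_rfl one_pos (hΛ.image _) fun η _ _ hη ↦ ?_
  rintro ⟨z, hz, hzb, rfl, rfl⟩
  obtain ⟨l, hl, h⟩ := hy z hz hzb ht1 ht2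
  exact hη ⟨l, hl, h.symm⟩

/-- On a set where `|log x|` is bounded below, the powers `x ^ l` for `l` in a finite set are
uniformly separated. -/
theorem exists_separation {Λ : Set ℝ} (hΛ : Λ.Finite) (l₀ : ℝ) {m : ℝ} (hm : 0 < m) :
    ∃ θ : ℝ, 0 < θ ∧ θ < 1 ∧ ∀ x : ℝ, 0 < x → m ≤ |Real.log x| → ∀ l ∈ Λ,
      l = l₀ ∨ x ^ l ≤ x ^ l₀ * θ ^ 2 ∨ x ^ l₀ ≤ x ^ l * θ ^ 2 := by
  obtain ⟨δ, hδ, hδΛ⟩ : ∃ δ > 0, ∀ l ∈ Λ, l ≠ l₀ → δ ≤ |l - l₀| := by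
    have hopen : IsOpen (Λ \ {l₀})ᶜ := hΛ.sdiff.isClosed.isOpen_compl
    obtain ⟨δ, hδ, hball⟩ := Metric.isOpen_iff.1 hopen l₀ (by simp)
    refine ⟨δ, hδ, fun l hl hne ↦ ?_⟩
    by_contra! hlt
    exact hball (show l ∈ Metric.ball l₀ δ by rwa [Metric.mem_ball, Real.dist_eq]) ⟨hl, hne⟩
  refine ⟨Real.exp (-(δ * m / 2)), Real.exp_pos _, by simpa using by positivity, ?_⟩
  intro x hx hmx l hl
  by_cases hne : l = l₀
  · exact Or.inl hne
  right
  have h1 : δ * m ≤ |(l - l₀) * Real.log x| := by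
    rw [abs_mul]; exact mul_le_mul (hδΛ l hl hne) hmx hm.le (abs_nonneg _)
  rw [Real.rpow_def_of_pos hx, Real.rpow_def_of_pos hx, ← Real.exp_nat_mul, ← Real.exp_add,
    ← Real.exp_add, Real.exp_le_exp, Real.exp_le_exp]
  push_cast
  rcases le_abs.1 h1 with h | h
  · right; linarith
  · left; linarith

variable [IsUltrametricDist K]

/-- The case of a prime ideal: if the part of the tropical variety over an annulus `‖c‖ ≤ ‖x₀‖ ≤ r`
lies on finitely many rays, and the ray through `f₀` is hit infinitely often, then it is hit by a
point with `x₀ = c`. -/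
theorem exists_point_of_isPrime (hK : ∃ x : K, 1 < ‖x‖)
    {P : Ideal (MvPolynomial (Fin (n + 1)) K)} [P.IsPrime] {c : K} (hc : c ≠ 0) {r m : ℝ}
    (hcr : ‖c‖ < r) (hm : 0 < m) (hmr : ∀ x, ‖c‖ ≤ x → x ≤ r → m ≤ |Real.log x|)
    {F : Set (Fin (n + 1) → ℝ)} (hF : F.Finite)
    (hPF : ∀ z : Fin (n + 1) → K, (∀ p ∈ P, MvPolynomial.eval z p = 0) → (∀ j, z j ≠ 0) →
      ‖c‖ ≤ ‖z 0‖ → ‖z 0‖ ≤ r → ∃ f ∈ F, ∀ j, ‖z j‖ = ‖z 0‖ ^ f j)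
    {f₀ : Fin (n + 1) → ℝ} (hf₀ : f₀ ∈ F)
    (hS : {s : ℝ | ‖c‖ < s ∧ s ≤ r ∧ ∃ z : Fin (n + 1) → K,
      (∀ p ∈ P, MvPolynomial.eval z p = 0) ∧ ‖z 0‖ = s ∧ ∀ j, ‖z j‖ = s ^ f₀ j}.Infinite) :
    ∃ ρ : Fin (n + 1) → K, (∀ p ∈ P, MvPolynomial.eval ρ p = 0) ∧ ρ 0 = c ∧
      ∀ j, ‖ρ j‖ = ‖c‖ ^ f₀ j := by
  have hc0 := norm_pos_iff.2 hc
  let b : MvPolynomial (Fin (n + 1)) K := ∏ j, MvPolynomial.X j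
  have hbz : ∀ z : Fin (n + 1) → K, MvPolynomial.eval z b ≠ 0 ↔ ∀ j, z j ≠ 0 := fun z ↦ by
    simp [b, Finset.prod_ne_zero_iff]
  obtain ⟨hb, hXc⟩ : b ∉ P ∧ MvPolynomial.X 0 - MvPolynomial.C c ∉ P := by
    obtain ⟨s, hs, -, z, hz, rfl, hz'⟩ := hS.nonempty
    refine ⟨fun h ↦ (hbz z).2 (fun j ↦ ?_) (hz _ h), fun h ↦ ?_⟩
    · rw [← norm_pos_iff, hz']; exact Real.rpow_pos_of_pos (hc0.trans hs) _
    · have h0 := hz _ h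
      rw [map_sub, MvPolynomial.eval_X, MvPolynomial.eval_C, sub_eq_zero] at h0
      rw [h0] at hs
      exact lt_irrefl _ hs
  have hPF' : ∀ z : Fin (n + 1) → K, (∀ p ∈ P, MvPolynomial.eval z p = 0) →
      MvPolynomial.eval z b ≠ 0 → ‖c‖ ≤ ‖z 0‖ → ‖z 0‖ ≤ r →
      ∃ f ∈ F, ∀ j, ‖z j‖ = ‖z 0‖ ^ f j :=
    fun z hz hzb ↦ hPF z hz ((hbz z).1 hzb)
  have hrel : ∀ j, ∃ f, planeHom (MvPolynomial.X j) f ∈ P ∧ f.map (evalRingHom c) ≠ 0 := by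
    intro j
    obtain ⟨g, hg0, hg⟩ := exists_planeHom_mem_of_norm hK hb (MvPolynomial.X j) hc0.le hcr
      (hF.image (· j)) fun z hz hzb h1 h2 ↦ by
        obtain ⟨f, hf, hzf⟩ := hPF' z hz hzb h1 h2
        exact ⟨f j, ⟨f, hf, rfl⟩, by rw [MvPolynomial.eval_X, hzf]⟩
    exact exists_planeHom_mem_map_ne_zero hg0 hg hXc
  obtain ⟨M, hM⟩ := exists_nat_weights_injOn hF
  let lam : (Fin (n + 1) → ℝ) → ℝ := fun f ↦ ∑ j, (M j : ℝ) * f j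
  let y : MvPolynomial (Fin (n + 1)) K := ∏ j, MvPolynomial.X j ^ M j
  have hy : ∀ (z : Fin (n + 1) → K) (f : Fin (n + 1) → ℝ) (x : ℝ), 0 < x →
      (∀ j, ‖z j‖ = x ^ f j) → ‖MvPolynomial.eval z y‖ = x ^ lam f := by
    intro z f x hx hzf
    simp only [y, lam, MvPolynomial.eval_prod, map_pow, MvPolynomial.eval_X, norm_prod, norm_pow,
      hzf, Real.rpow_sum_of_pos hx]
    exact Finset.prod_congr rfl fun j _ ↦ by
      rw [← Real.rpow_natCast, ← Real.rpow_mul hx.le, mul_comm]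
  obtain ⟨g, hg0, hgP, h, hh0, hlift⟩ := exists_plane_curve hb y
    (exists_planeHom_mem_of_norm hK hb y hc0.le hcr (hF.image lam) fun z hz hzb h1 h2 ↦ by
      obtain ⟨f, hf, hzf⟩ := hPF' z hz hzb h1 h2
      exact ⟨lam f, ⟨f, hf, rfl⟩, hy z f _ (hc0.trans_le h1) hzf⟩)
  obtain ⟨θ, hθ, hθ1, hsep⟩ := exists_separation (hF.image lam) (lam f₀) hm
  obtain ⟨E, hE, hnear⟩ := exists_root_near hK hg0 hh0 hc hcr.le hθ hθ1 (l := lam f₀) <| by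
    intro t h1 h2 ht η hη
    obtain ⟨z, hz, hzb, rfl, rfl⟩ := hlift t ht η hη
    obtain ⟨f, hf, hzf⟩ := hPF' z hz hzb h1 h2
    have h0 := hc0.trans_le h1
    rw [hy z f _ h0 hzf]
    refine (hsep _ h0 (hmr _ h1 h2) _ ⟨f, hf, rfl⟩).imp_left fun h ↦ by rw [h]
  obtain ⟨s, ⟨hs, hsr, z₀, hz₀, rfl, hz₀'⟩, hsE⟩ := (hS.sdiff hE).nonempty
  have hq₀ : ‖z₀ 0 - c‖ = ‖z₀ 0‖ := by
    rw [norm_sub_eq_max_of_ne hs.ne', max_eq_left hs.le]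
  have hseq := hnear (z₀ 0 - c) (by rwa [hq₀]) (by rwa [hq₀])
    (norm_pos_iff.1 (hq₀ ▸ hc0.trans hs)) (by
      refine ⟨MvPolynomial.eval z₀ y, ?_, ?_⟩
      · rw [add_sub_cancel, ← eval_planeHom]; exact hz₀ _ hgP
      · rw [add_sub_cancel]; exact hy _ _ _ (hc0.trans hs) hz₀')
  have hpt : ∀ k : ℕ, ∃ z : Fin (n + 1) → K, (∀ p ∈ P, MvPolynomial.eval z p = 0) ∧
      ‖z 0 - c‖ < 1 / (k + 1) ∧ ∀ j, ‖z j‖ = ‖c‖ ^ f₀ j := by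
    intro k
    obtain ⟨t, htc, ht, htn, η, hη, hη'⟩ := hseq (1 / (k + 1)) Nat.one_div_pos_of_nat
    obtain ⟨z, hz, hzb, rfl, rfl⟩ := hlift t ht η hη
    obtain ⟨f, hf, hzf⟩ := hPF' z hz hzb htn.ge (htn.trans_le hcr.le)
    rw [htn] at hzf hη'
    rw [hy z f _ hc0 hzf] at hη'
    have hlog : Real.log ‖c‖ ≠ 0 := fun h0 ↦ by
      have := hmr _ le_rfl hcr.le
      rw [h0, abs_zero] at this
      linarith
    have hlam : lam f = lam f₀ := by
      have := congrArg Real.log hη'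
      rw [Real.log_rpow hc0, Real.log_rpow hc0] at this
      exact mul_right_cancel₀ hlog this
    obtain rfl := hM hf hf₀ hlam
    exact ⟨z, hz, htc, hzf⟩
  choose z hz hzc hzn using hpt
  refine exists_limit_point hz ?_ hzn hrel
  rw [tendsto_iff_norm_sub_tendsto_zero]
  exact squeeze_zero (fun _ ↦ norm_nonneg _) (fun k ↦ (hzc k).le)
    tendsto_one_div_add_atTop_nhds_zero_nat

end Fibre

section Tropical

open Filter Topology

/-- The points of `V(I)` in the torus, in negative logarithmic coordinates. -/
def negLogSet {K : Type*} [NormedField K] {n : ℕ} (I : Ideal (MvPolynomial (Fin n) K)) :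
    Set (Fin n → ℝ) :=
  {v | ∃ z : Fin n → K, (∀ p ∈ I, MvPolynomial.eval z p = 0) ∧ ∀ j, ‖z j‖ = Real.exp (-v j)}

variable {K : Type*} [NormedField K] [IsAlgClosed K] [IsUltrametricDist K] {n : ℕ}

omit [IsAlgClosed K] [IsUltrametricDist K] in
/-- A closure covered by finitely many rays contains points of `negLogSet I` on each of its rays,
densely. -/
theorem exists_mem_negLogSet_on_ray {I : Ideal (MvPolynomial (Fin (n + 1)) K)}
    {F : Set (Fin (n + 1) → ℝ)} (hF : F.Finite)
    (hIF : ∀ v ∈ negLogSet I, v 0 ≠ 0 → ∃ f ∈ F, v = v 0 • f) {f₀ : Fin (n + 1) → ℝ}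
    (hf₀ : f₀ 0 = 1) {s : ℝ} (hs : s ≠ 0) (hcl : s • f₀ ∈ closure (negLogSet I))
    {O : Set ℝ} (hO : IsOpen O) (hsO : s ∈ O) :
    ∃ v ∈ negLogSet I, v 0 ∈ O ∧ v = v 0 • f₀ := by
  have hopen : IsOpen ({v : Fin (n + 1) → ℝ | v 0 ∈ O ∧ v 0 ≠ 0} ∩
      ⋂ f ∈ F \ {f₀}, {v | v ≠ v 0 • f}) := by
    refine IsOpen.inter ?_ (hF.sdiff.isOpen_biInter fun f _ ↦ ?_)
    · exact (hO.inter (isOpen_ne (x := (0 : ℝ)))).preimage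
        (continuous_apply (A := fun _ : Fin (n + 1) ↦ ℝ) 0)
    · exact isOpen_ne_fun continuous_id (by fun_prop)
  obtain ⟨v, ⟨⟨hvO, hv0⟩, hvF⟩, hv⟩ := mem_closure_iff.1 hcl _ hopen <| by
    refine ⟨by simp [hf₀, hs, hsO], ?_⟩
    simp only [Set.mem_iInter]
    intro f hf h
    refine hf.2 ?_
    simp only [Pi.smul_apply, hf₀, smul_eq_mul, mul_one] at h
    exact (smul_right_injective _ hs h).symm
  obtain ⟨f, hf, hvf⟩ := hIF v hv hv0
  refine ⟨v, hv, hvO, ?_⟩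
  by_cases hff : f = f₀
  · rwa [← hff]
  · exact absurd hvf (by simpa using Set.mem_iInter₂.1 hvF f ⟨hf, hff⟩)

/-- The fibre of a one-dimensional tropical fan over `-log ‖c‖ ≠ 0` consists of points of
`V(I + ⟨x₀ - c⟩)`. -/
theorem mem_negLogSet_sup_span (hK : ∃ x : K, 1 < ‖x‖) {I : Ideal (MvPolynomial (Fin (n + 1)) K)}
    {W : Set (Fin (n + 1) → ℝ)} (hW : W.Finite)
    (hIW : closure (negLogSet I) = ⋃ w ∈ W, {v | ∃ r : ℝ, 0 ≤ r ∧ v = r • w})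
    {c : K} (hc : c ≠ 0) (hc1 : ‖c‖ ≠ 1) {v : Fin (n + 1) → ℝ} (hv : v ∈ closure (negLogSet I))
    (hv0 : ‖c‖ = Real.exp (-v 0)) :
    v ∈ negLogSet (I ⊔ Ideal.span {MvPolynomial.X 0 - MvPolynomial.C c}) := by
  have hc0 := norm_pos_iff.2 hc
  have hv00 : v 0 ≠ 0 := fun h ↦ hc1 (by rw [hv0, h]; simp)
  let F : Set (Fin (n + 1) → ℝ) := (fun w ↦ (w 0)⁻¹ • w) '' W
  have hF : F.Finite := hW.image _
  have hIF' : ∀ u ∈ closure (negLogSet I), u 0 ≠ 0 → ∃ w ∈ W, w 0 ≠ 0 ∧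
      0 < u 0 / w 0 ∧ u = u 0 • (w 0)⁻¹ • w := by
    intro u hu hu0
    rw [hIW] at hu
    obtain ⟨w, hw, t, ht, rfl⟩ := Set.mem_iUnion₂.1 hu
    rw [Pi.smul_apply, smul_eq_mul] at hu0 ⊢
    obtain ⟨ht0, hw0⟩ := mul_ne_zero_iff.1 hu0
    refine ⟨w, hw, hw0, ?_, ?_⟩
    · rw [mul_div_cancel_right₀ _ hw0]; exact lt_of_le_of_ne ht (Ne.symm ht0)
    · rw [smul_smul, mul_assoc, mul_inv_cancel₀ hw0, mul_one]
  have hIF : ∀ u ∈ closure (negLogSet I), u 0 ≠ 0 → ∃ f ∈ F, u = u 0 • f := by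
    intro u hu hu0
    obtain ⟨w, hw, -, -, h⟩ := hIF' u hu hu0
    exact ⟨_, ⟨w, hw, rfl⟩, h⟩
  obtain ⟨w, hw, hw0, hvw, hvf⟩ := hIF' v hv hv00
  set f₀ : Fin (n + 1) → ℝ := (w 0)⁻¹ • w with hf₀
  have hf₀0 : f₀ 0 = 1 := by simp [hf₀, hw0]
  obtain ⟨r, m, hcr, hm, hmr, hsign⟩ : ∃ r m : ℝ, ‖c‖ < r ∧ 0 < m ∧
      (∀ x, ‖c‖ ≤ x → x ≤ r → m ≤ |Real.log x|) ∧
      ∀ x, ‖c‖ ≤ x → x ≤ r → 0 < -Real.log x / v 0 := by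
    have hlog : Real.log ‖c‖ = -v 0 := by rw [hv0, Real.log_exp]
    rcases lt_or_gt_of_ne hc1 with h | h
    · have hr : Real.log ((1 + ‖c‖) / 2) < 0 := Real.log_neg (by linarith) (by linarith)
      have hx : ∀ x, ‖c‖ ≤ x → x ≤ (1 + ‖c‖) / 2 → Real.log x ≤ Real.log ((1 + ‖c‖) / 2) :=
        fun x h1 h2 ↦ Real.log_le_log (hc0.trans_le h1) h2
      have hv : 0 < v 0 := by linarith [Real.log_neg hc0 h]
      refine ⟨(1 + ‖c‖) / 2, -Real.log ((1 + ‖c‖) / 2), by linarith, by linarith,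
        fun x h1 h2 ↦ ?_, fun x h1 h2 ↦ ?_⟩
      · exact (neg_le_neg (hx x h1 h2)).trans (neg_le_abs _)
      · exact div_pos (by linarith [hx x h1 h2]) hv
    · have hr : 0 < Real.log ‖c‖ := Real.log_pos h
      have hx : ∀ x, ‖c‖ ≤ x → Real.log ‖c‖ ≤ Real.log x := fun x h1 ↦ Real.log_le_log hc0 h1
      refine ⟨‖c‖ + 1, Real.log ‖c‖, by linarith, hr,
        fun x h1 _ ↦ (hx x h1).trans (le_abs_self _), fun x h1 _ ↦ ?_⟩
      exact div_pos_of_neg_of_neg (by linarith [hx x h1]) (by linarith)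
  have hPF : ∀ z : Fin (n + 1) → K, (∀ p ∈ I, MvPolynomial.eval z p = 0) → (∀ j, z j ≠ 0) →
      ‖c‖ ≤ ‖z 0‖ → ‖z 0‖ ≤ r → ∃ f ∈ F, ∀ j, ‖z j‖ = ‖z 0‖ ^ f j := by
    intro z hz hz0 h1 h2
    have hpos : ∀ j, 0 < ‖z j‖ := fun j ↦ norm_pos_iff.2 (hz0 j)
    have hne : Real.log ‖z 0‖ ≠ 0 := fun h ↦ by
      have := hmr _ h1 h2
      rw [h, abs_zero] at this
      linarith
    obtain ⟨f, hf, h⟩ := hIF (fun j ↦ -Real.log ‖z j‖) (subset_closure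
      ⟨z, hz, fun j ↦ by rw [neg_neg, Real.exp_log (hpos j)]⟩) (by simpa using hne)
    refine ⟨f, hf, fun j ↦ ?_⟩
    have hj : -Real.log ‖z j‖ = -Real.log ‖z 0‖ * f j := congrFun h j
    rw [Real.rpow_def_of_pos (hpos 0), ← Real.log_injOn_pos.eq_iff (hpos j) (Real.exp_pos _),
      Real.log_exp]
    linarith
  have hdense : ∀ x, ‖c‖ < x → x < r → ∀ O : Set ℝ, IsOpen O → x ∈ O → ∃ s ∈ O,
      ∃ z : Fin (n + 1) → K, (∀ p ∈ I, MvPolynomial.eval z p = 0) ∧ ‖z 0‖ = s ∧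
        ∀ j, ‖z j‖ = s ^ f₀ j := by
    intro x hx hxr O hO hxO
    have hx0 := hc0.trans hx
    have hs := hsign x hx.le hxr.le
    have hcl : (-Real.log x) • f₀ ∈ closure (negLogSet I) := by
      rw [hIW]
      refine Set.mem_iUnion₂.2 ⟨w, hw, -Real.log x * (w 0)⁻¹, ?_, by rw [hf₀, smul_smul]⟩
      have h3 := mul_pos hs hvw
      rw [div_mul_div_cancel₀ hv00] at h3
      exact h3.le
    obtain ⟨u, ⟨z, hz, hzu⟩, huO, huf⟩ := exists_mem_negLogSet_on_ray hF
      (fun u hu ↦ hIF u (subset_closure hu)) hf₀0 (fun h ↦ by simp [h] at hs) hcl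
      (hO.preimage (Real.continuous_exp.comp continuous_neg)) (s := -Real.log x)
      (by simpa [Real.exp_log hx0] using hxO)
    refine ⟨_, huO, z, hz, hzu 0, fun j ↦ ?_⟩
    rw [hzu j, congrFun huf j]
    rw [Pi.smul_apply, smul_eq_mul, Function.comp_apply, ← Real.exp_mul, neg_mul]
  let S : Ideal (MvPolynomial (Fin (n + 1)) K) → Set ℝ := fun P ↦ {s : ℝ | ‖c‖ < s ∧ s ≤ r ∧
    ∃ z : Fin (n + 1) → K, (∀ p ∈ P, MvPolynomial.eval z p = 0) ∧ ‖z 0‖ = s ∧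
      ∀ j, ‖z j‖ = s ^ f₀ j}
  have hS : (S I).Infinite := by
    intro hfin
    obtain ⟨x, hx⟩ := ((Set.Ioo_infinite hcr).sdiff hfin).nonempty
    obtain ⟨s, ⟨hs1, hs2⟩, hz⟩ := hdense x hx.1.1 hx.1.2 _ (isOpen_Ioo.sdiff hfin.isClosed) hx
    exact hs2 ⟨hs1.1, hs1.2.le, hz⟩
  obtain ⟨P, hP, hSP⟩ : ∃ P ∈ I.minimalPrimes, (S P).Infinite := by
    by_contra! hcon
    refine hS ((I.finite_minimalPrimes_of_isNoetherianRing.biUnion hcon).subset ?_)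
    rintro s ⟨h1, h2, z, hz, h3⟩
    have : (RingHom.ker (MvPolynomial.eval z)).IsPrime := RingHom.ker_isPrime _
    obtain ⟨P, hP, hPz⟩ := Ideal.exists_minimalPrimes_le (I := I)
      (J := RingHom.ker (MvPolynomial.eval z)) hz
    exact Set.mem_biUnion hP ⟨h1, h2, z, fun p hp ↦ hPz hp, h3⟩
  have := hP.1.1
  obtain ⟨ρ, hρ, hρc, hρn⟩ := exists_point_of_isPrime hK hc hcr hm hmr hF
    (fun z hz ↦ hPF z fun p hp ↦ hz p (hP.1.2 hp)) ⟨w, hw, rfl⟩ hSP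
  refine ⟨ρ, ?_, fun j ↦ ?_⟩
  · have hle : I ⊔ Ideal.span {MvPolynomial.X 0 - MvPolynomial.C c} ≤
        RingHom.ker (MvPolynomial.eval ρ) := by
      refine sup_le (fun p hp ↦ hρ p (hP.1.2 hp)) ?_
      rw [Ideal.span_singleton_le_iff_mem, RingHom.mem_ker]
      simp [hρc]
    exact fun p hp ↦ hle hp
  · rw [hρn, hv0, ← Real.exp_mul, neg_mul, ← smul_eq_mul, ← Pi.smul_apply, ← hvf]

end Tropical

section Valuation

/-- A real-valued additive valuation gives the absolute value `exp (-ν a)`. -/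
theorem exists_absoluteValue {K : Type*} [Field K] (ν : K → WithTop ℝ)
    (hν0 : ∀ a : K, ν a = ⊤ ↔ a = 0) (hνM : ∀ a b : K, ν (a * b) = ν a + ν b)
    (hνA : ∀ a b : K, min (ν a) (ν b) ≤ ν (a + b)) :
    ∃ N : AbsoluteValue K ℝ, (∀ a b, N (a + b) ≤ max (N a) (N b)) ∧
      ∀ a (v : ℝ), ν a = v ↔ N a = Real.exp (-v) := by
  have hcoe : ∀ a, a ≠ 0 → ∃ v : ℝ, ν a = v := fun a ha ↦
    (WithTop.ne_top_iff_exists.1 (mt (hν0 a).1 ha)).imp fun _ h ↦ h.symm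
  let e : WithTop ℝ → ℝ := fun v ↦ v.recTopCoe 0 fun x ↦ Real.exp (-x)
  have etop : e ⊤ = 0 := rfl
  have ecoe : ∀ x : ℝ, e x = Real.exp (-x) := fun _ ↦ rfl
  have ezero : e (ν 0) = 0 := by rw [(hν0 0).2 rfl, etop]
  have enonneg : ∀ x, 0 ≤ e x := fun x ↦ by
    cases x with
    | top => exact le_rfl
    | coe x => exact (Real.exp_pos _).le
  have emono : ∀ x y, x ≤ y → e y ≤ e x := by
    intro x y h
    cases y with
    | top => exact enonneg x
    | coe y =>
      cases x with
      | top => simp at h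
      | coe x =>
        rw [ecoe, ecoe]
        exact Real.exp_le_exp.2 (neg_le_neg (WithTop.coe_le_coe.1 h))
  have hmax : ∀ a b, e (ν (a + b)) ≤ max (e (ν a)) (e (ν b)) := by
    intro a b
    refine (emono _ _ (hνA a b)).trans ?_
    rcases min_choice (ν a) (ν b) with h | h <;> rw [h]
    · exact le_max_left _ _
    · exact le_max_right _ _
  refine ⟨⟨⟨fun a ↦ e (ν a), fun a b ↦ ?_⟩, fun a ↦ enonneg _, fun a ↦ ?_, fun a b ↦ ?_⟩, hmax,
    fun a v ↦ ?_⟩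
  · rw [hνM]
    cases ν a with
    | top => simp [etop]
    | coe x =>
      cases ν b with
      | top => simp [etop]
      | coe y => rw [← WithTop.coe_add, ecoe, ecoe, ecoe, ← Real.exp_add]; congr 1; ring
  · refine ⟨fun h ↦ ?_, fun h ↦ by rw [h]; exact ezero⟩
    by_contra ha
    obtain ⟨v, hv⟩ := hcoe a ha
    exact (Real.exp_pos (-v)).ne' (by simpa only [hv, ecoe] using h)
  · exact (hmax a b).trans (max_le_add_of_nonneg (enonneg _) (enonneg _))
  · change ν a = v ↔ e (ν a) = Real.exp (-v)
    refine ⟨fun h ↦ by rw [h, ecoe], fun h ↦ ?_⟩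
    obtain ⟨x, hx⟩ := hcoe a fun ha ↦ (Real.exp_pos (-v)).ne' (by rw [← h, ha, ezero])
    rw [hx, ecoe] at h
    rw [hx, neg_injective (Real.exp_injective h)]

end Valuation

theorem finite_inter_of_subset_rays {n : ℕ} {W T : Set (Fin (n + 1) → ℝ)} (hW : W.Finite)
    (hT : T ⊆ ⋃ w ∈ W, {v | ∃ r : ℝ, 0 ≤ r ∧ v = r • w}) {s : ℝ} (hs : s ≠ 0) :
    (T ∩ {v | v 0 = s}).Finite := by
  refine (hW.image fun w ↦ (s / w 0) • w).subset ?_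
  rintro v ⟨hv, rfl⟩
  obtain ⟨w, hw, r, -, rfl⟩ := Set.mem_iUnion₂.1 (hT hv)
  refine ⟨w, hw, ?_⟩
  rw [Pi.smul_apply, smul_eq_mul] at hs ⊢
  simp only
  rw [mul_div_cancel_right₀ _ (right_ne_zero_of_mul hs)]

theorem tropIdeal_sup_span_subset {K : Type*} [Field K] {ν : K → WithTop ℝ} {n : ℕ}
    (I : Ideal (MvPolynomial (Fin (n + 1)) K)) {c : K} {s : ℝ} (hs : ν c = s) :
    tropIdeal ν (I ⊔ Ideal.span {MvPolynomial.X 0 - MvPolynomial.C c}) ⊆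
      tropIdeal ν I ∩ {v | v 0 = s} := by
  refine closure_minimal ?_ (isClosed_closure.inter
    (isClosed_eq (continuous_apply (0 : Fin (n + 1))) continuous_const))
  rintro v ⟨z, hz0, hz, hzv⟩
  refine ⟨subset_closure ⟨z, hz0, fun p hp ↦ hz p (Ideal.mem_sup_left hp), hzv⟩, ?_⟩
  have h := hz _ (Ideal.mem_sup_right (Ideal.mem_span_singleton_self _))
  rw [map_sub, MvPolynomial.eval_X, MvPolynomial.eval_C, sub_eq_zero] at h
  have h0 := hzv 0
  rw [h, hs] at h0
  exact (WithTop.coe_injective h0).symm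

theorem stmt7 {K : Type*} [Field K] [IsAlgClosed K] (ν : K → WithTop ℝ)
    (hν0 : ∀ a : K, ν a = ⊤ ↔ a = 0)
    (hνM : ∀ a b : K, ν (a * b) = ν a + ν b)
    (hνA : ∀ a b : K, min (ν a) (ν b) ≤ ν (a + b))
    (hνNT : ∃ a : K, a ≠ 0 ∧ ν a ≠ 0)
    {n : ℕ} (I : Ideal (MvPolynomial (Fin (n + 1)) K))
    (hfan : ∃ W : Set (Fin (n + 1) → ℝ), W.Finite ∧
      tropIdeal ν I = ⋃ w ∈ W, {v | ∃ r : ℝ, 0 ≤ r ∧ v = r • w}) :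
    ∀ c : K, c ≠ 0 → ν c ≠ 0 →
      (tropIdeal ν I ∩ {v | (v 0 : WithTop ℝ) = ν c} =
        tropIdeal ν (I ⊔ Ideal.span {MvPolynomial.X 0 - MvPolynomial.C c})) ∧
      (tropIdeal ν I ∩ {v | (v 0 : WithTop ℝ) = ν c}).Finite := by
  obtain ⟨W, hW, hIW⟩ := hfan
  intro c hc hνc
  obtain ⟨N, hNA, hN⟩ := exists_absoluteValue ν hν0 hνM hνA
  have hcoe : ∀ a, a ≠ 0 → ∃ v : ℝ, ν a = v := fun a ha ↦
    (WithTop.ne_top_iff_exists.1 (mt (hν0 a).1 ha)).imp fun _ h ↦ h.symm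
  obtain ⟨s, hs⟩ := hcoe c hc
  have hs0 : s ≠ 0 := fun h ↦ hνc (by rw [hs, h, WithTop.coe_zero])
  have hset : {v : Fin (n + 1) → ℝ | (v 0 : WithTop ℝ) = ν c} = {v | v 0 = s} := by
    ext v
    simp [hs]
  rw [hset]
  refine ⟨(tropIdeal_sup_span_subset I hs).antisymm' ?_,
    finite_inter_of_subset_rays hW hIW.le hs0⟩
  let : NormedField K := N.toNormedField
  have hnorm : ∀ a : K, ‖a‖ = N a := fun _ ↦ rfl
  have : IsUltrametricDist K := IsUltrametricDist.isUltrametricDist_of_forall_norm_add_le_max_norm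
    hNA
  have hraw : ∀ J : Ideal (MvPolynomial (Fin (n + 1)) K),
      tropIdeal ν J = closure (negLogSet J) := fun J ↦ by
    refine congrArg closure (Set.ext fun v ↦ ⟨?_, ?_⟩)
    · rintro ⟨z, -, hz, hzv⟩
      exact ⟨z, hz, fun j ↦ (hN _ _).1 (hzv j)⟩
    · rintro ⟨z, hz, hzv⟩
      refine ⟨z, fun j ↦ ?_, hz, fun j ↦ (hN _ _).2 (hzv j)⟩
      rw [← norm_ne_zero_iff, hzv j]
      exact Real.exp_ne_zero _
  have hNc : ‖c‖ = Real.exp (-s) := (hN c s).1 hs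
  have hc1 : ‖c‖ ≠ 1 := by rw [hNc]; simpa using hs0
  have hK : ∃ x : K, 1 < ‖x‖ := by
    rcases lt_or_gt_of_ne hc1 with h | h
    · exact ⟨c⁻¹, by rw [norm_inv]; exact (one_lt_inv₀ (norm_pos_iff.2 hc)).2 h⟩
    · exact ⟨c, h⟩
  rintro v ⟨hv, hv0 : v 0 = s⟩
  rw [hraw] at hv hIW ⊢
  exact subset_closure (mem_negLogSet_sup_span hK hW hIW hc hc1 hv (by rw [hv0, hNc]))
end

section
/- Let t ∈ Kˣ with ν(t) = 1, and set f_1 = t·x_1² + x_1 + 1, f_2 = t·x_1·x_2² + x_1·x_2 + 1, f_3 = x_1·x_2·x_3 + 1 in K[x_1,x_2,x_3]. Then {(ν(z_1), ν(z_2), ν(z_3)) : z ∈ (Kˣ)³, f_1(z) = f_2(z) = f_3(z) = 0} = {(0,0,0), (0,−1,1), (−1,1,0), (−1,−1,2)}; in particular Trop(⟨f_1,f_2,f_3⟩) equals this set of four points. -/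
open scoped Pointwise

section Valuation

variable {K : Type*} [Field K]

theorem exists_real_val (ν : K → WithTop ℝ) (hν0 : ∀ a : K, ν a = ⊤ ↔ a = 0)
    {a : K} (ha : a ≠ 0) : ∃ r : ℝ, ν a = (r : WithTop ℝ) := by
  obtain ⟨r, hr⟩ := WithTop.ne_top_iff_exists.mp (mt (hν0 a).mp ha)
  exact ⟨r, hr.symm⟩

theorem val_one (ν : K → WithTop ℝ)
    (hν0 : ∀ a : K, ν a = ⊤ ↔ a = 0) (hνM : ∀ a b : K, ν (a * b) = ν a + ν b) :
    ν 1 = ((0 : ℝ) : WithTop ℝ) := by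
  obtain ⟨r, hr⟩ := exists_real_val ν hν0 (one_ne_zero (α := K))
  have h := hνM 1 1
  rw [mul_one, hr] at h
  norm_cast at h
  rw [hr, show r = 0 by linarith]

theorem val_neg_one (ν : K → WithTop ℝ)
    (hν0 : ∀ a : K, ν a = ⊤ ↔ a = 0) (hνM : ∀ a b : K, ν (a * b) = ν a + ν b) :
    ν (-1) = ((0 : ℝ) : WithTop ℝ) := by
  obtain ⟨r, hr⟩ := exists_real_val ν hν0 (neg_ne_zero.mpr (one_ne_zero (α := K)))
  have h := hνM (-1) (-1)
  rw [neg_one_mul, neg_neg, val_one ν hν0 hνM, hr] at h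
  norm_cast at h
  rw [hr, show r = 0 by linarith]

/-- If three elements sum to zero, none has valuation strictly below both others. -/
theorem min_val_le_of_add_eq_zero (ν : K → WithTop ℝ)
    (hν0 : ∀ a : K, ν a = ⊤ ↔ a = 0) (hνM : ∀ a b : K, ν (a * b) = ν a + ν b)
    (hνA : ∀ a b : K, min (ν a) (ν b) ≤ ν (a + b))
    {a b c : K} {x y z : ℝ} (hx : ν a = (x : WithTop ℝ)) (hy : ν b = (y : WithTop ℝ))
    (hz : ν c = (z : WithTop ℝ)) (h : a + b + c = 0) : min x y ≤ z := by
  have h1 : a + b = -1 * c := by linear_combination h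
  have h2 := hνA a b
  rw [h1, hνM, val_neg_one ν hν0 hνM, hx, hy, hz] at h2
  norm_cast at h2
  simpa using h2

/-- The valuations of the roots of `A X² + B X + 1` when its Newton polygon has two slopes. -/
theorem val_root_quadratic (ν : K → WithTop ℝ)
    (hν0 : ∀ a : K, ν a = ⊤ ↔ a = 0) (hνM : ∀ a b : K, ν (a * b) = ν a + ν b)
    (hνA : ∀ a b : K, min (ν a) (ν b) ≤ ν (a + b))
    {A B z : K} {p q x : ℝ} (hA : ν A = (p : WithTop ℝ)) (hB : ν B = (q : WithTop ℝ))
    (hz : ν z = (x : WithTop ℝ)) (hpq : 2 * q < p) (h : A * z ^ 2 + B * z + 1 = 0) :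
    x = -q ∨ x = q - p := by
  have h1 : ν (A * z ^ 2) = ((p + (x + x) : ℝ) : WithTop ℝ) := by
    rw [sq, hνM, hνM, hA, hz]; norm_cast
  have h2 : ν (B * z) = ((q + x : ℝ) : WithTop ℝ) := by
    rw [hνM, hB, hz]; norm_cast
  have h3 := val_one ν hν0 hνM
  have e1 := min_val_le_of_add_eq_zero ν hν0 hνM hνA h1 h2 h3 h
  have e2 := min_val_le_of_add_eq_zero ν hν0 hνM hνA h1 h3 h2 (by linear_combination h)
  have e3 := min_val_le_of_add_eq_zero ν hν0 hνM hνA h2 h3 h1 (by linear_combination h)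
  rw [min_le_iff] at e1 e2 e3
  by_contra! hne
  rcases lt_or_gt_of_ne hne.1 with h4 | h4 <;> rcases lt_or_gt_of_ne hne.2 with h5 | h5 <;>
    rcases e1 with e1 | e1 <;> rcases e2 with e2 | e2 <;> rcases e3 with e3 | e3 <;> linarith

theorem exists_root_quadratic [IsAlgClosed K] {A : K} (B : K) (hA : A ≠ 0) :
    ∃ z : K, A * z ^ 2 + B * z + 1 = 0 := by
  obtain ⟨z, hz⟩ := IsAlgClosed.exists_root
    (Polynomial.C A * Polynomial.X ^ 2 + Polynomial.C B * Polynomial.X + Polynomial.C 1)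
    (by rw [Polynomial.degree_quadratic hA]; norm_num)
  exact ⟨z, by simpa [Polynomial.IsRoot] using hz⟩

/-- Both slopes of the Newton polygon of `A X² + B X + 1` are realised by roots. -/
theorem exists_root_quadratic_val [IsAlgClosed K] (ν : K → WithTop ℝ)
    (hν0 : ∀ a : K, ν a = ⊤ ↔ a = 0) (hνM : ∀ a b : K, ν (a * b) = ν a + ν b)
    (hνA : ∀ a b : K, min (ν a) (ν b) ≤ ν (a + b))
    {A B : K} {p q y : ℝ} (hA : ν A = (p : WithTop ℝ)) (hB : ν B = (q : WithTop ℝ))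
    (hpq : 2 * q < p) (hy : y = -q ∨ y = q - p) :
    ∃ z : K, z ≠ 0 ∧ A * z ^ 2 + B * z + 1 = 0 ∧ ν z = (y : WithTop ℝ) := by
  have hA0 : A ≠ 0 := fun h => by simp [(hν0 A).mpr h] at hA
  obtain ⟨r, hr⟩ := exists_root_quadratic B hA0
  have hr0 : r ≠ 0 := by
    rintro rfl
    simp at hr
  obtain ⟨x, hx⟩ := exists_real_val ν hν0 hr0
  have hxy := val_root_quadratic ν hν0 hνM hνA hA hB hx hpq hr
  by_cases hyx : y = x
  · exact ⟨r, hr0, hr, hyx ▸ hx⟩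
  have hs0 : (A * r)⁻¹ ≠ 0 := inv_ne_zero (mul_ne_zero hA0 hr0)
  refine ⟨(A * r)⁻¹, hs0, ?_, ?_⟩
  · field_simp
    linear_combination hr
  · obtain ⟨s, hs⟩ := exists_real_val ν hν0 hs0
    have h := hνM (A * r) (A * r)⁻¹
    rw [mul_inv_cancel₀ (mul_ne_zero hA0 hr0), val_one ν hν0 hνM, hνM, hA, hx, hs] at h
    norm_cast at h
    rw [hs]
    congr 1
    rcases hxy with hxy | hxy <;> rcases hy with hy | hy <;>
      first | exact absurd (hy.trans hxy.symm) hyx | linarith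

end Valuation

theorem stmt8 {K : Type*} [Field K] [IsAlgClosed K] (ν : K → WithTop ℝ)
    (hν0 : ∀ a : K, ν a = ⊤ ↔ a = 0)
    (hνM : ∀ a b : K, ν (a * b) = ν a + ν b)
    (hνA : ∀ a b : K, min (ν a) (ν b) ≤ ν (a + b))
    (t : K) (ht : ν t = ((1 : ℝ) : WithTop ℝ)) :
    {v : Fin 3 → ℝ | ∃ z : Fin 3 → K, (∀ j, z j ≠ 0) ∧
        t * z 0 ^ 2 + z 0 + 1 = 0 ∧
        t * z 0 * z 1 ^ 2 + z 0 * z 1 + 1 = 0 ∧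
        z 0 * z 1 * z 2 + 1 = 0 ∧
        ∀ j, ν (z j) = (v j : WithTop ℝ)} =
      {![0, 0, 0], ![0, -1, 1], ![-1, 1, 0], ![-1, -1, 2]} ∧
    closure {v : Fin 3 → ℝ | ∃ z : Fin 3 → K, (∀ j, z j ≠ 0) ∧
        t * z 0 ^ 2 + z 0 + 1 = 0 ∧
        t * z 0 * z 1 ^ 2 + z 0 * z 1 + 1 = 0 ∧
        z 0 * z 1 * z 2 + 1 = 0 ∧
        ∀ j, ν (z j) = (v j : WithTop ℝ)} =
      {![0, 0, 0], ![0, -1, 1], ![-1, 1, 0], ![-1, -1, 2]} := by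
  have key : {v : Fin 3 → ℝ | ∃ z : Fin 3 → K, (∀ j, z j ≠ 0) ∧
        t * z 0 ^ 2 + z 0 + 1 = 0 ∧
        t * z 0 * z 1 ^ 2 + z 0 * z 1 + 1 = 0 ∧
        z 0 * z 1 * z 2 + 1 = 0 ∧
        ∀ j, ν (z j) = (v j : WithTop ℝ)} =
      {![0, 0, 0], ![0, -1, 1], ![-1, 1, 0], ![-1, -1, 2]} := by
    have h1 := val_one ν hν0 hνM
    have hm1 := val_neg_one ν hν0 hνM
    ext v
    constructor
    · rintro ⟨z, hz, f1, f2, f3, hv⟩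
      have a0 := val_root_quadratic ν hν0 hνM hνA ht h1 (hv 0) (by norm_num)
        (by linear_combination f1)
      have hA : ν (t * z 0) = ((1 + v 0 : ℝ) : WithTop ℝ) := by
        rw [hνM, ht, hv]; norm_cast
      have a1 := val_root_quadratic ν hν0 hνM hνA hA (hv 0) (hv 1)
        (by rcases a0 with h | h <;> linarith) f2
      have a2 : v 0 + v 1 + v 2 = 0 := by
        have h : z 0 * z 1 * z 2 = -1 := by linear_combination f3
        have h' := congrArg ν h
        rw [hνM, hνM, hm1, hv, hv, hv] at h'
        exact_mod_cast h'
      have hvec : ∀ a b c : ℝ, v 0 = a → v 1 = b → v 2 = c → v = ![a, b, c] := by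
        intro a b c ha hb hc
        ext j
        fin_cases j <;> simpa
      rcases a0 with a0 | a0 <;> rcases a1 with a1 | a1
      · exact Or.inl (hvec _ _ _ (by linarith) (by linarith) (by linarith))
      · exact Or.inr (Or.inl (hvec _ _ _ (by linarith) (by linarith) (by linarith)))
      · exact Or.inr (Or.inr (Or.inl (hvec _ _ _ (by linarith) (by linarith) (by linarith))))
      · exact Or.inr (Or.inr (Or.inr (hvec _ _ _ (by linarith) (by linarith) (by linarith))))
    · have build : ∀ a b c : ℝ, (a = 0 ∨ a = -1) → (b = -a ∨ b = -1) → a + b + c = 0 →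
          ∃ z : Fin 3 → K, (∀ j, z j ≠ 0) ∧
            t * z 0 ^ 2 + z 0 + 1 = 0 ∧
            t * z 0 * z 1 ^ 2 + z 0 * z 1 + 1 = 0 ∧
            z 0 * z 1 * z 2 + 1 = 0 ∧
            ∀ j, ν (z j) = ((![a, b, c] : Fin 3 → ℝ) j : WithTop ℝ) := by
        intro a b c ha hb hc
        obtain ⟨x, hx0, hx, hxa⟩ := exists_root_quadratic_val ν hν0 hνM hνA (y := a) ht h1
          (by norm_num) (by simpa using ha)
        have hA : ν (t * x) = ((1 + a : ℝ) : WithTop ℝ) := by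
          rw [hνM, ht, hxa]; norm_cast
        obtain ⟨y, hy0, hy, hyb⟩ := exists_root_quadratic_val ν hν0 hνM hνA (y := b) hA hxa
          (by rcases ha with h | h <;> linarith)
          (hb.imp id fun h => by linarith)
        have hw0 : -(x * y)⁻¹ ≠ 0 := neg_ne_zero.mpr (inv_ne_zero (mul_ne_zero hx0 hy0))
        have hxyw : x * y * -(x * y)⁻¹ = -1 := by field_simp
        have hwc : ν (-(x * y)⁻¹) = (c : WithTop ℝ) := by
          obtain ⟨s, hs⟩ := exists_real_val ν hν0 hw0
          have h := congrArg ν hxyw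
          rw [hνM, hνM, hm1, hxa, hyb, hs] at h
          norm_cast at h
          rw [hs, show s = c by linarith]
        refine ⟨![x, y, -(x * y)⁻¹], ?_, ?_, hy, ?_, ?_⟩
        · intro j
          fin_cases j
          exacts [hx0, hy0, hw0]
        · change t * x ^ 2 + x + 1 = 0
          linear_combination hx
        · change x * y * -(x * y)⁻¹ + 1 = 0
          linear_combination hxyw
        · intro j
          fin_cases j
          exacts [hxa, hyb, hwc]
      rintro (rfl | rfl | rfl | rfl) <;> exact build _ _ _ (by norm_num) (by norm_num) (by norm_num)
  refine ⟨key, ?_⟩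
  rw [key]
  exact (Set.toFinite _).isClosed.closure_eq
end

section
/- Suppose ν(3) = 1. Then there exist z_1, z_2, z_3 ∈ Kˣ with z_1² + 3z_1 − 1 = 0, z_2² + 9z_2 − 1 = 0, and 3z_3² + (z_1 − z_2)z_3 + 1 = 0, such that (ν(z_1), ν(z_2), ν(z_3)) = (0, 0, −1/2). In particular, (0, 0, −1/2) ∈ Trop(⟨x_1² + 3x_1 − 1, x_2² + 9x_2 − 1, 3x_3² + (x_1 − x_2)x_3 + 1⟩). -/
open scoped Pointwise

theorem exists_quadratic_root {K : Type*} [Field K] [IsAlgClosed K] {a : K} (b c : K)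
    (ha : a ≠ 0) : ∃ z : K, a * z ^ 2 + b * z + c = 0 := by
  obtain ⟨z, hz⟩ := IsAlgClosed.exists_root
    (Polynomial.C a * Polynomial.X ^ 2 + Polynomial.C b * Polynomial.X + Polynomial.C c)
    (by rw [Polynomial.degree_quadratic ha]; decide)
  exact ⟨z, by simpa [Polynomial.IsRoot] using hz⟩

namespace AddValuation

variable {K : Type*} [Field K] (v : AddValuation K (WithTop ℝ))

theorem exists_coe_eq {z : K} (hz : z ≠ 0) : ∃ r : ℝ, v z = (r : WithTop ℝ) := by
  obtain ⟨r, hr⟩ := WithTop.ne_top_iff_exists.mp (v.ne_top_iff.mpr hz)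
  exact ⟨r, hr.symm⟩

/-- A root of `z ^ 2 + c * z - 1` has valuation zero when `c` has nonnegative valuation. -/
theorem eq_zero_of_sq_add_mul_sub_one_eq_zero {c z : K} (hc : 0 ≤ v c)
    (hz : z ^ 2 + c * z - 1 = 0) : v z = ((0 : ℝ) : WithTop ℝ) := by
  have hprod : z * (z + c) = 1 := by linear_combination hz
  have hz0 : z ≠ 0 := left_ne_zero_of_mul_eq_one hprod
  obtain ⟨r, hr⟩ := v.exists_coe_eq hz0
  obtain ⟨s, hs⟩ := v.exists_coe_eq (right_ne_zero_of_mul_eq_one hprod)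
  have hrs : r + s = 0 := by
    have := congrArg v hprod
    rw [v.map_mul, v.map_one, hr, hs] at this
    exact_mod_cast this
  rw [hr]
  congr 1
  rcases lt_trichotomy r 0 with h | h | h
  · have h1 : (r : WithTop ℝ) < v (z + c + -c) :=
      v.map_lt_add (by rw [hs]; exact_mod_cast (by linarith : r < s))
        (by rw [v.map_neg]; exact lt_of_lt_of_le (by exact_mod_cast h) hc)
    rw [add_neg_cancel_right, hr] at h1
    exact absurd h1 (lt_irrefl _)
  · exact h
  · have h1 : (0 : WithTop ℝ) < v z := by rw [hr]; exact_mod_cast h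
    have h2 := v.map_le_add (g := 0) h1.le hc
    rw [hs] at h2
    have : (0 : ℝ) ≤ s := by exact_mod_cast h2
    linarith

/-- The Newton polygon of `t * z ^ 2 + a * z + 1` has a single slope when `v t = 1` and
`1 / 2 ≤ v a`. -/
theorem eq_neg_half_of_quadratic_eq_zero {t a z : K} (ht : v t = ((1 : ℝ) : WithTop ℝ))
    (ha : ((1 / 2 : ℝ) : WithTop ℝ) ≤ v a) (hz : t * z ^ 2 + a * z + 1 = 0) :
    v z = ((-(1 / 2) : ℝ) : WithTop ℝ) := by
  have hz0 : z ≠ 0 := by rintro rfl; simp at hz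
  obtain ⟨r, hr⟩ := v.exists_coe_eq hz0
  have hsq : v (t * z ^ 2) = ((1 + (r + r) : ℝ) : WithTop ℝ) := by
    rw [pow_two, v.map_mul, v.map_mul, ht, hr]; rfl
  have haz : ((1 / 2 + r : ℝ) : WithTop ℝ) ≤ v (a * z) := by
    rw [v.map_mul, hr, WithTop.coe_add]
    gcongr
  have hone : v (1 : K) = ((0 : ℝ) : WithTop ℝ) := v.map_one
  rw [hr]
  congr 1
  rcases lt_trichotomy r (-(1 / 2)) with h | h | h
  · have h1 : ((1 + (r + r) : ℝ) : WithTop ℝ) < v (a * z + 1) :=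
      v.map_lt_add (lt_of_lt_of_le (by exact_mod_cast (by linarith)) haz)
        (by rw [hone]; exact_mod_cast (by linarith))
    rw [← hsq, show a * z + 1 = -(t * z ^ 2) by linear_combination hz, v.map_neg] at h1
    exact absurd h1 (lt_irrefl _)
  · exact h
  · have h1 : ((0 : ℝ) : WithTop ℝ) < v (t * z ^ 2 + a * z) :=
      v.map_lt_add (by rw [hsq]; exact_mod_cast (by linarith))
        (lt_of_lt_of_le (by exact_mod_cast (by linarith)) haz)
    rw [show t * z ^ 2 + a * z = -1 by linear_combination hz, v.map_neg, hone] at h1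
    exact absurd h1 (lt_irrefl _)

theorem half_le_or_half_le_of_one_le_mul {a b : K} (h : ((1 : ℝ) : WithTop ℝ) ≤ v (a * b)) :
    ((1 / 2 : ℝ) : WithTop ℝ) ≤ v a ∨ ((1 / 2 : ℝ) : WithTop ℝ) ≤ v b := by
  by_contra! hlt
  obtain ⟨r, hr⟩ := WithTop.ne_top_iff_exists.mp hlt.1.ne_top
  obtain ⟨s, hs⟩ := WithTop.ne_top_iff_exists.mp hlt.2.ne_top
  rw [v.map_mul] at h
  rw [← hr, ← hs] at h hlt
  norm_cast at h hlt
  linarith [hlt.1, hlt.2]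

end AddValuation

theorem stmt9 {K : Type*} [Field K] [IsAlgClosed K] (ν : K → WithTop ℝ)
    (hν0 : ∀ a : K, ν a = ⊤ ↔ a = 0)
    (hνM : ∀ a b : K, ν (a * b) = ν a + ν b)
    (hνA : ∀ a b : K, min (ν a) (ν b) ≤ ν (a + b))
    (h3 : ν (3 : K) = ((1 : ℝ) : WithTop ℝ)) :
    (∃ z1 z2 z3 : K, z1 ≠ 0 ∧ z2 ≠ 0 ∧ z3 ≠ 0 ∧
      z1 ^ 2 + 3 * z1 - 1 = 0 ∧ z2 ^ 2 + 9 * z2 - 1 = 0 ∧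
      3 * z3 ^ 2 + (z1 - z2) * z3 + 1 = 0 ∧
      ν z1 = ((0 : ℝ) : WithTop ℝ) ∧ ν z2 = ((0 : ℝ) : WithTop ℝ) ∧
      ν z3 = ((-(1 / 2) : ℝ) : WithTop ℝ)) ∧
    (![0, 0, -(1 / 2)] : Fin 3 → ℝ) ∈
      closure {v : Fin 3 → ℝ | ∃ z : Fin 3 → K, (∀ j, z j ≠ 0) ∧
        z 0 ^ 2 + 3 * z 0 - 1 = 0 ∧ z 1 ^ 2 + 9 * z 1 - 1 = 0 ∧
        3 * z 2 ^ 2 + (z 0 - z 1) * z 2 + 1 = 0 ∧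
        ∀ j, ν (z j) = (v j : WithTop ℝ)} := by
  have hν_one : ν 1 = 0 := by
    obtain ⟨r, hr⟩ := WithTop.ne_top_iff_exists.mp (mt (hν0 1).mp one_ne_zero)
    have h := hνM 1 1
    rw [mul_one, ← hr] at h
    rw [← hr]
    norm_cast at h ⊢
    linarith
  let v : AddValuation K (WithTop ℝ) := AddValuation.of ν ((hν0 0).mpr rfl) hν_one hνA hνM
  have hv3 : v 3 = ((1 : ℝ) : WithTop ℝ) := h3
  have hv3_nonneg : 0 ≤ v 3 := by rw [hv3]; exact_mod_cast zero_le_one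
  have hv9_nonneg : 0 ≤ v 9 := by
    rw [show (9 : K) = 3 * 3 by norm_num, v.map_mul]
    exact add_nonneg hv3_nonneg hv3_nonneg
  have h3_ne : (3 : K) ≠ 0 := v.ne_top_iff.mp (by rw [hv3]; exact WithTop.coe_ne_top)
  obtain ⟨z1, hz1⟩ : ∃ z : K, z ^ 2 + 3 * z - 1 = 0 := by
    simpa [sub_eq_add_neg] using exists_quadratic_root (a := (1 : K)) 3 (-1) one_ne_zero
  obtain ⟨y, hy⟩ : ∃ z : K, z ^ 2 + 9 * z - 1 = 0 := by
    simpa [sub_eq_add_neg] using exists_quadratic_root (a := (1 : K)) 9 (-1) one_ne_zero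
  have hv1 := v.eq_zero_of_sq_add_mul_sub_one_eq_zero hv3_nonneg hz1
  obtain ⟨z2, hz2, hdiff⟩ : ∃ z : K, z ^ 2 + 9 * z - 1 = 0 ∧
      ((1 / 2 : ℝ) : WithTop ℝ) ≤ v (z1 - z) := by
    have hprod : ((1 : ℝ) : WithTop ℝ) ≤ v ((z1 - y) * (z1 - (-9 - y))) := by
      rw [show (z1 - y) * (z1 - (-9 - y)) = 3 * z1 + 3 * z1 by linear_combination hz1 - hy]
      have h : v (3 * z1) = ((1 : ℝ) : WithTop ℝ) := by
        rw [v.map_mul, hv3, hv1, WithTop.coe_zero, add_zero]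
      exact v.map_le_add h.ge h.ge
    rcases v.half_le_or_half_le_of_one_le_mul hprod with h | h
    · exact ⟨y, hy, h⟩
    · exact ⟨-9 - y, by linear_combination hy, h⟩
  have hv2 := v.eq_zero_of_sq_add_mul_sub_one_eq_zero hv9_nonneg hz2
  obtain ⟨z3, hz3⟩ := exists_quadratic_root (z1 - z2) 1 h3_ne
  have hv3' := v.eq_neg_half_of_quadratic_eq_zero hv3 hdiff hz3
  have hne1 : z1 ≠ 0 := by rintro rfl; simp at hz1
  have hne2 : z2 ≠ 0 := by rintro rfl; simp at hz2
  have hne3 : z3 ≠ 0 := by rintro rfl; simp at hz3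
  refine ⟨⟨z1, z2, z3, hne1, hne2, hne3, hz1, hz2, hz3, hv1, hv2, hv3'⟩, subset_closure ?_⟩
  refine ⟨![z1, z2, z3], ?_, hz1, hz2, hz3, ?_⟩
  · intro j
    fin_cases j
    exacts [hne1, hne2, hne3]
  · intro j
    fin_cases j
    exacts [hv1, hv2, hv3']
end
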